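/- Observability inequality at any time T > T_opt in the time-analytic setting (dual formulation of Theorem 1.3 of the paper, restricted to classical adjoint solutions). Let k ≥ m ≥ 1 and n = k+m. Let λ₁,…,λ_{k+m} : [0,1] → (0,∞) be C² functions with λ₁(x) > ⋯ > λ_k(x) > 0 and 0 < λ_{k+1}(x) < ⋯ < λ_{k+m}(x) for every x; set Σ(x) = diag(−λ₁(x),…,−λ_k(x), λ_{k+1}(x),…,λ_{k+m}(x)), Σ₋(x), Σ₊(x) its negative and positive diagonal blocks, τ_i = ∫₀¹ dx/λ_i(x), T₁ = τ_k + τ_{k+1}, and T_opt = max{τ_{k+1−m}+τ_{k+1}, …, τ_k+τ_{k+m}}. Let B ∈ ℝ^{k×m} be such that for every 1 ≤ i ≤ m the i×i matrix formed from the last i rows and the last i columns of B is invertible. Let C : [0,∞) × [0,1] → ℝ^{n×n} be continuous and such that the map t ↦ C(t,·) is real-analytic on some open interval I containing [0, T₁], as a map into the Banach space C([0,1]; ℝ^{n×n}) with the supremum norm. Then for every T > T_opt there exists a constant c_T > 0 such that every continuously differentiable v : [0,T] × [0,1] → ℝⁿ satisfying ∂_t v(t,x) = Σ(x) ∂_x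 v(t,x) + (Σ′(x) − C(t,x)ᵀ) v(t,x) on [0,T] × [0,1], v₋(t,1) = 0 for all t, and Σ₊(0) v₊(t,0) = −Bᵀ Σ₋(0) v₋(t,0) for all t, obeys ∫₀ᵀ |v₊(t,1)|² dt ≥ c_T ∫₀¹ |v(0,x)|² dx. -/

import Mathlib

open Set

namespace Obs
open Filter Topology

def FRk {X : Type*} [NormedAddCommGroup X] [NormedSpace ℝ X] (T : X →L[ℝ] X) : Prop :=
  ∃ (n : ℕ) (e : (Fin n → ℝ) →L[ℝ] X) (r : X →L[ℝ] (Fin n → ℝ)), ‖T - e ∘L r‖ < 1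

lemma frk_of_equicont {Ω : Type*} [TopologicalSpace Ω] [CompactSpace Ω] [T2Space Ω]
    {V : Type*} [NormedAddCommGroup V] [NormedSpace ℝ V] [FiniteDimensional ℝ V]
    (T : C(Ω, V) →L[ℝ] C(Ω, V))
    (h : ∀ p : Ω, ∀ᶠ q in 𝓝 p, ∀ g : C(Ω, V), ‖g‖ ≤ 1 → ‖T g q - T g p‖ ≤ 1/2) : FRk T := by
  classical
  choose U hU using fun p => (eventually_iff_exists_mem.1 (h p))
  have hUo : ∀ p, p ∈ interior (U p) := fun p => mem_interior_iff_mem_nhds.2 (hU p).1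
  obtain ⟨J, hJ⟩ := isCompact_univ.elim_finite_subcover (fun p => interior (U p))
    (fun p => isOpen_interior) (fun p _ => mem_iUnion.2 ⟨p, hUo p⟩)
  obtain ⟨ρ, hρ⟩ := PartitionOfUnity.exists_isSubordinate (s := (univ : Set Ω)) isClosed_univ
    (fun p : J => interior (U p)) (fun p => isOpen_interior) (by
      intro x hx
      obtain ⟨i, hi, hx⟩ := mem_iUnion₂.1 (hJ hx)
      exact mem_iUnion.2 ⟨⟨i, hi⟩, hx⟩)
  let N := J → V
  let mk : J → V →L[ℝ] C(Ω, V) := fun j => LinearMap.mkContinuous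
    { toFun := fun v => ⟨fun x => ρ j x • v, by fun_prop⟩
      map_add' := by intro a b; ext x; simp
      map_smul' := by intro c a; ext x; exact smul_comm _ _ _ } 1 (by
        intro v
        rw [one_mul]
        refine (ContinuousMap.norm_le _ (norm_nonneg _)).2 (fun x => ?_)
        simp only [LinearMap.coe_mk, AddHom.coe_mk, ContinuousMap.coe_mk, norm_smul]
        rw [Real.norm_of_nonneg (ρ.nonneg j x)]
        exact mul_le_of_le_one_left (norm_nonneg _) (ρ.le_one j x))
  let e : N →L[ℝ] C(Ω, V) := ∑ j : J, (mk j) ∘L (ContinuousLinearMap.proj j)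
  let r : C(Ω, V) →L[ℝ] N := ContinuousLinearMap.pi
    (fun j : J => (ContinuousMap.evalCLM ℝ (j : Ω)) ∘L T)
  have key : ‖T - e ∘L r‖ ≤ 1/2 := by
    refine ContinuousLinearMap.opNorm_le_of_unit_norm (by norm_num) (fun g hg => ?_)
    refine (ContinuousMap.norm_le _ (by norm_num)).2 (fun x => ?_)
    have h1 : ∑ j : J, ρ j x = 1 := by
      have := ρ.sum_eq_one (mem_univ x)
      rwa [finsum_eq_sum_of_fintype] at this
    have h2 : (T - e ∘L r) g x = ∑ j : J, ρ j x • (T g x - T g j) := by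
      simp only [smul_sub, Finset.sum_sub_distrib, ← Finset.sum_smul, h1, one_smul]
      simp [e, r, mk, ContinuousMap.evalCLM]
      rfl
    rw [h2]
    calc ‖∑ j : J, ρ j x • (T g x - T g j)‖ ≤ ∑ j : J, ρ j x * (1/2) := by
          refine norm_sum_le_of_le _ (fun j _ => ?_)
          rw [norm_smul, Real.norm_of_nonneg (ρ.nonneg j x)]
          by_cases h0 : ρ j x = 0
          · simp [h0]
          · refine mul_le_mul_of_nonneg_left ?_ (ρ.nonneg j x)
            have : x ∈ interior (U j) := hρ j (subset_tsupport _ h0)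
            exact (hU j).2 x (interior_subset this) g hg.le
      _ = 1/2 := by rw [← Finset.sum_mul, h1, one_mul]
  let φ : N ≃L[ℝ] (Fin (Module.finrank ℝ N) → ℝ) :=
    ContinuousLinearEquiv.ofFinrankEq (by simp)
  refine ⟨_, e ∘L φ.symm.toContinuousLinearMap, φ.toContinuousLinearMap ∘L r, ?_⟩
  have : (e ∘L φ.symm.toContinuousLinearMap) ∘L (φ.toContinuousLinearMap ∘L r) = e ∘L r := by
    ext1 x; simp
  rw [this]; linarith

lemma rank_generic {n : ℕ} {Y : Type*} [NormedAddCommGroup Y] [NormedSpace ℝ Y] [CompleteSpace Y]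
    (M : ℝ → (Fin n → ℝ) →L[ℝ] Y) (t : ℝ) (hM : AnalyticAt ℝ M t) :
    ∃ d : ℕ, ∀ᶠ t' in 𝓝[≠] t, Module.finrank ℝ (M t').ker = d := by
  classical
  obtain ⟨U, hU⟩ := hM.exists_ball_analyticOnNhd
  obtain ⟨hr, hU⟩ := hU
  let rk : ℝ → ℕ := fun t => Module.finrank ℝ (M t).range
  have hrk : ∀ s, rk s + Module.finrank ℝ (M s).ker = n := by
    intro s
    have := LinearMap.finrank_range_add_finrank_ker (M s).toLinearMap
    simpa using this
  let P : ℕ → Prop := fun ρ => ∃ᶠ s in 𝓝[≠] t, ρ ≤ rk s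
  have hP0 : P 0 := by
    simp only [P, zero_le, frequently_true_iff_neBot]; infer_instance
  have hPn : ∀ ρ, P ρ → ρ ≤ n := by
    intro ρ h
    obtain ⟨s, hs⟩ := h.exists
    have := hrk s; omega
  let R := Nat.findGreatest P n
  have hR : P R := Nat.findGreatest_spec (Nat.zero_le _) hP0
  have hR1 : ∀ᶠ s in 𝓝[≠] t, rk s ≤ R := by
    by_contra hc
    have h2 : P (R+1) := by
      refine (not_eventually.1 hc).mono ?_
      intro s hs; omega
    have := Nat.le_findGreatest (hPn _ h2) h2
    have h3 : R + 1 ≤ R := this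
    omega
  have hball : ∀ᶠ s in 𝓝[≠] t, s ∈ Metric.ball t U :=
    eventually_nhdsWithin_of_eventually_nhds (Metric.ball_mem_nhds t hr)
  obtain ⟨t1, ht1, ht1b⟩ := (hR.and_eventually hball).exists
  obtain ⟨f, hf⟩ := exists_linearIndependent_of_le_finrank (R := ℝ) (M := (M t1).range) ht1
  have hc : ∀ i, ∃ c, M t1 c = f i := fun i => (f i).2
  choose c hc using hc
  have hf' : LinearIndependent ℝ (fun i => (f i : Y)) := hf.map' _ (Submodule.ker_subtype _)
  have hψ : ∃ ψ : Y →L[ℝ] (Fin R → ℝ), ∀ i, ψ (f i) = Pi.single i 1 := by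
    let S := Submodule.span ℝ (Set.range (fun i => (f i : Y)))
    let b := Module.Basis.span hf'
    have : FiniteDimensional ℝ S := FiniteDimensional.span_of_finite ℝ (Set.finite_range _)
    obtain ⟨p, hp⟩ := Submodule.ClosedComplemented.of_finiteDimensional S
    refine ⟨(LinearMap.toContinuousLinearMap b.equivFun.toLinearMap) ∘L p, fun i => ?_⟩
    have hmem : (f i : Y) = ((b i : S) : Y) := by simp [b, Module.Basis.span_apply]
    rw [hmem]
    simp [hp]
    ext j; simp [Finsupp.single_apply, Pi.single_apply, eq_comm]
  obtain ⟨ψ, hψ⟩ := hψ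
  let D : ℝ → ℝ := fun s => Matrix.det (Matrix.of fun i j => ψ (M s (c i)) j)
  have hD1 : D t1 = 1 := by
    simp only [D, hc, hψ]
    have : (Matrix.of fun i j => (Pi.single i 1 : Fin R → ℝ) j) = (1 : Matrix (Fin R) (Fin R) ℝ) := by
      ext i j
      simp [Matrix.one_apply, Pi.single_apply, eq_comm]
    rw [this, Matrix.det_one]
  have hDa : AnalyticOnNhd ℝ D (Metric.ball t U) := by
    have : ∀ i j, AnalyticOnNhd ℝ (fun s => ψ (M s (c i)) j) (Metric.ball t U) := by
      intro i j
      let L : ((Fin n → ℝ) →L[ℝ] Y) →L[ℝ] ℝ :=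
        (ContinuousLinearMap.proj j) ∘L ψ ∘L (ContinuousLinearMap.apply ℝ Y (c i))
      exact fun s hs => (L.analyticAt _).comp (hU s hs)
    simp only [D, Matrix.det_apply, Matrix.of_apply]
    refine Finset.analyticOnNhd_fun_sum _ (fun σ _ => ?_)
    have h2 : AnalyticOnNhd ℝ (fun s => ∏ i, ψ (M s (c (σ i))) i) (Metric.ball t U) :=
      Finset.analyticOnNhd_fun_prod _ (fun i _ => this _ _)
    intro s hs
    have := (analyticAt_const (v := ((Equiv.Perm.sign σ : ℤ) : ℝ))).mul (h2 s hs)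
    simp only [Units.smul_def, zsmul_eq_mul]
    exact this
  have hD2 : ∀ᶠ s in 𝓝[≠] t, D s ≠ 0 := by
    rcases (hDa t (Metric.mem_ball_self hr)).eventually_eq_zero_or_eventually_ne_zero with h | h
    · exfalso
      have := hDa.eqOn_zero_of_preconnected_of_eventuallyEq_zero
        (convex_ball t U).isPreconnected (Metric.mem_ball_self hr) h ht1b
      rw [hD1] at this
      exact one_ne_zero this
    · exact h
  refine ⟨n - R, ?_⟩
  filter_upwards [hR1, hD2] with s h1 h2
  have h3 : R ≤ rk s := by
    have hli : LinearIndependent ℝ (fun i => ψ (M s (c i))) := by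
      have := Matrix.linearIndependent_rows_of_det_ne_zero h2
      exact this
    have hli2 : LinearIndependent ℝ (fun i => M s (c i)) := LinearIndependent.of_comp ψ.toLinearMap hli
    have hli3 : LinearIndependent ℝ (fun i => (⟨M s (c i), ⟨c i, rfl⟩⟩ : (M s).range)) :=
      LinearIndependent.of_comp (M s).range.subtype hli2
    have := hli3.fintype_card_le_finrank
    simpa using this
  have := hrk s
  omega

end Obs

open Set
namespace Obs
open Filter Topology

section GC
set_option linter.unusedSectionVars false
variable {X Y Z : Type*} [NormedAddCommGroup X] [NormedSpace ℝ X] [CompleteSpace X]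
  [NormedAddCommGroup Y] [NormedSpace ℝ Y] [CompleteSpace Y]
  [NormedAddCommGroup Z] [NormedSpace ℝ Z] [CompleteSpace Z]

lemma analyticAt_clm_comp {X Y Z : Type*} [NormedAddCommGroup X] [NormedSpace ℝ X]
    [NormedAddCommGroup Y] [NormedSpace ℝ Y]
    [NormedAddCommGroup Z] [NormedSpace ℝ Z]
    {f : ℝ → Y →L[ℝ] Z} {g : ℝ → X →L[ℝ] Y} {t : ℝ} (hf : AnalyticAt ℝ f t)
    (hg : AnalyticAt ℝ g t) : AnalyticAt ℝ (fun s => f s ∘L g s) t := by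
  have h1 := ContinuousLinearMap.analyticAt_bilinear (ContinuousLinearMap.compL ℝ X Y Z) (f t, g t)
  exact AnalyticAt.comp (f := fun s => (f s, g s)) h1 (hf.prod hg)

lemma ker_of_fr {n : ℕ} (A : X →L[ℝ] Y) (P : Y →L[ℝ] X) (T G : X →L[ℝ] X) (hP : P ∘L A = 1 - T)
    (e : (Fin n → ℝ) →L[ℝ] X) (r : X →L[ℝ] (Fin n → ℝ))
    (h1 : G * (1 - (T - e ∘L r)) = 1) (h2 : (1 - (T - e ∘L r)) * G = 1) :
    FiniteDimensional ℝ A.ker ∧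
      Module.finrank ℝ A.ker + Module.finrank ℝ e.ker
        = Module.finrank ℝ ((A ∘L G ∘L e : (Fin n → ℝ) →L[ℝ] Y)).ker := by
  have hz : ∀ z, A z = 0 → G (e (r z)) = z := by
    intro z hz
    have h3 : P (A z) = z - T z := congrArg (fun L : X →L[ℝ] X => L z) hP
    rw [hz, map_zero] at h3
    have h4 : G (z - (T z - e (r z))) = z := congrArg (fun L : X →L[ℝ] X => L z) h1
    rwa [← sub_add, ← h3, zero_add] at h4
  have hG : ∀ y, G y = 0 → y = 0 := by
    intro y hy
    have h4 : (1 - (T - e ∘L r)) (G y) = y := congrArg (fun L : X →L[ℝ] X => L y) h2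
    rw [← h4, hy, map_zero]
  let M : (Fin n → ℝ) →L[ℝ] Y := A ∘L G ∘L e
  let Φ : M.ker →ₗ[ℝ] A.ker := LinearMap.codRestrict _
    ((G ∘L e).toLinearMap ∘ₗ M.ker.subtype) (fun c => c.2)
  have hsurj : Function.Surjective Φ := by
    intro z
    have hz' := hz z.1 z.2
    refine ⟨⟨r z.1, ?_⟩, Subtype.ext hz'⟩
    change A (G (e (r z.1))) = 0
    rw [hz']; exact z.2
  have hfd : FiniteDimensional ℝ A.ker := Module.Finite.of_surjective Φ hsurj
  refine ⟨hfd, ?_⟩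
  have h5 := LinearMap.finrank_range_add_finrank_ker Φ
  rw [LinearMap.range_eq_top.2 hsurj, finrank_top] at h5
  change _ = Module.finrank ℝ M.ker
  rw [← h5]
  congr 1
  have hle : e.ker ≤ M.ker := by
    intro c hc
    have : e c = 0 := hc
    change A (G (e c)) = 0
    simp [this]
  have h6 : Φ.ker.map M.ker.subtype = e.ker := by
    ext c
    constructor
    · rintro ⟨d, hd, rfl⟩
      have : G (e d) = 0 := congrArg Subtype.val hd
      exact hG _ this
    · intro hc
      refine ⟨⟨c, hle hc⟩, ?_, rfl⟩
      have : e c = 0 := hc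
      refine Subtype.ext ?_
      change G (e c) = 0
      simp [this]
  rw [← h6]; exact Submodule.finrank_map_subtype_eq _ _

lemma inv_of_fr (T : X →L[ℝ] X) (h : ‖T‖ < 1) :
    ∃ u : (X →L[ℝ] X)ˣ, (u : X →L[ℝ] X) = 1 - T := ⟨Units.oneSub T h, rfl⟩

lemma ker_finite (A : X →L[ℝ] Y) (T : X →L[ℝ] X) (P : Y →L[ℝ] X) (hP : P ∘L A = 1 - T)
    (hT : FRk T) : FiniteDimensional ℝ A.ker := by
  obtain ⟨n, e, r, h⟩ := hT
  obtain ⟨u, hu⟩ := inv_of_fr _ h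
  exact (ker_of_fr A P T (↑u⁻¹) hP e r (by rw [← hu]; simp) (by rw [← hu]; simp)).1

lemma gc_local (A : ℝ → X →L[ℝ] Y) (T : ℝ → X →L[ℝ] X) (t : ℝ) (hA : AnalyticAt ℝ A t)
    (hT : AnalyticAt ℝ T t) (hfr : FRk (T t))
    (hP : ∀ᶠ s in 𝓝 t, ∃ P : Y →L[ℝ] X, P ∘L A s = 1 - T s) :
    ∃ g : ℕ, ∀ᶠ s in 𝓝[≠] t, Module.finrank ℝ (A s).ker = g := by
  obtain ⟨n, e, r, h⟩ := hfr
  let G : ℝ → X →L[ℝ] X := fun s => Ring.inverse (1 - (T s - e ∘L r))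
  obtain ⟨u, hu⟩ := inv_of_fr _ h
  have hTs : AnalyticAt ℝ (fun s => 1 - (T s - e ∘L r)) t :=
    analyticAt_const.sub (hT.sub analyticAt_const)
  have hGa : AnalyticAt ℝ G t := by
    have := analyticAt_inverse (𝕜 := ℝ) u
    rw [hu] at this
    exact AnalyticAt.fun_comp this hTs
  have hM : AnalyticAt ℝ (fun s => (A s ∘L G s ∘L e : (Fin n → ℝ) →L[ℝ] Y)) t :=
    analyticAt_clm_comp hA (analyticAt_clm_comp hGa analyticAt_const)
  obtain ⟨d, hd⟩ := rank_generic _ t hM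
  refine ⟨d - Module.finrank ℝ e.ker, ?_⟩
  have hlt : ∀ᶠ s in 𝓝 t, ‖T s - e ∘L r‖ < 1 :=
    (hT.continuousAt.sub continuousAt_const).norm.eventually_lt continuousAt_const h
  filter_upwards [hd, eventually_nhdsWithin_of_eventually_nhds hlt,
    eventually_nhdsWithin_of_eventually_nhds hP] with s h1 h2 ⟨P, hP⟩
  obtain ⟨v, hv⟩ := inv_of_fr _ h2
  have hGs : G s = ↑v⁻¹ := by simp only [G]; rw [← hv, Ring.inverse_unit]
  have := (ker_of_fr (A s) P (T s) (G s) hP e r (by rw [hGs, ← hv]; simp)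
    (by rw [hGs, ← hv]; simp)).2
  rw [h1] at this
  omega

lemma generic_const {a b : ℝ} (hab : a < b) (f : ℝ → ℕ)
    (h : ∀ t ∈ Ioo a b, ∃ g : ℕ, ∀ᶠ s in 𝓝[≠] t, f s = g) :
    ∃ g : ℕ, ∀ t ∈ Ioo a b, ∀ᶠ s in 𝓝[≠] t, f s = g := by
  classical
  choose! g hg using h
  have hcont : ContinuousOn g (Ioo a b) := by
    intro t ht
    refine ContinuousAt.continuousWithinAt ?_
    have h1 := hg t ht
    have h2 : ∀ᶠ s in 𝓝[≠] t, ∀ᶠ r in 𝓝[≠] s, f r = g t := by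
      rw [eventually_nhdsWithin_iff] at h1
      have := eventually_eventually_nhds.2 h1
      filter_upwards [eventually_nhdsWithin_of_eventually_nhds this, self_mem_nhdsWithin] with s hs hst
      have hst' : s ≠ t := hst
      have : ∀ᶠ r in 𝓝[≠] s, r ≠ t :=
        eventually_nhdsWithin_of_eventually_nhds (isOpen_ne.mem_nhds hst')
      filter_upwards [eventually_nhdsWithin_of_eventually_nhds hs, this] with r h1 h2
      exact h1 h2
    have h3 : ∀ᶠ s in 𝓝 t, g s = g t := by
      rw [eventually_nhdsWithin_iff] at h2
      filter_upwards [h2, isOpen_Ioo.mem_nhds ht] with s hs hs2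
      by_cases hst : s = t
      · rw [hst]
      · obtain ⟨r, hr1, hr2⟩ := ((hs hst).and (hg s hs2)).exists
        rw [← hr1, ← hr2]
    exact (continuousAt_const (y := g t)).congr (h3.mono fun s hs => hs.symm)
  obtain ⟨c, hc⟩ := exists_between hab
  refine ⟨g c, fun t ht => ?_⟩
  rw [← isPreconnected_Ioo.constant hcont ht hc]
  exact hg t ht

lemma gc_image {a b : ℝ} (hab : a < b) (A : ℝ → X →L[ℝ] Y) (T : ℝ → X →L[ℝ] X) (W : X →L[ℝ] Z)
    (hA : AnalyticOnNhd ℝ A (Ioo a b)) (hT : AnalyticOnNhd ℝ T (Ioo a b))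
    (hfr : ∀ t ∈ Ioo a b, FRk (T t))
    (hP : ∀ t ∈ Ioo a b, ∃ P : Y →L[ℝ] X, P ∘L A t = 1 - T t) :
    (∀ t ∈ Ioo a b, FiniteDimensional ℝ ((A t).ker.map W.toLinearMap)) ∧
    ∃ g : ℕ, ∀ t ∈ Ioo a b, ∀ᶠ s in 𝓝[≠] t, Module.finrank ℝ ((A s).ker.map W.toLinearMap) = g := by
  have hfd : ∀ t ∈ Ioo a b, FiniteDimensional ℝ (A t).ker := by
    intro t ht
    obtain ⟨P, hP⟩ := hP t ht
    exact ker_finite _ _ P hP (hfr t ht)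
  refine ⟨fun t ht => by have := hfd t ht; infer_instance, generic_const hab _ fun t ht => ?_⟩
  have hPe : ∀ᶠ s in 𝓝 t, ∃ P : Y →L[ℝ] X, P ∘L A s = 1 - T s := by
    filter_upwards [isOpen_Ioo.mem_nhds ht] with s hs using hP s hs
  obtain ⟨g1, hg1⟩ := gc_local A T t (hA t ht) (hT t ht) (hfr t ht) hPe
  have hprod : AnalyticAt ℝ (fun s => (A s).prod W) t := by
    have : (fun s => (A s).prod W) = fun s =>
        (ContinuousLinearMap.inl ℝ Y Z) ∘L (A s) + (ContinuousLinearMap.inr ℝ Y Z) ∘L W := by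
      funext s; ext x <;> simp
    rw [this]
    exact (analyticAt_clm_comp analyticAt_const (hA t ht)).add analyticAt_const
  obtain ⟨g2, hg2⟩ := gc_local (fun s => (A s).prod W) T t hprod (hT t ht) (hfr t ht) (by
    filter_upwards [hPe] with s ⟨P, hP⟩
    exact ⟨P ∘L ContinuousLinearMap.fst ℝ Y Z, by rw [← hP]; ext x; simp⟩)
  refine ⟨g1 - g2, ?_⟩
  filter_upwards [hg1, hg2, eventually_nhdsWithin_of_eventually_nhds (isOpen_Ioo.mem_nhds ht)]
    with s h1 h2 h3
  have := hfd s h3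
  let Φ : (A s).ker →ₗ[ℝ] Z := W.toLinearMap ∘ₗ (A s).ker.subtype
  have h5 := LinearMap.finrank_range_add_finrank_ker Φ
  have h6 : Φ.range = (A s).ker.map W.toLinearMap := by
    simp [Φ, LinearMap.range_comp]
  have h7 : Φ.ker.map (A s).ker.subtype = ((A s).prod W).ker := by
    ext c
    simp only [Submodule.mem_map, LinearMap.mem_ker, Subtype.exists, Submodule.subtype_apply]
    constructor
    · rintro ⟨d, hd, h, rfl⟩
      exact Prod.ext hd h
    · intro h
      exact ⟨c, congrArg Prod.fst h, congrArg Prod.snd h, rfl⟩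
  have h8 : Module.finrank ℝ Φ.ker = g2 := by
    rw [← h2, ← h7]; exact (Submodule.finrank_map_subtype_eq _ _).symm
  rw [← h6]
  omega

lemma ob_lemma (A : X →L[ℝ] Y) (T : X →L[ℝ] X) (P : Y →L[ℝ] X) (hP : P ∘L A = 1 - T)
    (hT : FRk T) (W : X →L[ℝ] Z) (hW : ∀ z, A z = 0 → W z = 0) :
    ∃ c : ℝ, 0 ≤ c ∧ ∀ z, ‖W z‖ ≤ c * ‖A z‖ := by
  obtain ⟨n, e, r, h⟩ := hT
  obtain ⟨u, hu⟩ := inv_of_fr _ h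
  let G : X →L[ℝ] X := ↑u⁻¹
  have h1 : G * (1 - (T - e ∘L r)) = 1 := by rw [← hu]; simp [G]
  let M : (Fin n → ℝ) →L[ℝ] Y := A ∘L G ∘L e
  obtain ⟨s, hs⟩ := M.toLinearMap.rangeRestrict.exists_rightInverse_of_surjective
    (LinearMap.range_rangeRestrict _)
  let sc : M.range →L[ℝ] (Fin n → ℝ) := LinearMap.toContinuousLinearMap s
  have hs' : ∀ c, W (G (e c)) = W (G (e (sc ⟨M c, ⟨c, rfl⟩⟩))) := by
    intro c
    have h2 : M (s ⟨M c, ⟨c, rfl⟩⟩) = M c :=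
      congrArg Subtype.val (congrArg (fun L : M.range →ₗ[ℝ] M.range => L ⟨M c, ⟨c, rfl⟩⟩) hs)
    have h3 : W (G (e (c - s ⟨M c, ⟨c, rfl⟩⟩))) = 0 := by
      apply hW
      change M (c - s ⟨M c, ⟨c, rfl⟩⟩) = 0
      rw [map_sub, h2, sub_self]
    rw [map_sub, map_sub, map_sub, sub_eq_zero] at h3
    exact h3
  let W1 : M.range →L[ℝ] Z := W ∘L G ∘L e ∘L sc
  refine ⟨‖W ∘L G ∘L P‖ + ‖W1‖ * (1 + ‖A ∘L G ∘L P‖), by positivity, fun z => ?_⟩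
  have h4 : G (P (A z)) + G (e (r z)) = z := by
    have h3 : P (A z) = z - T z := congrArg (fun L : X →L[ℝ] X => L z) hP
    have h4 : G (z - (T z - e (r z))) = z := congrArg (fun L : X →L[ℝ] X => L z) h1
    rw [← map_add, h3, ← sub_add] at *
    exact h4
  have h5 : M (r z) = A z - (A ∘L G ∘L P) (A z) := by
    have : A (G (P (A z)) + G (e (r z))) = A z := by rw [h4]
    rw [map_add] at this
    change A (G (e (r z))) = A z - A (G (P (A z)))
    rw [eq_sub_iff_add_eq, add_comm, this]
  have h6 : W z = (W ∘L G ∘L P) (A z) + W1 ⟨M (r z), ⟨r z, rfl⟩⟩ := by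
    conv_lhs => rw [← h4]
    rw [map_add, hs']; rfl
  rw [h6]
  have h7 : ‖M (r z)‖ ≤ (1 + ‖A ∘L G ∘L P‖) * ‖A z‖ := by
    rw [h5, add_mul, one_mul]
    exact (norm_sub_le _ _).trans (add_le_add le_rfl (ContinuousLinearMap.le_opNorm _ _))
  calc _ ≤ ‖W ∘L G ∘L P‖ * ‖A z‖ + ‖W1‖ * ‖M (r z)‖ :=
        (norm_add_le _ _).trans (add_le_add (ContinuousLinearMap.le_opNorm _ _)
          (ContinuousLinearMap.le_opNorm W1 _))
    _ ≤ ‖W ∘L G ∘L P‖ * ‖A z‖ + ‖W1‖ * ((1 + ‖A ∘L G ∘L P‖) * ‖A z‖) := by gcongr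
    _ = _ := by ring

end GC
end Obs

open Set
namespace Obs
open Filter Topology
open scoped NNReal ENNReal

section Shift
set_option linter.unusedSectionVars false
variable {V : Type*} [NormedAddCommGroup V] [NormedSpace ℝ V] [CompleteSpace V]

open Classical in
noncomputable def Qc (F : ℝ → V) (τ : ℝ) (n : ℕ) : V :=
  if h : AnalyticAt ℝ F τ then (Classical.choose h).coeff n else 0

lemma Qc_eq (F : ℝ → V) (τ : ℝ) (p : FormalMultilinearSeries ℝ ℝ V)
    (hp : HasFPowerSeriesAt F p τ) (n : ℕ) : Qc F τ n = p.coeff n := by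
  have h : AnalyticAt ℝ F τ := ⟨p, hp⟩
  rw [Qc, dif_pos h, (Classical.choose_spec h).eq_formalMultilinearSeries hp]

lemma Qc_loc (F : ℝ → V) (τ₀ : ℝ) (h : AnalyticAt ℝ F τ₀) :
    (∃ ρ : ℝ, 0 < ρ ∧ ∃ c : ℝ, ∀ᶠ τ in 𝓝 τ₀, (∀ n, ‖Qc F τ n‖ * ρ ^ n ≤ c) ∧
      ∀ z : ℝ, |z| < ρ → HasSum (fun n => z ^ n • Qc F τ n) (F (τ + z))) ∧
    ∀ n, ContinuousAt (fun τ => Qc F τ n) τ₀ := by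
  obtain ⟨p, r, hp⟩ := h
  obtain ⟨R, hR0, hR⟩ : ∃ R : ℝ≥0, 0 < R ∧ ((R + R : ℝ≥0) : ℝ≥0∞) < r := by
    obtain ⟨s, hs0, hs⟩ := ENNReal.lt_iff_exists_nnreal_btwn.1 hp.r_pos
    refine ⟨s / 2, half_pos (by exact_mod_cast hs0), by rwa [add_halves]⟩
  have hRp : ((R : ℝ≥0∞) + R) < p.radius := lt_of_lt_of_le (by exact_mod_cast hR) hp.r_le
  have hnear : ∀ᶠ τ in 𝓝 τ₀, ‖τ - τ₀‖₊ < R := by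
    have : ContinuousAt (fun τ : ℝ => ‖τ - τ₀‖₊) τ₀ := by fun_prop
    exact this.eventually_lt continuousAt_const (by simpa using hR0)
  have hball : ∀ τ : ℝ, ‖τ - τ₀‖₊ < R →
      HasFPowerSeriesOnBall F (p.changeOrigin (τ - τ₀)) τ (r - ‖τ - τ₀‖₊) := by
    intro τ hτ
    have h1 : ((‖τ - τ₀‖₊ : ℝ≥0) : ℝ≥0∞) < r := by
      refine lt_of_le_of_lt ?_ hR
      exact_mod_cast (hτ.le.trans (le_add_of_nonneg_left (zero_le)))
    have := hp.changeOrigin h1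
    rwa [add_sub_cancel] at this
  have hQ : ∀ τ : ℝ, ‖τ - τ₀‖₊ < R → ∀ n, Qc F τ n = (p.changeOrigin (τ - τ₀)).coeff n :=
    fun τ hτ n => Qc_eq F τ _ (hball τ hτ).hasFPowerSeriesAt n
  constructor
  · have hsum := p.changeOriginSeries_summable_aux₁ hRp
    let c : ℝ≥0 := ∑' s : Σ k l : ℕ, { s : Finset (Fin (k + l)) // s.card = l },
      ‖p (s.1 + s.2.1)‖₊ * R ^ s.2.1 * R ^ s.1
    refine ⟨R, hR0, c, ?_⟩
    filter_upwards [hnear] with τ hτ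
    constructor
    · intro n
      rw [hQ τ hτ n, ← FormalMultilinearSeries.norm_apply_eq_norm_coef]
      have h1 : ((‖τ - τ₀‖₊ : ℝ≥0) : ℝ≥0∞) < p.radius := by
        refine lt_of_le_of_lt ?_ hRp
        exact_mod_cast (hτ.le.trans (le_add_of_nonneg_left (zero_le)))
      have h2 := p.nnnorm_changeOrigin_le n h1
      have hRr : ((R : ℝ≥0) : ℝ≥0∞) < p.radius :=
        lt_of_le_of_lt (by exact_mod_cast (le_add_of_nonneg_left (zero_le))) hRp
      have h3 : ‖p.changeOrigin (τ - τ₀) n‖₊ * R ^ n ≤ c := by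
        calc ‖p.changeOrigin (τ - τ₀) n‖₊ * R ^ n ≤
            (∑' s : Σ l : ℕ, { s : Finset (Fin (n + l)) // s.card = l },
              ‖p (n + s.1)‖₊ * ‖τ - τ₀‖₊ ^ s.1) * R ^ n := by gcongr
          _ ≤ (∑' s : Σ l : ℕ, { s : Finset (Fin (n + l)) // s.card = l },
              ‖p (n + s.1)‖₊ * R ^ s.1) * R ^ n := by
                gcongr
                · exact p.changeOriginSeries_summable_aux₂ h1 n
                · exact p.changeOriginSeries_summable_aux₂ hRr n
          _ = ∑' s : Σ l : ℕ, { s : Finset (Fin (n + l)) // s.card = l },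
              ‖p (n + s.1)‖₊ * R ^ s.1 * R ^ n := by rw [NNReal.tsum_mul_right]
          _ ≤ c := by
              have := (NNReal.summable_sigma.1 hsum).2
              have h4 := hsum.tsum_sigma' (fun k => (NNReal.summable_sigma.1 hsum).1 k)
              rw [show c = _ from h4]
              exact this.le_tsum n (fun _ _ => zero_le)
      exact_mod_cast h3
    · intro z hz
      have h1 := (hball τ hτ).hasSum (y := z) (by
        rw [Metric.mem_eball, edist_zero_right]
        rw [lt_tsub_iff_right]
        refine lt_trans ?_ hR
        have : ‖z‖₊ < R := by
          rw [← NNReal.coe_lt_coe]; simpa using hz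
        change ((‖z‖₊ : ℝ≥0) : ℝ≥0∞) + _ < _
        exact_mod_cast add_lt_add this hτ)
      convert h1 using 2 with n
      rw [hQ τ hτ n, FormalMultilinearSeries.apply_eq_pow_smul_coeff]
  · intro n
    have h1 : ContinuousAt (fun x => (p.changeOrigin x n) (fun _ => 1)) (0 : ℝ) := by
      have := (p.hasFPowerSeriesOnBall_changeOrigin n (hp.r_pos.trans_le hp.r_le)).continuousOn
      have h2 : ContinuousAt (fun x => p.changeOrigin x n) (0:ℝ) :=
        this.continuousAt (Metric.eball_mem_nhds _ (hp.r_pos.trans_le hp.r_le))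
      exact ((ContinuousMultilinearMap.apply ℝ (fun _ : Fin n => ℝ) V
        (fun _ => (1:ℝ))).continuous.continuousAt).comp h2
    have h2 : ContinuousAt (fun τ => (p.changeOrigin (τ - τ₀) n) (fun _ => 1)) τ₀ := by
      have h3 : ContinuousAt (fun τ : ℝ => τ - τ₀) τ₀ := by fun_prop
      have : ContinuousAt (fun x => (p.changeOrigin x n) (fun _ => 1)) (τ₀ - τ₀) := by
        rwa [sub_self]
      exact ContinuousAt.comp (f := fun τ : ℝ => τ - τ₀) this h3
    refine h2.congr ?_
    filter_upwards [hnear] with τ hτ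
    rw [hQ τ hτ n]; rfl

lemma analyticAt_shift {K : Type*} [TopologicalSpace K] [CompactSpace K] (F : ℝ → V)
    (hd : K → ℝ) (hdc : Continuous hd) (Φ : ℝ → C(K, V)) (t₀ : ℝ)
    (hΦ : ∀ᶠ t in 𝓝 t₀, ∀ k, Φ t k = F (t + hd k))
    (hF : ∀ k, AnalyticAt ℝ F (t₀ + hd k)) : AnalyticAt ℝ Φ t₀ := by
  have hcont : ∀ n, Continuous (fun k => Qc F (t₀ + hd k) n) := by
    intro n
    rw [continuous_iff_continuousAt]
    intro k
    exact ContinuousAt.comp (f := fun k => t₀ + hd k) ((Qc_loc F _ (hF k)).2 n) (by fun_prop)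
  let q : ℕ → C(K, V) := fun n => ⟨_, hcont n⟩
  choose ρ hρ c hc using fun k => (Qc_loc F _ (hF k)).1
  have hU : ∀ k, ∀ᶠ k' in 𝓝 k, (∀ n, ‖Qc F (t₀ + hd k') n‖ * ρ k ^ n ≤ c k) ∧
      ∀ z : ℝ, |z| < ρ k → HasSum (fun n => z ^ n • Qc F (t₀ + hd k') n) (F (t₀ + hd k' + z)) := by
    intro k
    have : Tendsto (fun k' => t₀ + hd k') (𝓝 k) (𝓝 (t₀ + hd k)) :=
      (by fun_prop : Continuous fun k' => t₀ + hd k').tendsto k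
    exact this.eventually (hc k)
  obtain ⟨J, -, hJ⟩ := isCompact_univ.elim_nhds_subcover _ (fun k _ => hU k)
  obtain ⟨ρ0, hρ0, hρ1⟩ : ∃ ρ0 : ℝ, 0 < ρ0 ∧ ∀ k ∈ J, ρ0 ≤ ρ k := by
    rcases J.eq_empty_or_nonempty with h | h
    · exact ⟨1, one_pos, by simp [h]⟩
    · refine ⟨J.inf' h ρ, (Finset.lt_inf'_iff h).2 fun k _ => hρ k, fun k hk => Finset.inf'_le _ hk⟩
  have hbd : ∀ n, ‖q n‖ * ρ0 ^ n ≤ ∑ k ∈ J, |c k| := by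
    intro n
    have h0 : 0 < ρ0 ^ n := by positivity
    rw [← le_div_iff₀ h0]
    refine (ContinuousMap.norm_le _ (by positivity)).2 fun k' => ?_
    rw [le_div_iff₀ h0]
    obtain ⟨k, hk, hk'⟩ := mem_iUnion₂.1 (hJ (mem_univ k'))
    calc ‖q n k'‖ * ρ0 ^ n ≤ ‖q n k'‖ * ρ k ^ n := by gcongr; exact hρ1 k hk
      _ ≤ c k := hk'.1 n
      _ ≤ |c k| := le_abs_self _
      _ ≤ _ := Finset.single_le_sum (f := fun k => |c k|) (fun _ _ => abs_nonneg _) hk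
  let p : FormalMultilinearSeries ℝ ℝ C(K, V) := fun n =>
    ContinuousMultilinearMap.mkPiRing ℝ (Fin n) (q n)
  have hpc : ∀ n, p.coeff n = q n := by
    intro n; simp [p, FormalMultilinearSeries.coeff]
  refine ⟨p, hasFPowerSeriesAt_iff.2 ?_⟩
  have hz : ∀ᶠ z : ℝ in 𝓝 0, |z| < ρ0 := by
    have : ContinuousAt (fun z : ℝ => |z|) 0 := by fun_prop
    exact this.eventually_lt continuousAt_const (by simpa using hρ0)
  have hz2 : ∀ᶠ z : ℝ in 𝓝 0, ∀ k, Φ (t₀ + z) k = F (t₀ + z + hd k) := by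
    have : Tendsto (fun z => t₀ + z) (𝓝 0) (𝓝 t₀) := by
      have := (by fun_prop : Continuous fun z : ℝ => t₀ + z).tendsto 0
      simpa using this
    exact this.eventually hΦ
  filter_upwards [hz, hz2] with z hz hz2
  simp only [hpc]
  have hs : Summable (fun n => z ^ n • q n) := by
    have hg : Summable (fun n => (∑ k ∈ J, |c k|) * (|z| / ρ0) ^ n) :=
      (summable_geometric_of_lt_one (by positivity) ((div_lt_one hρ0).2 hz)).mul_left _
    refine Summable.of_norm_bounded hg fun n => ?_
    rw [norm_smul, norm_pow, Real.norm_eq_abs, div_pow, mul_div_assoc', le_div_iff₀ (by positivity)]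
    have := mul_le_mul_of_nonneg_right (hbd n) (by positivity : 0 ≤ |z| ^ n)
    linarith [this]
  suffices hE : Φ (t₀ + z) = ∑' n, z ^ n • q n by rw [hE]; exact hs.hasSum
  ext k
  rw [hz2 k]
  obtain ⟨k1, hk, hk'⟩ := mem_iUnion₂.1 (hJ (mem_univ k))
  have h1 := hk'.2 z (hz.trans_le (hρ1 k1 hk))
  have h2 : HasSum (fun n => (z ^ n • q n) k) ((∑' n, z ^ n • q n) k) :=
    hs.hasSum.mapL (ContinuousMap.evalCLM ℝ k)
  have h3 := h2.unique h1
  rw [h3]; congr 1; ring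

end Shift
end Obs

open Set
namespace Obs
open Filter Topology MeasureTheory

structure Fr (ι : Type) [Fintype ι] where
  σ : ι → ℝ → ℝ
  dσ : ι → ℝ → ℝ
  hσ : ∀ i x, HasDerivAt (σ i) (dσ i x) x
  hdσ : ∀ i, Continuous (dσ i)
  σ0 : ∀ i, σ i 0 = 0
  hlt : ∀ i l, i ≠ l → (∀ x, dσ i x < dσ l x) ∨ (∀ x, dσ l x < dσ i x)
  mi : ι → Prop
  hmi : ∀ i, mi i → ∀ x, 0 < dσ i x
  hpl : ∀ i, ¬ mi i → ∀ x, dσ i x < 0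
  j0 : ι
  hj0 : mi j0
  imax : ι
  himax : ∀ i x, dσ i x ≤ dσ imax x
  imin : ι
  himin : ∀ i x, dσ imin x ≤ dσ i x
  hneg : ¬ mi imin
  Bm : ι → ι → ℝ
  hBm : ∀ i j, Bm i j ≠ 0 → mi j

namespace Fr
variable {ι : Type} [Fintype ι] (Φ : Fr ι)

lemma σc (i : ι) : Continuous (Φ.σ i) :=
  continuous_iff_continuousAt.2 fun x => (Φ.hσ i x).continuousAt

lemma hpmax : Φ.mi Φ.imax := by
  by_contra h
  have h1 := Φ.hpl _ h 0
  have h2 := Φ.himax Φ.j0 0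
  have h3 := Φ.hmi _ Φ.hj0 0
  linarith

lemma mono_of {f f' : ℝ → ℝ} (h : ∀ x, HasDerivAt f (f' x) x) (h0 : ∀ x, 0 ≤ f' x) : Monotone f :=
  monotone_of_deriv_nonneg (fun x => (h x).differentiableAt) (fun x => by rw [(h x).deriv]; exact h0 x)

lemma σ_mono {i : ι} (h : Φ.mi i) : Monotone (Φ.σ i) :=
  mono_of (Φ.hσ i) fun x => (Φ.hmi i h x).le

lemma σ_anti {i : ι} (h : ¬ Φ.mi i) : Antitone (Φ.σ i) := by
  have : Monotone (fun x => - Φ.σ i x) :=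
    mono_of (fun x => (Φ.hσ i x).neg) fun x => by have := Φ.hpl i h x; linarith
  intro x y hxy
  have := this hxy
  simp only at this; linarith

lemma sub_mono {i l : ι} (h : ∀ x, Φ.dσ i x ≤ Φ.dσ l x) : Monotone (fun x => Φ.σ l x - Φ.σ i x) :=
  mono_of (fun x => (Φ.hσ l x).sub (Φ.hσ i x)) fun x => by have := h x; linarith

lemma cmp (i l : ι) : (∀ x, Φ.dσ i x ≤ Φ.dσ l x) ∨ (∀ x, Φ.dσ l x ≤ Φ.dσ i x) := by
  by_cases h : i = l
  · left; intro x; rw [h]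
  · rcases Φ.hlt i l h with h | h
    · left; intro x; exact (h x).le
    · right; intro x; exact (h x).le

def γ (i : ι) (s ξ : ℝ) : ℝ × ℝ := (s + Φ.σ i ξ, ξ)

lemma γ_cont (i : ι) (s : ℝ) : Continuous (Φ.γ i s) := by
  have := Φ.σc i
  unfold γ; fun_prop

lemma γ_cont2 (i : ι) : Continuous (fun p : ℝ × ℝ => Φ.γ i p.1 p.2) := by
  have := Φ.σc i
  unfold γ; fun_prop

lemma γ_self (i : ι) (p : ℝ × ℝ) : Φ.γ i (p.1 - Φ.σ i p.2) p.2 = p := by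
  simp [γ]

lemma γ_zero (i : ι) (s : ℝ) : Φ.γ i s 0 = (s, 0) := by simp [γ, Φ.σ0]

def Om (L : ℝ) : Set (ℝ × ℝ) :=
  {p | 0 ≤ p.2 ∧ p.2 ≤ 1 ∧ 0 ≤ p.1 ∧ p.1 - Φ.σ Φ.j0 p.2 ≤ L - Φ.σ Φ.j0 1}

lemma Om_path {L : ℝ} {i : ι} {s x y ξ : ℝ} (hx : Φ.γ i s x ∈ Φ.Om L) (hy : Φ.γ i s y ∈ Φ.Om L)
    (h1 : x ≤ ξ) (h2 : ξ ≤ y) : Φ.γ i s ξ ∈ Φ.Om L := by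
  obtain ⟨a1, a2, a3, a4⟩ := hx
  obtain ⟨b1, b2, b3, b4⟩ := hy
  simp only [γ] at *
  refine ⟨by simp only; linarith, by simp only; linarith, ?_, ?_⟩ <;> simp only
  · by_cases h : Φ.mi i
    · have := Φ.σ_mono h h1; linarith
    · have := Φ.σ_anti h h2; linarith
  · rcases Φ.cmp i Φ.j0 with h | h
    · have := Φ.sub_mono h h1; simp only at this; linarith
    · have := Φ.sub_mono h h2; simp only at this; linarith

lemma mem_Om_one {L t : ℝ} : (t, (1:ℝ)) ∈ Φ.Om L ↔ 0 ≤ t ∧ t ≤ L := by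
  simp [Om]

lemma mem_Om_zero {L t : ℝ} : (t, (0:ℝ)) ∈ Φ.Om L ↔ 0 ≤ t ∧ t ≤ L - Φ.σ Φ.j0 1 := by
  simp [Om, Φ.σ0]

lemma mem_Om_init {L x : ℝ} (hS : 0 ≤ L - Φ.σ Φ.j0 1) (h0 : 0 ≤ x) (h1 : x ≤ 1) :
    ((0:ℝ), x) ∈ Φ.Om L := by
  refine ⟨h0, h1, le_rfl, ?_⟩
  have := Φ.σ_mono Φ.hj0 h0
  rw [Φ.σ0] at this
  simp only; linarith

noncomputable def cl (x : ℝ) : ℝ := max 0 (min 1 x)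

lemma cl_cont : Continuous cl := by unfold cl; fun_prop
lemma cl_nonneg (x : ℝ) : 0 ≤ cl x := le_max_left _ _
lemma cl_le (x : ℝ) : cl x ≤ 1 := max_le zero_le_one (min_le_left _ _)
lemma cl_id {x : ℝ} (h0 : 0 ≤ x) (h1 : x ≤ 1) : cl x = x := by
  rw [cl, min_eq_right h1, max_eq_right h0]

noncomputable def r (L : ℝ) (p : ℝ × ℝ) : ℝ × ℝ :=
  (max 0 (min (L - Φ.σ Φ.j0 1 + Φ.σ Φ.j0 (cl p.2)) p.1), cl p.2)

lemma r_cont (L : ℝ) : Continuous (Φ.r L) := by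
  have := Φ.σc Φ.j0
  have := cl_cont
  unfold r; fun_prop

lemma r_mem {L : ℝ} (hS : 0 ≤ L - Φ.σ Φ.j0 1) (p : ℝ × ℝ) : Φ.r L p ∈ Φ.Om L := by
  refine ⟨cl_nonneg _, cl_le _, le_max_left _ _, ?_⟩
  have := Φ.σ_mono Φ.hj0 (cl_nonneg p.2)
  rw [Φ.σ0] at this
  simp only [r]
  rw [sub_le_iff_le_add]
  exact max_le (by linarith) (min_le_left _ _)

lemma r_id {L : ℝ} {p : ℝ × ℝ} (hp : p ∈ Φ.Om L) : Φ.r L p = p := by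
  obtain ⟨a1, a2, a3, a4⟩ := hp
  refine Prod.ext ?_ (cl_id a1 a2)
  simp only [r]
  rw [cl_id a1 a2, min_eq_right (by linarith), max_eq_right a3]

lemma Om_compact (L : ℝ) (hS : 0 ≤ L - Φ.σ Φ.j0 1) : IsCompact (Φ.Om L) := by
  have h : Φ.Om L = Φ.r L '' (Icc 0 L ×ˢ Icc 0 1) := by
    ext p
    constructor
    · intro hp
      refine ⟨p, ⟨⟨hp.2.2.1, ?_⟩, hp.1, hp.2.1⟩, Φ.r_id hp⟩
      have := Φ.σ_mono Φ.hj0 hp.2.1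
      have := hp.2.2.2
      linarith
    · rintro ⟨q, _, rfl⟩
      exact Φ.r_mem hS q
  rw [h]
  exact (isCompact_Icc.prod isCompact_Icc).image (Φ.r_cont L)

lemma Om_fst_le {L : ℝ} {p : ℝ × ℝ} (hp : p ∈ Φ.Om L) : p.1 ≤ L := by
  have := Φ.σ_mono Φ.hj0 hp.2.1
  have := hp.2.2.2
  linarith

structure Mild (E : ι → ι → ℝ × ℝ → ℝ) (L : ℝ) (w : ℝ × ℝ → ι → ℝ) : Prop where
  cont : ContinuousOn w (Φ.Om L)
  eq : ∀ i s x y, x ≤ y → Φ.γ i s x ∈ Φ.Om L → Φ.γ i s y ∈ Φ.Om L →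
    w (Φ.γ i s y) i - w (Φ.γ i s x) i =
      ∫ ξ in x..y, ∑ l, E i l (Φ.γ i s ξ) * w (Φ.γ i s ξ) l
  b0 : ∀ t, (t, (0:ℝ)) ∈ Φ.Om L → ∀ i, ¬ Φ.mi i → w (t, 0) i = ∑ j, Φ.Bm i j * w (t, 0) j

structure Sol (E : ι → ι → ℝ × ℝ → ℝ) (L : ℝ) (w : ℝ × ℝ → ι → ℝ) : Prop extends Φ.Mild E L w where
  b1 : ∀ t, (t, (1:ℝ)) ∈ Φ.Om L → w (t, 1) = 0

structure Win [DecidableEq ι] (L : ℝ) where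
  S_pos : 0 < L - Φ.σ Φ.j0 1
  α : ι → ℝ → ℝ
  Γ : ι → ι → ℝ → ℝ
  hα : ∀ i, Continuous (α i)
  hΓ : ∀ i l, Continuous (Γ i l)
  α0 : ∀ i s, 0 ≤ α i s
  α1 : ∀ i s, α i s ≤ 1
  cΓ : ℝ
  Γb : ∀ i l s, |Γ i l s| ≤ cΓ
  h1 : ∀ i p, p ∈ Φ.Om L → α i (p.1 - Φ.σ i p.2) ≠ 0 →
    Φ.γ i (p.1 - Φ.σ i p.2) 1 ∈ Φ.Om L
  h2 : ∀ i p, p ∈ Φ.Om L → α i (p.1 - Φ.σ i p.2) ≠ 1 → (p.1 - Φ.σ i p.2, (0:ℝ)) ∈ Φ.Om L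
  h3 : ∀ i l s, (s, (0:ℝ)) ∈ Φ.Om L → Γ i l s ≠ 0 → Φ.γ l s 1 ∈ Φ.Om L
  h4 : ∀ s, (s, (0:ℝ)) ∈ Φ.Om L → ∀ u : ι → ℝ,
    (∀ i, ¬ Φ.mi i → u i = ∑ j, Φ.Bm i j * u j) → ∀ i, ∑ l, Γ i l s * u l = u i

noncomputable def U (f : ι → ℝ × ℝ → ℝ) (l : ι) (s x : ℝ) : ℝ := ∫ ξ in (0:ℝ)..x, f l (Φ.γ l s ξ)

lemma U_cont (f : ι → ℝ × ℝ → ℝ) (hf : ∀ l, Continuous (f l)) (l : ι) :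
    Continuous (fun p : ℝ × ℝ => Φ.U f l p.1 p.2) := by
  have h := hf l
  have h1 := Φ.γ_cont2 l
  have h2 : Continuous (Function.uncurry fun (p : ℝ × ℝ) (ξ : ℝ) => f l (Φ.γ l p.1 ξ)) := by
    have : Continuous (fun q : (ℝ × ℝ) × ℝ => Φ.γ l q.1.1 q.2) :=
      h1.comp (f := fun q : (ℝ × ℝ) × ℝ => (q.1.1, q.2)) (by fun_prop)
    exact h.comp this
  exact intervalIntegral.continuous_parametric_intervalIntegral_of_continuous (a₀ := 0) h2
    continuous_snd

lemma U_sub (f : ι → ℝ × ℝ → ℝ) (hf : ∀ l, Continuous (f l)) (l : ι) (s x y : ℝ) :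
    Φ.U f l s y - Φ.U f l s x = ∫ ξ in x..y, f l (Φ.γ l s ξ) := by
  have h : Continuous fun ξ => f l (Φ.γ l s ξ) := (hf l).comp (Φ.γ_cont l s)
  rw [U, U, sub_eq_iff_eq_add, add_comm]
  exact (intervalIntegral.integral_add_adjacent_intervals (h.intervalIntegrable _ _)
    (h.intervalIntegrable _ _)).symm

section K
set_option linter.unusedSectionVars false
variable [DecidableEq ι] {Φ} {L : ℝ} (D : Φ.Win L)

noncomputable def Win.Θ (i l : ι) (s : ℝ) : ℝ :=
  (if i = l then D.α i s else 0) + (1 - D.α i s) * D.Γ i l s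

lemma Win.Θ_cont (i l : ι) : Continuous (D.Θ i l) := by
  have := D.hα i
  have := D.hΓ i l
  unfold Win.Θ; split_ifs <;> fun_prop

noncomputable def Win.cΘ : ℝ := 1 + |D.cΓ|

lemma Win.Θ_bd (i l : ι) (s : ℝ) : |D.Θ i l s| ≤ D.cΘ := by
  have h0 := D.α0 i s
  have h1 := D.α1 i s
  have h2 := (D.Γb i l s).trans (le_abs_self _)
  unfold Win.Θ Win.cΘ
  refine (abs_add_le _ _).trans (add_le_add ?_ ?_)
  · split_ifs
    · rw [abs_of_nonneg h0]; exact h1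
    · simp
  · rw [abs_mul, abs_of_nonneg (by linarith : 0 ≤ 1 - D.α i s)]
    exact (mul_le_of_le_one_left (abs_nonneg _) (by linarith)).trans h2

lemma Win.cΘ_nonneg : 0 ≤ D.cΘ := by unfold Win.cΘ; positivity

lemma Win.Θ_ne {i l : ι} {p : ℝ × ℝ} (hp : p ∈ Φ.Om L) (h : D.Θ i l (p.1 - Φ.σ i p.2) ≠ 0) :
    Φ.γ l (p.1 - Φ.σ i p.2) 1 ∈ Φ.Om L := by
  by_cases hα : D.α i (p.1 - Φ.σ i p.2) = 1
  · rw [Win.Θ, hα] at h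
    have : i = l := by by_contra hc; simp [hc] at h
    rw [← this]
    exact D.h1 i p hp (by rw [hα]; exact one_ne_zero)
  · have h0 := D.h2 i p hp hα
    by_cases hΓ : D.Γ i l (p.1 - Φ.σ i p.2) = 0
    · rw [Win.Θ, hΓ, mul_zero, add_zero] at h
      have : i = l := by by_contra hc; simp [hc] at h
      subst this
      rw [if_pos rfl] at h
      exact D.h1 i p hp h
    · exact D.h3 i l _ h0 hΓ

noncomputable def Win.K (f : ι → ℝ × ℝ → ℝ) (i : ι) (p : ℝ × ℝ) : ℝ :=
  Φ.U f i (p.1 - Φ.σ i p.2) p.2 -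
    ∑ l, D.Θ i l (p.1 - Φ.σ i p.2) * Φ.U f l (p.1 - Φ.σ i p.2) 1

lemma Win.K_cont (f : ι → ℝ × ℝ → ℝ) (hf : ∀ l, Continuous (f l)) (i : ι) :
    Continuous (D.K f i) := by
  have h1 := Φ.σc i
  have h2 : Continuous fun p : ℝ × ℝ => p.1 - Φ.σ i p.2 := by fun_prop
  unfold Win.K
  refine Continuous.sub ?_ (continuous_finsetSum _ fun l _ => ?_)
  · exact (Φ.U_cont f hf i).comp (h2.prodMk continuous_snd)
  · exact ((D.Θ_cont i l).comp h2).mul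
      ((Φ.U_cont f hf l).comp (h2.prodMk continuous_const))

lemma Win.K_eq (f : ι → ℝ × ℝ → ℝ) (i : ι) (p : ℝ × ℝ) :
    D.K f i p = D.α i (p.1 - Φ.σ i p.2) *
        (Φ.U f i (p.1 - Φ.σ i p.2) p.2 - Φ.U f i (p.1 - Φ.σ i p.2) 1) +
      (1 - D.α i (p.1 - Φ.σ i p.2)) * (Φ.U f i (p.1 - Φ.σ i p.2) p.2 -
        ∑ l, D.Γ i l (p.1 - Φ.σ i p.2) * Φ.U f l (p.1 - Φ.σ i p.2) 1) := by
  unfold Win.K Win.Θ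
  simp only [add_mul, Finset.sum_add_distrib, ite_mul, zero_mul, Finset.sum_ite_eq,
    Finset.mem_univ, if_true, mul_assoc, ← Finset.mul_sum]
  ring

def SegB (L : ℝ) (f : ι → ℝ × ℝ → ℝ) (m : ℝ) : Prop :=
  ∀ i s x y, x ≤ y → Φ.γ i s x ∈ Φ.Om L → Φ.γ i s y ∈ Φ.Om L →
    |∫ ξ in x..y, f i (Φ.γ i s ξ)| ≤ m

lemma Win.K_bd (f : ι → ℝ × ℝ → ℝ) (hf : ∀ l, Continuous (f l)) (m : ℝ)
    (h : SegB (Φ := Φ) L f m) {p : ℝ × ℝ} (hp : p ∈ Φ.Om L) (i : ι) :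
    |D.K f i p| ≤ (2 + Fintype.card ι * |D.cΓ|) * m := by
  set s := p.1 - Φ.σ i p.2 with hs
  have hγ : Φ.γ i s p.2 = p := Φ.γ_self i p
  have hm : 0 ≤ m := (abs_nonneg _).trans (h i s p.2 p.2 le_rfl (by rwa [hγ]) (by rwa [hγ]))
  rw [D.K_eq, ← hs]
  have h0 := D.α0 i s
  have h1 := D.α1 i s
  have hA : |D.α i s * (Φ.U f i s p.2 - Φ.U f i s 1)| ≤ m := by
    by_cases hα : D.α i s = 0
    · simpa [hα] using hm
    · have h2 := D.h1 i p hp hα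
      have h3 := h i s p.2 1 hp.2.1 (by rwa [hγ]) h2
      rw [← Φ.U_sub f hf] at h3
      rw [abs_mul, abs_of_nonneg h0, abs_sub_comm]
      exact (mul_le_of_le_one_left (abs_nonneg _) h1).trans h3
  have hB : |(1 - D.α i s) * (Φ.U f i s p.2 - ∑ l, D.Γ i l s * Φ.U f l s 1)| ≤
      m + Fintype.card ι * |D.cΓ| * m := by
    by_cases hα : D.α i s = 1
    · rw [hα]; simp; positivity
    · have h2 := D.h2 i p hp hα
      have hU0 : ∀ l x, Φ.U f l s x = ∫ ξ in (0:ℝ)..x, f l (Φ.γ l s ξ) := fun l x => rfl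
      have h3 := h i s 0 p.2 hp.1 (by rw [Φ.γ_zero]; exact h2) (by rwa [hγ])
      rw [← hU0] at h3
      rw [abs_mul, abs_of_nonneg (by linarith : 0 ≤ 1 - D.α i s)]
      refine (mul_le_of_le_one_left (abs_nonneg _) (by linarith)).trans ?_
      refine (abs_sub _ _).trans (add_le_add h3 ?_)
      refine (Finset.abs_sum_le_sum_abs _ _).trans ?_
      have : ∀ l ∈ Finset.univ, |D.Γ i l s * Φ.U f l s 1| ≤ |D.cΓ| * m := by
        intro l _
        by_cases hΓ : D.Γ i l s = 0
        · rw [hΓ, zero_mul, abs_zero]; positivity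
        · have h4 := D.h3 i l s h2 hΓ
          have h5 := h l s 0 1 zero_le_one (by rw [Φ.γ_zero]; exact h2) h4
          rw [← hU0] at h5
          rw [abs_mul]
          exact mul_le_mul ((D.Γb i l s).trans (le_abs_self _)) h5 (abs_nonneg _) (abs_nonneg _)
      refine (Finset.sum_le_card_nsmul _ _ _ this).trans ?_
      simp [mul_assoc]
  calc _ ≤ _ := (abs_add_le _ _).trans (add_le_add hA hB)
    _ = _ := by ring

lemma Win.K_sub (f g : ι → ℝ × ℝ → ℝ) (hf : ∀ l, Continuous (f l)) (hg : ∀ l, Continuous (g l))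
    (i : ι) (p : ℝ × ℝ) : D.K (fun l q => f l q - g l q) i p = D.K f i p - D.K g i p := by
  have : ∀ l s x, Φ.U (fun l q => f l q - g l q) l s x = Φ.U f l s x - Φ.U g l s x := by
    intro l s x
    exact intervalIntegral.integral_sub
      (((hf l).comp (Φ.γ_cont l s)).intervalIntegrable _ _)
      (((hg l).comp (Φ.γ_cont l s)).intervalIntegrable _ _)
  simp only [Win.K, this, mul_sub, Finset.sum_sub_distrib]
  ring

lemma Win.K_local (f g : ι → ℝ × ℝ → ℝ) (hf : ∀ l, Continuous (f l)) (hg : ∀ l, Continuous (g l))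
    (h : ∀ l, ∀ p ∈ Φ.Om L, f l p = g l p) {p : ℝ × ℝ} (hp : p ∈ Φ.Om L) (i : ι) :
    D.K f i p = D.K g i p := by
  have := D.K_bd (fun l q => f l q - g l q) (fun l => (hf l).sub (hg l)) 0 (by
    intro i s x y hxy hx hy
    rw [intervalIntegral.integral_congr (g := fun _ => (0:ℝ))]
    · simp
    · intro ξ hξ
      rw [uIcc_of_le hxy] at hξ
      simp only
      rw [h i _ (Φ.Om_path hx hy hξ.1 hξ.2), sub_self]) hp i
  rw [mul_zero, D.K_sub f g hf hg] at this
  have := abs_nonpos_iff.1 this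
  linarith

lemma Win.K_unif (f : ι → ℝ × ℝ → ℝ) (m : ℝ) (hm : 0 ≤ m)
    (h : ∀ l p, |f l p| ≤ m) {p : ℝ × ℝ} (h0 : 0 ≤ p.2) (h1 : p.2 ≤ 1) (i : ι) :
    |D.K f i p| ≤ (1 + Fintype.card ι * D.cΘ) * m := by
  have hU : ∀ l s x, 0 ≤ x → x ≤ 1 → |Φ.U f l s x| ≤ m := by
    intro l s x h0 h1
    have := intervalIntegral.norm_integral_le_of_norm_le_const (a := 0) (b := x)
      (f := fun ξ => f l (Φ.γ l s ξ)) (C := m) (fun ξ _ => h l _)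
    rw [sub_zero, abs_of_nonneg h0, Real.norm_eq_abs] at this
    exact this.trans (mul_le_of_le_one_right hm h1)
  unfold Win.K
  refine (abs_sub _ _).trans ?_
  rw [add_mul, one_mul]
  refine add_le_add (hU _ _ _ h0 h1) ((Finset.abs_sum_le_sum_abs _ _).trans ?_)
  have : ∀ l ∈ Finset.univ, |D.Θ i l (p.1 - Φ.σ i p.2) * Φ.U f l (p.1 - Φ.σ i p.2) 1| ≤ D.cΘ * m := by
    intro l _
    rw [abs_mul]
    exact mul_le_mul (D.Θ_bd _ _ _) (hU _ _ _ zero_le_one le_rfl) (abs_nonneg _) D.cΘ_nonneg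
  refine (Finset.sum_le_card_nsmul _ _ _ this).trans ?_
  simp [mul_assoc]

def fE (E : ι → ι → ℝ × ℝ → ℝ) (w : ℝ × ℝ → ι → ℝ) (i : ι) (p : ℝ × ℝ) : ℝ := ∑ l, E i l p * w p l

lemma fE_cont {E : ι → ι → ℝ × ℝ → ℝ} (hE : ∀ i l, Continuous (E i l)) {w : ℝ × ℝ → ι → ℝ}
    (hw : Continuous w) (i : ι) : Continuous (fE E w i) := by
  unfold fE
  refine continuous_finsetSum _ fun l _ => (hE i l).mul ?_
  fun_prop

end K
end Fr
end Obs

open Set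
namespace Obs
open Filter Topology MeasureTheory
open scoped BoundedContinuousFunction

namespace Fr
section K
set_option linter.unusedSectionVars false
variable {ι : Type} [Fintype ι] [DecidableEq ι] {Φ : Fr ι} {L : ℝ} (D : Φ.Win L)

lemma Win.Θ_sum (i : ι) (s : ℝ) (X : ι → ℝ) :
    ∑ l, D.Θ i l s * X l = D.α i s * X i + (1 - D.α i s) * ∑ l, D.Γ i l s * X l := by
  unfold Win.Θ
  simp only [add_mul, Finset.sum_add_distrib, ite_mul, zero_mul, Finset.sum_ite_eq,
    Finset.mem_univ, if_true, mul_assoc, ← Finset.mul_sum]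

lemma comp_r_cont (hS : 0 ≤ L - Φ.σ Φ.j0 1) {w : ℝ × ℝ → ι → ℝ} (hw : ContinuousOn w (Φ.Om L)) :
    Continuous (fun p => w (Φ.r L p)) :=
  hw.comp_continuous (Φ.r_cont L) (fun p => Φ.r_mem hS p)

lemma Mild.seg {E : ι → ι → ℝ × ℝ → ℝ} {w : ℝ × ℝ → ι → ℝ} (hM : Φ.Mild E L w)
    (i : ι) (s x y : ℝ) (hxy : x ≤ y) (hx : Φ.γ i s x ∈ Φ.Om L) (hy : Φ.γ i s y ∈ Φ.Om L) :
    w (Φ.γ i s y) i - w (Φ.γ i s x) i =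
      ∫ ξ in x..y, fE E (fun p => w (Φ.r L p)) i (Φ.γ i s ξ) := by
  rw [hM.eq i s x y hxy hx hy]
  refine intervalIntegral.integral_congr fun ξ hξ => ?_
  rw [uIcc_of_le hxy] at hξ
  simp only [fE]
  rw [Φ.r_id (Φ.Om_path hx hy hξ.1 hξ.2)]

lemma Win.rep {E : ι → ι → ℝ × ℝ → ℝ} (hE : ∀ i l, Continuous (E i l))
    {w : ℝ × ℝ → ι → ℝ} (hM : Φ.Mild E L w) {p : ℝ × ℝ} (hp : p ∈ Φ.Om L) (i : ι) :
    w p i = ∑ l, D.Θ i l (p.1 - Φ.σ i p.2) * w (Φ.γ l (p.1 - Φ.σ i p.2) 1) l +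
      D.K (fE E (fun p => w (Φ.r L p))) i p := by
  have hwc := comp_r_cont D.S_pos.le hM.cont
  set f := fE E (fun p => w (Φ.r L p)) with hf
  have hfc : ∀ l, Continuous (f l) := fun l => fE_cont hE hwc l
  set s := p.1 - Φ.σ i p.2 with hs
  have hγ : Φ.γ i s p.2 = p := Φ.γ_self i p
  rw [D.K_eq, ← hs, D.Θ_sum]
  have hA : D.α i s * (w p i - w (Φ.γ i s 1) i - (Φ.U f i s p.2 - Φ.U f i s 1)) = 0 := by
    by_cases hα : D.α i s = 0
    · simp [hα]
    · have h1 := hM.seg i s p.2 1 hp.2.1 (by rwa [hγ]) (D.h1 i p hp hα)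
      rw [← Φ.U_sub f hfc, hγ] at h1
      rw [show w p i - w (Φ.γ i s 1) i - (Φ.U f i s p.2 - Φ.U f i s 1) = 0 by linarith, mul_zero]
  have hB : (1 - D.α i s) * (w p i - ∑ l, D.Γ i l s * w (Φ.γ l s 1) l
      - (Φ.U f i s p.2 - ∑ l, D.Γ i l s * Φ.U f l s 1)) = 0 := by
    by_cases hα : D.α i s = 1
    · simp [hα]
    · have h2 := D.h2 i p hp hα
      rw [← hs] at h2
      have h3 : ∀ l x, 0 ≤ x → Φ.γ l s x ∈ Φ.Om L →
          w (Φ.γ l s x) l = w (s, 0) l + Φ.U f l s x := by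
        intro l x hx hm
        have h1 := hM.seg l s 0 x hx (by rwa [Φ.γ_zero]) hm
        rw [Φ.γ_zero] at h1
        have : Φ.U f l s x = ∫ ξ in (0:ℝ)..x, f l (Φ.γ l s ξ) := rfl
        linarith
      have h4 : w p i = w (s, 0) i + Φ.U f i s p.2 := by
        have := h3 i p.2 hp.1 (by rwa [hγ]); rwa [hγ] at this
      have h5 : ∑ l, D.Γ i l s * w (Φ.γ l s 1) l =
          ∑ l, D.Γ i l s * w (s, 0) l + ∑ l, D.Γ i l s * Φ.U f l s 1 := by
        rw [← Finset.sum_add_distrib]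
        refine Finset.sum_congr rfl fun l _ => ?_
        by_cases hΓ : D.Γ i l s = 0
        · simp [hΓ]
        · rw [h3 l 1 zero_le_one (D.h3 i l s h2 hΓ)]; ring
      rw [h5, D.h4 s h2 _ (hM.b0 s h2) i, h4]
      ring
  linear_combination hA + hB

lemma Win.mild_of_fix {E : ι → ι → ℝ × ℝ → ℝ} (hE : ∀ i l, Continuous (E i l))
    {z : ℝ × ℝ → ι → ℝ} (hz : Continuous z)
    (hfix : ∀ p ∈ Φ.Om L, ∀ i, z p i = D.K (fE E z) i p)
    (b0 : ∀ t, (t, (0:ℝ)) ∈ Φ.Om L → ∀ i, ¬ Φ.mi i → z (t, 0) i = ∑ j, Φ.Bm i j * z (t, 0) j) :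
    Φ.Mild E L z := by
  refine ⟨hz.continuousOn, fun i s x y hxy hx hy => ?_, b0⟩
  rw [hfix _ hx, hfix _ hy]
  have : ∀ ξ, (Φ.γ i s ξ).1 - Φ.σ i (Φ.γ i s ξ).2 = s := by intro ξ; simp [γ]
  simp only [Win.K, this]
  have h2 := Φ.U_sub (fE E z) (fun l => fE_cont hE hz l) i s x y
  change _ = ∫ ξ in x..y, fE E z i (Φ.γ i s ξ)
  rw [← h2]
  simp only [γ]
  ring

lemma Win.K_add (f g : ι → ℝ × ℝ → ℝ) (hf : ∀ l, Continuous (f l)) (hg : ∀ l, Continuous (g l))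
    (i : ι) (p : ℝ × ℝ) : D.K (fun l q => f l q + g l q) i p = D.K f i p + D.K g i p := by
  have : ∀ l s x, Φ.U (fun l q => f l q + g l q) l s x = Φ.U f l s x + Φ.U g l s x := by
    intro l s x
    exact intervalIntegral.integral_add
      (((hf l).comp (Φ.γ_cont l s)).intervalIntegrable _ _)
      (((hg l).comp (Φ.γ_cont l s)).intervalIntegrable _ _)
  simp only [Win.K, this, mul_add, Finset.sum_add_distrib]
  ring

lemma Win.K_smul (c : ℝ) (f : ι → ℝ × ℝ → ℝ)
    (i : ι) (p : ℝ × ℝ) : D.K (fun l q => c * f l q) i p = c * D.K f i p := by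
  have : ∀ l s x, Φ.U (fun l q => c * f l q) l s x = c * Φ.U f l s x := by
    intro l s x
    exact intervalIntegral.integral_const_mul _ _
  simp only [Win.K, this, mul_sub, Finset.mul_sum]
  congr 1
  refine Finset.sum_congr rfl fun l _ => by ring

lemma Win.compact (D : Φ.Win L) : CompactSpace (Φ.Om L) := isCompact_iff_compactSpace.1 (Φ.Om_compact L D.S_pos.le)

noncomputable def Win.ext (g : C(Φ.Om L, ι → ℝ)) (p : ℝ × ℝ) : ι → ℝ := g ⟨Φ.r L p, Φ.r_mem D.S_pos.le p⟩

lemma Win.ext_cont (g : C(Φ.Om L, ι → ℝ)) : Continuous (D.ext g) := by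
  refine g.continuous.comp (Continuous.subtype_mk (Φ.r_cont L) _)

lemma Win.ext_id (g : C(Φ.Om L, ι → ℝ)) (p : Φ.Om L) : D.ext g p = g p := by
  unfold Win.ext
  congr 1
  exact Subtype.ext (Φ.r_id p.2)

lemma Win.ext_bd [CompactSpace (Φ.Om L)] (g : C(Φ.Om L, ι → ℝ)) (p : ℝ × ℝ) (i : ι) :
    |D.ext g p i| ≤ ‖g‖ := by
  have h1 := g.norm_coe_le_norm ⟨Φ.r L p, Φ.r_mem D.S_pos.le p⟩
  exact (norm_le_pi_norm (D.ext g p) i).trans h1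

abbrev Co (ι : Type) := ι → ι → (ℝ × ℝ) →ᵇ ℝ

lemma Co_bd (E : Co ι) (i l : ι) (p : ℝ × ℝ) : |E i l p| ≤ ‖E‖ :=
  ((E i l).norm_coe_le_norm p).trans ((norm_le_pi_norm (E i) l).trans (norm_le_pi_norm E i))

lemma fE_bd [CompactSpace (Φ.Om L)] (E : Co ι) (g : C(Φ.Om L, ι → ℝ)) (l : ι) (p : ℝ × ℝ) :
    |fE (fun i l => E i l) (D.ext g) l p| ≤ Fintype.card ι * (‖E‖ * ‖g‖) := by
  unfold fE
  refine (Finset.abs_sum_le_sum_abs _ _).trans ?_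
  have : ∀ j ∈ Finset.univ, |E l j p * D.ext g p j| ≤ ‖E‖ * ‖g‖ := by
    intro j _
    rw [abs_mul]
    exact mul_le_mul (Co_bd E l j p) (D.ext_bd g p j) (abs_nonneg _) (norm_nonneg _)
  refine (Finset.sum_le_card_nsmul _ _ _ this).trans ?_
  simp

lemma coC (E : Co ι) (i l : ι) : Continuous (fun p => E i l p) := (E i l).continuous

noncomputable def Win.KL0 (E : Co ι) (g : C(Φ.Om L, ι → ℝ)) : C(Φ.Om L, ι → ℝ) :=
  ⟨fun p i => D.K (fE (fun i l => E i l) (D.ext g)) i p, continuous_pi fun i =>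
    (D.K_cont _ (fun l => fE_cont (coC E) (D.ext_cont g) l) i).comp
      continuous_subtype_val⟩

noncomputable def Win.KL [CompactSpace (Φ.Om L)] :
    Co ι →L[ℝ] C(Φ.Om L, ι → ℝ) →L[ℝ] C(Φ.Om L, ι → ℝ) :=
  LinearMap.mkContinuous₂ (LinearMap.mk₂ ℝ D.KL0
    (by
      intro E E' g
      ext p i
      have := D.K_add (fE (fun i l => E i l) (D.ext g)) (fE (fun i l => E' i l) (D.ext g))
        (fun l => fE_cont (coC E) (D.ext_cont g) l) (fun l => fE_cont (coC E') (D.ext_cont g) l) i p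
      refine Eq.trans ?_ this
      simp only [Win.KL0, ContinuousMap.coe_mk]
      congr 1
      funext l q
      simp [fE, add_mul, Finset.sum_add_distrib])
    (by
      intro c E g
      ext p i
      have := D.K_smul c (fE (fun i l => E i l) (D.ext g)) i p
      refine Eq.trans ?_ this
      simp only [Win.KL0, ContinuousMap.coe_mk]
      congr 1
      funext l q
      simp [fE, mul_assoc, Finset.mul_sum])
    (by
      intro E g g'
      ext p i
      have := D.K_add (fE (fun i l => E i l) (D.ext g)) (fE (fun i l => E i l) (D.ext g'))
        (fun l => fE_cont (coC E) (D.ext_cont g) l) (fun l => fE_cont (coC E) (D.ext_cont g') l) i p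
      refine Eq.trans ?_ this
      simp only [Win.KL0, ContinuousMap.coe_mk]
      congr 1
      funext l q
      simp [fE, Win.ext, mul_add, Finset.sum_add_distrib])
    (by
      intro c E g
      ext p i
      have := D.K_smul c (fE (fun i l => E i l) (D.ext g)) i p
      refine Eq.trans ?_ this
      simp only [Win.KL0, ContinuousMap.coe_mk]
      congr 1
      funext l q
      simp [fE, Win.ext, mul_left_comm, Finset.mul_sum]))
    ((1 + Fintype.card ι * D.cΘ) * Fintype.card ι) (by
      intro E g
      have h1 : 0 ≤ D.cΘ := D.cΘ_nonneg
      refine (ContinuousMap.norm_le _ (by positivity)).2 fun p => ?_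
      refine (pi_norm_le_iff_of_nonneg (by positivity)).2 fun i => ?_
      refine (D.K_unif _ _ (by positivity) (fE_bd D E g) p.2.1 p.2.2.1 i).trans (le_of_eq ?_)
      ring)

lemma Win.KL_apply [CompactSpace (Φ.Om L)] (E : Co ι) (g : C(Φ.Om L, ι → ℝ)) (p : Φ.Om L) (i : ι) :
    D.KL E g p i = D.K (fE (fun i l => E i l) (D.ext g)) i p := rfl

lemma Win.KL_sq [CompactSpace (Φ.Om L)] (E : Co ι) (g : C(Φ.Om L, ι → ℝ)) (p : Φ.Om L) (i : ι) :
    D.KL E (D.KL E g) p i = D.K (fE (fun i l => E i l)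
      (fun q j => D.K (fE (fun i l => E i l) (D.ext g)) j q)) i p := by
  rw [D.KL_apply]
  have hc : Continuous fun (q : ℝ × ℝ) (j : ι) => D.K (fE (fun i l => E i l) (D.ext g)) j q :=
    continuous_pi fun j => D.K_cont _ (fun l => fE_cont (coC E) (D.ext_cont g) l) j
  refine D.K_local _ _ (fun l => fE_cont (coC E) (D.ext_cont _) l) (fun l => fE_cont (coC E) hc l) ?_ p.2 i
  intro l q hq
  unfold fE
  refine Finset.sum_congr rfl fun j _ => ?_
  rw [show q = ((⟨q, hq⟩ : Φ.Om L) : ℝ × ℝ) from rfl, D.ext_id, D.KL_apply]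
  rfl

end K
end Fr
end Obs

open Set
namespace Obs
open Filter Topology MeasureTheory
open scoped BoundedContinuousFunction

lemma osc_piece {ψ dψ c : ℝ → ℝ} (hψ : ∀ x, HasDerivAt ψ (dψ x) x) (hdψ : Continuous dψ)
    (hc : Continuous c) {M κ C a b : ℝ} (hM : 0 ≤ M) (ha : 0 ≤ a) (hab : a ≤ b) (hb : b ≤ 1)
    (hω : ∀ ξ ∈ Icc a b, |c ξ - dψ ξ * (c a / dψ a)| + |dψ ξ * (c a / dψ a)| * |ξ - a| ≤ κ)
    (hC : |c a / dψ a| ≤ C) (s s0 : ℝ) (R : ℝ → ℝ → ℝ) (hR : Continuous (Function.uncurry R))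
    (hb0 : ∀ r, ∀ ξ ∈ Icc (0:ℝ) 1, |R r ξ| ≤ M)
    (hl : ∀ r, ∀ ξ ∈ Icc (0:ℝ) 1, ∀ ζ ∈ Icc (0:ℝ) 1, |R r ξ - R r ζ| ≤ M * |ξ - ζ|) :
    |∫ ξ in a..b, c ξ * (R (s + ψ ξ) ξ - R (s0 + ψ ξ) ξ)| ≤
      2 * M * κ * (b - a) + 2 * (C * M) * |s - s0| := by
  have hψc : Continuous ψ := continuous_iff_continuousAt.2 fun x => (hψ x).continuousAt
  have hRc : ∀ s, Continuous fun ξ => R (s + ψ ξ) ξ := fun s =>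
    hR.comp (f := fun ξ => (s + ψ ξ, ξ)) (by fun_prop)
  have hRa : Continuous fun r => R r a := hR.comp (f := fun r => (r, a)) (by fun_prop)
  have hRaψ : ∀ s, Continuous fun ξ => R (s + ψ ξ) a := fun s =>
    hR.comp (f := fun ξ => (s + ψ ξ, a)) (by fun_prop)
  set q : ℝ → ℝ := fun r => c a / dψ a * R r a with hq
  have hqc : Continuous q := by fun_prop
  have hqb : ∀ r, |q r| ≤ C * M := by
    intro r
    rw [hq]; simp only; rw [abs_mul]
    exact mul_le_mul hC (hb0 r a ⟨ha, by linarith⟩) (abs_nonneg _) ((abs_nonneg _).trans hC)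
  have hsub : ∀ s, ∫ ξ in a..b, q (s + ψ ξ) * dψ ξ = ∫ r in (s + ψ a)..(s + ψ b), q r := by
    intro s
    exact intervalIntegral.integral_comp_mul_deriv (f := fun ξ => s + ψ ξ) (g := q)
      (fun x _ => (hψ x).const_add s) hdψ.continuousOn hqc
  have herr : ∀ s, |∫ ξ in a..b, (c ξ * R (s + ψ ξ) ξ - q (s + ψ ξ) * dψ ξ)| ≤ M * κ * (b - a) := by
    intro s
    have := intervalIntegral.norm_integral_le_of_norm_le_const (a := a) (b := b)
      (f := fun ξ => c ξ * R (s + ψ ξ) ξ - q (s + ψ ξ) * dψ ξ) (C := M * κ) (by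
        intro ξ hξ
        rw [uIoc_of_le hab] at hξ
        have hξ1 : ξ ∈ Icc (0:ℝ) 1 := ⟨by linarith [hξ.1], by linarith [hξ.2]⟩
        have h1 := hb0 (s + ψ ξ) ξ hξ1
        have h2 := hl (s + ψ ξ) ξ hξ1 a ⟨ha, by linarith⟩
        have h3 := hω ξ ⟨hξ.1.le, hξ.2⟩
        have : c ξ * R (s + ψ ξ) ξ - q (s + ψ ξ) * dψ ξ =
          (c ξ - dψ ξ * (c a / dψ a)) * R (s + ψ ξ) ξ +
            dψ ξ * (c a / dψ a) * (R (s + ψ ξ) ξ - R (s + ψ ξ) a) := by rw [hq]; ring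
        rw [this, Real.norm_eq_abs]
        refine (abs_add_le _ _).trans ?_
        rw [abs_mul, abs_mul _ (R _ _ - _)]
        have h4 := mul_le_mul_of_nonneg_left h1 (abs_nonneg (c ξ - dψ ξ * (c a / dψ a)))
        have h5 := mul_le_mul_of_nonneg_left h2 (abs_nonneg (dψ ξ * (c a / dψ a)))
        have h6 := mul_le_mul_of_nonneg_left h3 hM
        nlinarith)
    rwa [abs_of_nonneg (by linarith : (0:ℝ) ≤ b - a), Real.norm_eq_abs] at this
  have hqI : ∀ x y, IntervalIntegrable q volume x y := fun x y => hqc.intervalIntegrable _ _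
  have hqs : ∀ x, |∫ r in (s0 + x)..(s + x), q r| ≤ C * M * |s - s0| := by
    intro x
    have := intervalIntegral.norm_integral_le_of_norm_le_const (a := s0 + x) (b := s + x)
      (f := q) (C := C * M) (fun r _ => hqb r)
    rwa [show s + x - (s0 + x) = s - s0 by ring, Real.norm_eq_abs] at this
  have hi1 : ∀ s, IntervalIntegrable (fun ξ => c ξ * R (s + ψ ξ) ξ - q (s + ψ ξ) * dψ ξ) volume a b := by
    intro s
    have := hRc s
    refine Continuous.intervalIntegrable ?_ _ _
    have : Continuous fun ξ => q (s + ψ ξ) := hqc.comp (by fun_prop)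
    fun_prop
  have hi2 : ∀ s, IntervalIntegrable (fun ξ => q (s + ψ ξ) * dψ ξ) volume a b := by
    intro s
    refine Continuous.intervalIntegrable ?_ _ _
    have : Continuous fun ξ => q (s + ψ ξ) := hqc.comp (by fun_prop)
    fun_prop
  have key : ∫ ξ in a..b, c ξ * (R (s + ψ ξ) ξ - R (s0 + ψ ξ) ξ) =
      ((∫ ξ in a..b, (c ξ * R (s + ψ ξ) ξ - q (s + ψ ξ) * dψ ξ)) -
      (∫ ξ in a..b, (c ξ * R (s0 + ψ ξ) ξ - q (s0 + ψ ξ) * dψ ξ))) +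
      ((∫ r in (s0 + ψ b)..(s + ψ b), q r) - ∫ r in (s0 + ψ a)..(s + ψ a), q r) := by
    have e1 : (∫ r in (s0 + ψ b)..(s + ψ b), q r) - (∫ r in (s0 + ψ a)..(s + ψ a), q r) =
        (∫ ξ in a..b, q (s + ψ ξ) * dψ ξ) - ∫ ξ in a..b, q (s0 + ψ ξ) * dψ ξ := by
      rw [hsub, hsub]
      have h1 := intervalIntegral.integral_add_adjacent_intervals (hqI (s0 + ψ a) (s0 + ψ b))
        (hqI (s0 + ψ b) (s + ψ b))
      have h2 := intervalIntegral.integral_add_adjacent_intervals (hqI (s0 + ψ a) (s + ψ a))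
        (hqI (s + ψ a) (s + ψ b))
      linarith
    rw [e1, ← intervalIntegral.integral_sub (hi1 s) (hi1 s0),
      ← intervalIntegral.integral_sub (hi2 s) (hi2 s0), ← intervalIntegral.integral_add
        ((hi1 s).sub (hi1 s0)) ((hi2 s).sub (hi2 s0))]
    refine intervalIntegral.integral_congr fun ξ _ => ?_
    ring
  rw [key]
  refine (abs_add_le _ _).trans ?_
  have h1 := (abs_sub (∫ ξ in a..b, (c ξ * R (s + ψ ξ) ξ - q (s + ψ ξ) * dψ ξ))
      (∫ ξ in a..b, (c ξ * R (s0 + ψ ξ) ξ - q (s0 + ψ ξ) * dψ ξ)))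
  have h2 := abs_sub (∫ r in (s0 + ψ b)..(s + ψ b), q r) (∫ r in (s0 + ψ a)..(s + ψ a), q r)
  have h3 := herr s
  have h4 := herr s0
  have h5 := hqs (ψ a)
  have h6 := hqs (ψ b)
  linarith

lemma osc {ψ dψ c : ℝ → ℝ} (hψ : ∀ x, HasDerivAt ψ (dψ x) x) (hdψ : Continuous dψ)
    (hne : ∀ x, dψ x ≠ 0) (hc : Continuous c) {M : ℝ} (hM : 0 ≤ M) {x0 : ℝ} (h0 : 0 ≤ x0)
    (h1 : x0 ≤ 1) (s0 : ℝ) {ε : ℝ} (hε : 0 < ε) : ∀ᶠ s in 𝓝 s0, ∀ R : ℝ → ℝ → ℝ,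
      Continuous (Function.uncurry R) → (∀ r, ∀ ξ ∈ Icc (0:ℝ) 1, |R r ξ| ≤ M) →
      (∀ r, ∀ ξ ∈ Icc (0:ℝ) 1, ∀ ζ ∈ Icc (0:ℝ) 1, |R r ξ - R r ζ| ≤ M * |ξ - ζ|) →
      |∫ ξ in (0:ℝ)..x0, c ξ * (R (s + ψ ξ) ξ - R (s0 + ψ ξ) ξ)| ≤ ε := by
  obtain ⟨κ, hκ, hκε⟩ : ∃ κ > 0, 2 * M * κ ≤ ε / 2 := by
    refine ⟨ε / (4 * (M + 1)), by positivity, ?_⟩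
    rw [← mul_div_assoc, div_le_div_iff₀ (by positivity) (by positivity)]
    nlinarith
  set ω : ℝ × ℝ → ℝ := fun p => |c p.1 - dψ p.1 * (c p.2 / dψ p.2)| +
    |dψ p.1 * (c p.2 / dψ p.2)| * |p.1 - p.2| with hωd
  have hcd : Continuous fun p : ℝ × ℝ => c p.2 / dψ p.2 :=
    (hc.comp continuous_snd).div (hdψ.comp continuous_snd) (fun p => hne _)
  have hωc : Continuous ω := by fun_prop
  have hωu := (isCompact_Icc.prod isCompact_Icc : IsCompact (Icc (0:ℝ) 1 ×ˢ Icc (0:ℝ) 1)).uniformContinuousOn_of_continuous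
    hωc.continuousOn
  rw [Metric.uniformContinuousOn_iff] at hωu
  obtain ⟨δ, hδ, hω⟩ := hωu κ hκ
  obtain ⟨C, hC⟩ := (isCompact_Icc : IsCompact (Icc (0:ℝ) 1)).exists_bound_of_continuousOn
    (f := fun x => c x / dψ x) (hc.div hdψ hne).continuousOn
  obtain ⟨N, hN⟩ := exists_nat_gt (1 / δ)
  have hNp : (0:ℝ) < N := (by positivity : (0:ℝ) < 1 / δ).trans hN
  have hNδ : x0 / N < δ := by
    rw [div_lt_iff₀ hNp]
    rw [div_lt_iff₀ hδ] at hN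
    linarith
  have hCM : 0 ≤ C * M := mul_nonneg ((norm_nonneg _).trans (hC 0 ⟨le_rfl, zero_le_one⟩)) hM
  have hev : ∀ᶠ s in 𝓝 s0, |s - s0| < ε / (4 * (N * (C * M + 1))) := by
    have : Tendsto (fun s => |s - s0|) (𝓝 s0) (𝓝 0) := by
      have : Continuous fun s => |s - s0| := by fun_prop
      simpa using this.tendsto s0
    exact this.eventually_lt_const (by positivity)
  filter_upwards [hev] with s hs R hR hb0 hl
  have hRc : ∀ s, Continuous fun ξ => R (s + ψ ξ) ξ := fun s => by
    have hψc : Continuous ψ := continuous_iff_continuousAt.2 fun x => (hψ x).continuousAt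
    exact hR.comp (f := fun ξ => (s + ψ ξ, ξ)) (by fun_prop)
  have hint : Continuous fun ξ => c ξ * (R (s + ψ ξ) ξ - R (s0 + ψ ξ) ξ) :=
    hc.mul ((hRc s).sub (hRc s0))
  have hsum := intervalIntegral.sum_integral_adjacent_intervals (μ := volume)
    (f := fun ξ => c ξ * (R (s + ψ ξ) ξ - R (s0 + ψ ξ) ξ)) (a := fun j : ℕ => x0 * j / N) (n := N)
    (fun j _ => hint.intervalIntegrable _ _)
  have e0 : x0 * ((0:ℕ):ℝ) / N = 0 := by simp
  have e1 : x0 * (N:ℝ) / N = x0 := by field_simp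
  simp only [e0, e1] at hsum
  rw [← hsum]
  refine (Finset.abs_sum_le_sum_abs _ _).trans ?_
  have hstep : ∀ j ∈ Finset.range N, |∫ ξ in (x0 * (j:ℝ) / N)..(x0 * ((j + 1 : ℕ) : ℝ) / N),
      c ξ * (R (s + ψ ξ) ξ - R (s0 + ψ ξ) ξ)| ≤ 2 * M * κ * (x0 / N) + 2 * (C * M) * |s - s0| := by
    intro j hj
    rw [Finset.mem_range] at hj
    have hjN : (j:ℝ) + 1 ≤ N := by exact_mod_cast hj
    have g1 : (0:ℝ) ≤ x0 * j / N := by positivity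
    have g3 : x0 * ((j + 1 : ℕ) : ℝ) / N - x0 * j / N = x0 / N := by push_cast; ring
    have g0 : 0 ≤ x0 / N := by positivity
    have g4 : x0 * ((j + 1 : ℕ) : ℝ) / N ≤ 1 := by
      rw [div_le_one hNp]; push_cast; nlinarith
    have ha : x0 * (j:ℝ) / N ∈ Icc (0:ℝ) 1 := ⟨g1, by linarith⟩
    have := osc_piece hψ hdψ hc (κ := κ) (C := C) (a := x0 * (j:ℝ) / N)
      (b := x0 * ((j + 1 : ℕ) : ℝ) / N) hM g1 (by linarith) g4 (by
        intro ξ hξ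
        have hξ1 : ξ ∈ Icc (0:ℝ) 1 := ⟨by linarith [hξ.1], by linarith [hξ.2]⟩
        have := hω (ξ, x0 * (j:ℝ) / N) ⟨hξ1, ha⟩ (x0 * (j:ℝ) / N, x0 * (j:ℝ) / N) ⟨ha, ha⟩ (by
          rw [Prod.dist_eq]
          simp only [dist_self]
          rw [Real.dist_eq, max_eq_left (abs_nonneg _), abs_of_nonneg (by linarith [hξ.1])]
          linarith [hξ.2])
        have hd : ω (x0 * (j:ℝ) / N, x0 * (j:ℝ) / N) = 0 := by
          simp only [hωd]
          rw [mul_div_cancel₀ _ (hne _)]; simp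
        rw [hd, Real.dist_eq, sub_zero] at this
        exact (le_abs_self _).trans this.le) (hC _ ha) s s0 R hR hb0 hl
    rw [g3] at this
    exact this
  refine (Finset.sum_le_sum hstep).trans ?_
  rw [Finset.sum_const, Finset.card_range, nsmul_eq_mul]
  rw [lt_div_iff₀ (by positivity)] at hs
  have e2 : (N:ℝ) * (2 * M * κ * (x0 / N) + 2 * (C * M) * |s - s0|) =
      2 * M * κ * x0 + 2 * (N * (C * M)) * |s - s0| := by field_simp
  rw [e2]
  have h2 : 2 * M * κ * x0 ≤ 2 * M * κ := mul_le_of_le_one_right (by positivity) h1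
  have h3 : 0 ≤ N * |s - s0| := by positivity
  nlinarith

namespace Fr
section K
set_option linter.unusedSectionVars false
variable {ι : Type} [Fintype ι] [DecidableEq ι] {Φ : Fr ι} {L : ℝ} (D : Φ.Win L)

lemma Win.K_lip (f : ι → ℝ × ℝ → ℝ) (hf : ∀ l, Continuous (f l)) {M : ℝ} (h : ∀ l p, |f l p| ≤ M)
    (j : ι) (r ξ ζ : ℝ) :
    |D.K f j (Φ.γ j r ξ) - D.K f j (Φ.γ j r ζ)| ≤ M * |ξ - ζ| := by
  have : ∀ ξ, (Φ.γ j r ξ).1 - Φ.σ j (Φ.γ j r ξ).2 = r := by intro ξ; simp [γ]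
  simp only [Win.K, this]
  have h2 := Φ.U_sub f hf j r ζ ξ
  simp only [γ, sub_sub_sub_cancel_right] at h2 ⊢
  rw [h2]
  have := intervalIntegral.norm_integral_le_of_norm_le_const (a := ζ) (b := ξ)
    (f := fun ξ => f j (Φ.γ j r ξ)) (C := M) (fun ξ _ => h j _)
  simpa [γ] using this

lemma Win.U_equi [CompactSpace (Φ.Om L)] (E : Co ι) (hd : ∀ i, E i i = 0) (l : ι) (s0 x0 : ℝ)
    (h0 : 0 ≤ x0) (h1 : x0 ≤ 1) {ε : ℝ} (hε : 0 < ε) :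
    ∀ᶠ s in 𝓝 s0, ∀ g : C(Φ.Om L, ι → ℝ), ‖g‖ ≤ 1 →
      |Φ.U (fE (fun i l => E i l) (fun q j => D.K (fE (fun i l => E i l) (D.ext g)) j q)) l s x0 -
       Φ.U (fE (fun i l => E i l) (fun q j => D.K (fE (fun i l => E i l) (D.ext g)) j q)) l s0 x0| ≤ ε := by
  set M := (1 + Fintype.card ι * D.cΘ) * (Fintype.card ι * ‖E‖) with hMd
  have hcΘ := D.cΘ_nonneg
  have hM : 0 ≤ M := by positivity
  have hM1 : Fintype.card ι * ‖E‖ ≤ M := by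
    have : 0 ≤ Fintype.card ι * D.cΘ * (Fintype.card ι * ‖E‖) := by positivity
    linarith
  have hcard : (0:ℝ) < Fintype.card ι := by
    have : Nonempty ι := ⟨l⟩
    exact_mod_cast Fintype.card_pos
  set ε' := ε / (2 * Fintype.card ι) with hε'
  have hε'p : 0 < ε' := by positivity
  have hEγ : ∀ j, Continuous fun p : ℝ × ℝ => E l j (Φ.γ l p.1 p.2) := fun j =>
    (coC E l j).comp (Φ.γ_cont2 l)
  have ev1 : ∀ j, ∀ᶠ s in 𝓝 s0, ∀ ξ ∈ Icc (0:ℝ) 1,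
      M * |E l j (Φ.γ l s ξ) - E l j (Φ.γ l s0 ξ)| < ε' := by
    intro j
    refine isCompact_Icc.eventually_forall_of_forall_eventually
      (P := fun s ξ => M * |E l j (Φ.γ l s ξ) - E l j (Φ.γ l s0 ξ)| < ε') fun ξ _ => ?_
    have hc : Continuous fun z : ℝ × ℝ => M * |E l j (Φ.γ l z.1 z.2) - E l j (Φ.γ l s0 z.2)| := by
      have h2 : Continuous fun z : ℝ × ℝ => E l j (Φ.γ l s0 z.2) :=
        (hEγ j).comp (f := fun z : ℝ × ℝ => (s0, z.2)) (by fun_prop)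
      exact continuous_const.mul ((hEγ j).sub h2).abs
    have := hc.tendsto (s0, ξ)
    simp only [sub_self, abs_zero, mul_zero] at this
    exact this.eventually_lt_const hε'p
  have ev2 : ∀ j, j ≠ l → ∀ᶠ s in 𝓝 s0, ∀ R : ℝ → ℝ → ℝ,
      Continuous (Function.uncurry R) → (∀ r, ∀ ξ ∈ Icc (0:ℝ) 1, |R r ξ| ≤ M) →
      (∀ r, ∀ ξ ∈ Icc (0:ℝ) 1, ∀ ζ ∈ Icc (0:ℝ) 1, |R r ξ - R r ζ| ≤ M * |ξ - ζ|) →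
      |∫ ξ in (0:ℝ)..x0, E l j (Φ.γ l s0 ξ) *
        (R (s + (Φ.σ l ξ - Φ.σ j ξ)) ξ - R (s0 + (Φ.σ l ξ - Φ.σ j ξ)) ξ)| ≤ ε' := by
    intro j hj
    refine osc (ψ := fun ξ => Φ.σ l ξ - Φ.σ j ξ) (dψ := fun ξ => Φ.dσ l ξ - Φ.dσ j ξ)
      (c := fun ξ => E l j (Φ.γ l s0 ξ)) (fun x => (Φ.hσ l x).sub (Φ.hσ j x))
      ((Φ.hdσ l).sub (Φ.hdσ j)) ?_ ((coC E l j).comp (Φ.γ_cont l s0)) hM h0 h1 s0 hε'p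
    intro x
    rcases Φ.hlt j l hj with h | h
    · have := h x; intro hc; linarith
    · have := h x; intro hc; linarith
  have ev2' : ∀ᶠ s in 𝓝 s0, ∀ j, j ≠ l → ∀ R : ℝ → ℝ → ℝ,
      Continuous (Function.uncurry R) → (∀ r, ∀ ξ ∈ Icc (0:ℝ) 1, |R r ξ| ≤ M) →
      (∀ r, ∀ ξ ∈ Icc (0:ℝ) 1, ∀ ζ ∈ Icc (0:ℝ) 1, |R r ξ - R r ζ| ≤ M * |ξ - ζ|) →
      |∫ ξ in (0:ℝ)..x0, E l j (Φ.γ l s0 ξ) *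
        (R (s + (Φ.σ l ξ - Φ.σ j ξ)) ξ - R (s0 + (Φ.σ l ξ - Φ.σ j ξ)) ξ)| ≤ ε' := by
    refine eventually_all.2 fun j => ?_
    by_cases hj : j = l
    · filter_upwards with s h; exact absurd hj h
    · filter_upwards [ev2 j hj] with s h _; exact h
  filter_upwards [eventually_all.2 ev1, ev2'] with s hs1 hs2 g hg
  set h := fE (fun i l => E i l) (D.ext g) with hh
  have hhc : ∀ l, Continuous (h l) := fun l => fE_cont (coC E) (D.ext_cont g) l
  have hhb : ∀ l p, |h l p| ≤ Fintype.card ι * ‖E‖ := fun l p => (fE_bd D E g l p).trans (by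
    refine mul_le_mul_of_nonneg_left ?_ hcard.le
    exact mul_le_of_le_one_right (norm_nonneg _) hg)
  set R : ι → ℝ → ℝ → ℝ := fun j r ξ => D.K h j (Φ.γ j r ξ) with hR
  have hRc : ∀ j, Continuous (Function.uncurry (R j)) := fun j =>
    (D.K_cont h hhc j).comp (Φ.γ_cont2 j)
  have hRb : ∀ j r, ∀ ξ ∈ Icc (0:ℝ) 1, |R j r ξ| ≤ M := fun j r ξ hξ =>
    D.K_unif h _ (by positivity) hhb hξ.1 hξ.2 j
  have hRl : ∀ j r, ∀ ξ ∈ Icc (0:ℝ) 1, ∀ ζ ∈ Icc (0:ℝ) 1, |R j r ξ - R j r ζ| ≤ M * |ξ - ζ| :=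
    fun j r ξ _ ζ _ => (D.K_lip h hhc hhb j r ξ ζ).trans
      (mul_le_mul_of_nonneg_right hM1 (abs_nonneg _))
  have hRe : ∀ j s ξ, D.K h j (Φ.γ l s ξ) = R j (s + (Φ.σ l ξ - Φ.σ j ξ)) ξ := by
    intro j s ξ
    simp only [hR]
    congr 1
    simp [γ]; ring
  have hRψ : ∀ j s, Continuous fun ξ => R j (s + (Φ.σ l ξ - Φ.σ j ξ)) ξ := by
    intro j s
    have a1 := Φ.σc l
    have a2 := Φ.σc j
    exact (hRc j).comp (f := fun ξ => (s + (Φ.σ l ξ - Φ.σ j ξ), ξ)) (by fun_prop)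
  have hEs : ∀ j s, Continuous fun ξ => E l j (Φ.γ l s ξ) := fun j s =>
    (coC E l j).comp (Φ.γ_cont l s)
  have hU : ∀ s, Φ.U (fE (fun i l => E i l) (fun q j => D.K h j q)) l s x0 =
      ∑ j, ∫ ξ in (0:ℝ)..x0, E l j (Φ.γ l s ξ) * R j (s + (Φ.σ l ξ - Φ.σ j ξ)) ξ := by
    intro s
    unfold U fE
    simp only [hRe]
    rw [intervalIntegral.integral_finsetSum]
    intro j _
    exact ((hEs j s).mul (hRψ j s)).intervalIntegrable _ _
  rw [hU, hU, ← Finset.sum_sub_distrib]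
  refine (Finset.abs_sum_le_sum_abs _ _).trans ?_
  have : ∀ j ∈ Finset.univ, |(∫ ξ in (0:ℝ)..x0, E l j (Φ.γ l s ξ) * R j (s + (Φ.σ l ξ - Φ.σ j ξ)) ξ) -
      ∫ ξ in (0:ℝ)..x0, E l j (Φ.γ l s0 ξ) * R j (s0 + (Φ.σ l ξ - Φ.σ j ξ)) ξ| ≤ ε / Fintype.card ι := by
    intro j _
    by_cases hj : j = l
    · subst hj
      simp [hd j]; positivity
    · have k1 := hs2 j hj (R j) (hRc j) (hRb j) (hRl j)
      have k2 : |∫ ξ in (0:ℝ)..x0, (E l j (Φ.γ l s ξ) - E l j (Φ.γ l s0 ξ)) *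
          R j (s + (Φ.σ l ξ - Φ.σ j ξ)) ξ| ≤ ε' := by
        have := intervalIntegral.norm_integral_le_of_norm_le_const (a := 0) (b := x0)
          (f := fun ξ => (E l j (Φ.γ l s ξ) - E l j (Φ.γ l s0 ξ)) *
            R j (s + (Φ.σ l ξ - Φ.σ j ξ)) ξ) (C := ε') (by
          intro ξ hξ
          rw [uIoc_of_le h0] at hξ
          have hξ1 : ξ ∈ Icc (0:ℝ) 1 := ⟨hξ.1.le, by linarith [hξ.2]⟩
          have q1 := hs1 j ξ hξ1
          have q2 := hRb j (s + (Φ.σ l ξ - Φ.σ j ξ)) ξ hξ1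
          rw [Real.norm_eq_abs, abs_mul, mul_comm]
          exact (mul_le_mul_of_nonneg_right q2 (abs_nonneg _)).trans q1.le)
        rw [sub_zero, abs_of_nonneg h0, Real.norm_eq_abs] at this
        exact this.trans (mul_le_of_le_one_right hε'p.le h1)
      have k3 : (∫ ξ in (0:ℝ)..x0, E l j (Φ.γ l s ξ) * R j (s + (Φ.σ l ξ - Φ.σ j ξ)) ξ) -
        (∫ ξ in (0:ℝ)..x0, E l j (Φ.γ l s0 ξ) * R j (s0 + (Φ.σ l ξ - Φ.σ j ξ)) ξ) =
        (∫ ξ in (0:ℝ)..x0, (E l j (Φ.γ l s ξ) - E l j (Φ.γ l s0 ξ)) *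
          R j (s + (Φ.σ l ξ - Φ.σ j ξ)) ξ) + ∫ ξ in (0:ℝ)..x0, E l j (Φ.γ l s0 ξ) *
        (R j (s + (Φ.σ l ξ - Φ.σ j ξ)) ξ - R j (s0 + (Φ.σ l ξ - Φ.σ j ξ)) ξ) := by
        rw [← intervalIntegral.integral_sub, ← intervalIntegral.integral_add]
        · refine intervalIntegral.integral_congr fun ξ _ => ?_
          ring
        · exact (((hEs j s).sub (hEs j s0)).mul (hRψ j s)).intervalIntegrable _ _
        · exact ((hEs j s0).mul ((hRψ j s).sub (hRψ j s0))).intervalIntegrable _ _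
        · exact ((hEs j s).mul (hRψ j s)).intervalIntegrable _ _
        · exact ((hEs j s0).mul (hRψ j s0)).intervalIntegrable _ _
      rw [k3]
      refine (abs_add_le _ _).trans ((add_le_add k2 k1).trans (le_of_eq ?_))
      rw [hε']; field_simp; ring
  refine (Finset.sum_le_card_nsmul _ _ _ this).trans (le_of_eq ?_)
  rw [Finset.card_univ, nsmul_eq_mul]
  field_simp

lemma Win.frk [CompactSpace (Φ.Om L)] (E : Co ι) (hd : ∀ i, E i i = 0) :
    FRk (D.KL E ∘L D.KL E) := by
  refine frk_of_equicont _ fun p => ?_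
  set M := (1 + Fintype.card ι * D.cΘ) * (Fintype.card ι * ‖E‖) with hMd
  have hcΘ := D.cΘ_nonneg
  have hM : 0 ≤ M := by positivity
  set M1 := Fintype.card ι * (‖E‖ * M) with hM1
  have hM1p : 0 ≤ M1 := by positivity
  set ε := 1 / (4 * (1 + Fintype.card ι * D.cΘ)) with hεd
  have hεp : 0 < ε := by positivity
  have main : ∀ i, ∀ᶠ q : Φ.Om L in 𝓝 p, ∀ g, ‖g‖ ≤ 1 →
      |(D.KL E ∘L D.KL E) g q i - (D.KL E ∘L D.KL E) g p i| ≤ 1 / 2 := by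
    intro i
    have hσi := Φ.σc i
    have hsc : Continuous fun q : Φ.Om L => q.1.1 - Φ.σ i q.1.2 := by fun_prop
    have ev1 : ∀ᶠ q : Φ.Om L in 𝓝 p, M1 * |q.1.2 - p.1.2| + ∑ l, M1 *
        |D.Θ i l (q.1.1 - Φ.σ i q.1.2) - D.Θ i l (p.1.1 - Φ.σ i p.1.2)| < 1 / 4 := by
      have hc : Continuous fun q : Φ.Om L => M1 * |q.1.2 - p.1.2| + ∑ l, M1 *
        |D.Θ i l (q.1.1 - Φ.σ i q.1.2) - D.Θ i l (p.1.1 - Φ.σ i p.1.2)| := by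
        have : ∀ l, Continuous fun q : Φ.Om L => D.Θ i l (q.1.1 - Φ.σ i q.1.2) := fun l =>
          (D.Θ_cont i l).comp hsc
        fun_prop
      have := hc.tendsto p
      simp only [sub_self, abs_zero, mul_zero, Finset.sum_const_zero, add_zero] at this
      exact this.eventually_lt_const (by norm_num)
    have ev2 := (hsc.tendsto p).eventually
      (D.U_equi E hd i (p.1.1 - Φ.σ i p.1.2) p.1.2 p.2.1 p.2.2.1 hεp)
    have ev3 := (hsc.tendsto p).eventually (eventually_all.2 fun l =>
      (D.U_equi E hd l (p.1.1 - Φ.σ i p.1.2) 1 zero_le_one le_rfl hεp))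
    filter_upwards [ev1, ev2, ev3] with q hq1 hq2 hq3 g hg
    have hq2 := hq2 g hg
    have hq3 := fun l => hq3 l g hg
    rw [ContinuousLinearMap.comp_apply, D.KL_sq, D.KL_sq]
    set h := fE (fun i l => E i l) (D.ext g) with hh
    have hhc : ∀ l, Continuous (h l) := fun l => fE_cont (coC E) (D.ext_cont g) l
    have hhb : ∀ l p, |h l p| ≤ Fintype.card ι * ‖E‖ := fun l p => (fE_bd D E g l p).trans (by
      refine mul_le_mul_of_nonneg_left ?_ (Nat.cast_nonneg _)
      exact mul_le_of_le_one_right (norm_nonneg _) hg)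
    set f := fE (fun i l => E i l) (fun q j => D.K h j q) with hf
    have hfc : ∀ l, Continuous (f l) := fun l => fE_cont (coC E)
      (continuous_pi fun j => D.K_cont h hhc j) l
    have hfb : ∀ l q, 0 ≤ q.2 → q.2 ≤ 1 → |f l q| ≤ M1 := by
      intro l q h0 h1
      rw [hf]; unfold fE
      refine (Finset.abs_sum_le_sum_abs _ _).trans ?_
      have : ∀ j ∈ Finset.univ, |E l j q * D.K h j q| ≤ ‖E‖ * M := by
        intro j _
        rw [abs_mul]
        exact mul_le_mul (Co_bd E l j q) (D.K_unif h _ (by positivity) hhb h0 h1 j)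
          (abs_nonneg _) (norm_nonneg _)
      refine (Finset.sum_le_card_nsmul _ _ _ this).trans ?_
      simp [hM1]
    have hUl : ∀ l s x y, 0 ≤ x → x ≤ 1 → 0 ≤ y → y ≤ 1 →
        |Φ.U f l s y - Φ.U f l s x| ≤ M1 * |y - x| := by
      intro l s x y hx0 hx1 hy0 hy1
      rw [Φ.U_sub f hfc]
      have := intervalIntegral.norm_integral_le_of_norm_le_const (a := x) (b := y)
        (f := fun ξ => f l (Φ.γ l s ξ)) (C := M1) (fun ξ hξ => hfb l _ (by
          have := hξ.1; simp only [γ]; exact (le_min hx0 hy0).trans this.le) (by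
          have := hξ.2; simp only [γ]; exact this.trans (max_le hx1 hy1)))
      simpa using this
    have hU1 : ∀ l s, |Φ.U f l s 1| ≤ M1 := by
      intro l s
      have := hUl l s 0 1 le_rfl zero_le_one zero_le_one le_rfl
      have h0 : Φ.U f l s 0 = 0 := by simp [U]
      simpa [h0] using this
    unfold Win.K
    set s := q.1.1 - Φ.σ i q.1.2
    set s0 := p.1.1 - Φ.σ i p.1.2
    have e : Φ.U f i s q.1.2 - ∑ l, D.Θ i l s * Φ.U f l s 1 -
        (Φ.U f i s0 p.1.2 - ∑ l, D.Θ i l s0 * Φ.U f l s0 1) =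
        (Φ.U f i s q.1.2 - Φ.U f i s p.1.2) + (Φ.U f i s p.1.2 - Φ.U f i s0 p.1.2) -
        (∑ l, (D.Θ i l s * (Φ.U f l s 1 - Φ.U f l s0 1) + (D.Θ i l s - D.Θ i l s0) * Φ.U f l s0 1)) := by
      have : ∀ l, D.Θ i l s * (Φ.U f l s 1 - Φ.U f l s0 1) + (D.Θ i l s - D.Θ i l s0) * Φ.U f l s0 1
        = D.Θ i l s * Φ.U f l s 1 - D.Θ i l s0 * Φ.U f l s0 1 := fun l => by ring
      simp only [this, Finset.sum_sub_distrib]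
      ring
    rw [e]
    have b1 := hUl i s p.1.2 q.1.2 p.2.1 p.2.2.1 q.2.1 q.2.2.1
    have b2 : |∑ l, (D.Θ i l s * (Φ.U f l s 1 - Φ.U f l s0 1) +
        (D.Θ i l s - D.Θ i l s0) * Φ.U f l s0 1)| ≤
        Fintype.card ι * D.cΘ * ε + ∑ l, M1 * |D.Θ i l s - D.Θ i l s0| := by
      refine (Finset.abs_sum_le_sum_abs _ _).trans ?_
      have : ∀ l ∈ Finset.univ, |D.Θ i l s * (Φ.U f l s 1 - Φ.U f l s0 1) +
        (D.Θ i l s - D.Θ i l s0) * Φ.U f l s0 1| ≤ D.cΘ * ε + M1 * |D.Θ i l s - D.Θ i l s0| := by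
        intro l _
        refine (abs_add_le _ _).trans (add_le_add ?_ ?_)
        · rw [abs_mul]
          exact mul_le_mul (D.Θ_bd i l s) (hq3 l) (abs_nonneg _) hcΘ
        · rw [abs_mul, mul_comm]
          exact mul_le_mul_of_nonneg_right (hU1 l s0) (abs_nonneg _)
      refine (Finset.sum_le_sum this).trans ?_
      rw [Finset.sum_add_distrib]
      simp [mul_assoc]
    have b3 : (1 + Fintype.card ι * D.cΘ) * ε = 1 / 4 := by
      rw [hεd]; field_simp
    refine (abs_sub _ _).trans ?_
    have b4 := abs_add_le (Φ.U f i s q.1.2 - Φ.U f i s p.1.2) (Φ.U f i s p.1.2 - Φ.U f i s0 p.1.2)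
    linarith
  filter_upwards [eventually_all.2 main] with q hq g hg
  refine (pi_norm_le_iff_of_nonneg (by norm_num)).2 fun i => ?_
  exact hq i g hg

end K
end Fr
end Obs

open Set
namespace Obs
open Filter Topology MeasureTheory
open scoped BoundedContinuousFunction

lemma bexp_apply (f : (ℝ × ℝ) →ᵇ ℝ) (p : ℝ × ℝ) : (NormedSpace.exp f) p = Real.exp (f p) := by
  have h := NormedSpace.map_exp_of_mem_ball (𝕂 := ℝ)
    (({ toFun := fun f : (ℝ × ℝ) →ᵇ ℝ => f p, map_one' := rfl, map_mul' := fun _ _ => rfl, map_zero' := rfl,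
        map_add' := fun _ _ => rfl } : ((ℝ × ℝ) →ᵇ ℝ) →+* ℝ)) (continuous_eval_const p) f
        ((NormedSpace.expSeries_radius_eq_top ℝ ((ℝ × ℝ) →ᵇ ℝ)).symm ▸ edist_lt_top _ _)
  rw [Real.exp_eq_exp_ℝ]
  exact h

namespace Fr
section K
set_option linter.unusedSectionVars false
variable {ι : Type} [Fintype ι] [DecidableEq ι] {Φ : Fr ι} {L : ℝ}

lemma Mild.gauge {E E' : ι → ι → ℝ × ℝ → ℝ} (hE : ∀ i l, Continuous (E i l))
    (hS : 0 ≤ L - Φ.σ Φ.j0 1) {w : ℝ × ℝ → ι → ℝ} (hM : Φ.Mild E L w)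
    {P φ : ι → ℝ × ℝ → ℝ} (hP : ∀ i, Continuous (P i)) (hφ : ∀ i, Continuous (φ i))
    (hφp : ∀ i s ξ, 0 ≤ ξ → ξ ≤ 1 → φ i (Φ.γ i s ξ) = Real.exp (∫ ζ in (0:ℝ)..ξ, P i (Φ.γ i s ζ)))
    (hE' : ∀ i l, ∀ p ∈ Φ.Om L, E' i l p * φ l p =
      φ i p * E i l p + if i = l then P i p * φ i p else 0) :
    Φ.Mild E' L (fun p i => φ i p * w p i) := by
  refine ⟨?_, fun i s x y hxy hx hy => ?_, fun t ht i hi => ?_⟩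
  · refine continuousOn_pi.2 fun i => (hφ i).continuousOn.mul ?_
    exact (continuous_apply i).comp_continuousOn hM.cont
  · have hwc := comp_r_cont hS hM.cont
    set G : ℝ → ℝ := fun ξ => fE E (fun p => w (Φ.r L p)) i (Φ.γ i s ξ) with hG
    have hGc : Continuous G := (fE_cont hE hwc i).comp (Φ.γ_cont i s)
    have hPc : Continuous fun ξ => P i (Φ.γ i s ξ) := (hP i).comp (Φ.γ_cont i s)
    set e : ℝ → ℝ := fun ξ => Real.exp (∫ ζ in (0:ℝ)..ξ, P i (Φ.γ i s ζ)) with he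
    have hed : ∀ ξ, HasDerivAt e (e ξ * P i (Φ.γ i s ξ)) ξ := fun ξ =>
      (hPc.integral_hasStrictDerivAt 0 ξ).hasDerivAt.exp
    have hec : Continuous e := continuous_iff_continuousAt.2 fun x => (hed x).continuousAt
    set A : ℝ → ℝ := fun η => w (Φ.γ i s x) i + ∫ ξ in x..η, G ξ with hA
    have hAd : ∀ ξ, HasDerivAt A (G ξ) ξ := fun ξ =>
      ((hGc.integral_hasStrictDerivAt x ξ).hasDerivAt).const_add _
    have hAc : Continuous A := continuous_iff_continuousAt.2 fun x => (hAd x).continuousAt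
    have hAe : ∀ ξ ∈ Icc x y, A ξ = w (Φ.γ i s ξ) i := by
      intro ξ hξ
      have := hM.seg i s x ξ hξ.1 hx (Φ.Om_path hx hy hξ.1 hξ.2)
      simp only [hA]; linarith
    have hee : ∀ ξ ∈ Icc x y, φ i (Φ.γ i s ξ) = e ξ := fun ξ hξ =>
      hφp i s ξ (hx.1.trans hξ.1) (hξ.2.trans hy.2.1)
    have hI := intervalIntegral.integral_eq_sub_of_hasDerivAt (a := x) (b := y)
      (f := fun ξ => e ξ * A ξ) (f' := fun ξ => e ξ * P i (Φ.γ i s ξ) * A ξ + e ξ * G ξ)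
      (fun ξ _ => (hed ξ).mul (hAd ξ)) (((hec.mul hPc).mul hAc |>.add (hec.mul hGc)).intervalIntegrable _ _)
    rw [hee y ⟨hxy, le_rfl⟩, hee x ⟨le_rfl, hxy⟩, ← hAe y ⟨hxy, le_rfl⟩, ← hAe x ⟨le_rfl, hxy⟩, ← hI]
    refine intervalIntegral.integral_congr fun ξ hξ => ?_
    rw [uIcc_of_le hxy] at hξ
    have hm := Φ.Om_path hx hy hξ.1 hξ.2
    have h1 : ∀ l, E' i l (Φ.γ i s ξ) * (φ l (Φ.γ i s ξ) * w (Φ.γ i s ξ) l) =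
        φ i (Φ.γ i s ξ) * (E i l (Φ.γ i s ξ) * w (Φ.γ i s ξ) l) +
          if i = l then P i (Φ.γ i s ξ) * φ i (Φ.γ i s ξ) * w (Φ.γ i s ξ) l else 0 := by
      intro l
      rw [← mul_assoc, hE' i l _ hm]
      split_ifs <;> ring
    simp only [h1, Finset.sum_add_distrib, Finset.sum_ite_eq, Finset.mem_univ, if_true,
      ← Finset.mul_sum]
    rw [hAe ξ hξ, hee ξ hξ]
    simp only [hG, fE]
    rw [Φ.r_id hm]
    ring
  · have h1 : ∀ j, φ j (t, 0) = 1 := by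
      intro j
      have := hφp j t 0 le_rfl zero_le_one
      rw [Φ.γ_zero] at this
      simpa using this
    simp only [h1, one_mul]
    exact hM.b0 t ht i hi

noncomputable def gF (Φ : Fr ι) (i : ι) (f : (ℝ × ℝ) →ᵇ ℝ) (p : ℝ × ℝ) : ℝ :=
  ∫ ζ in (0:ℝ)..cl p.2, f (Φ.γ i (p.1 - Φ.σ i (cl p.2)) ζ)

lemma gF_cont (i : ι) (f : (ℝ × ℝ) →ᵇ ℝ) : Continuous (gF Φ i f) := by
  have h1 := Φ.σc i
  have h2 := cl_cont
  exact (Φ.U_cont (fun _ => f) (fun _ => f.continuous) i).comp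
    (f := fun p : ℝ × ℝ => (p.1 - Φ.σ i (cl p.2), cl p.2)) (by fun_prop)

lemma gF_bd (i : ι) (f : (ℝ × ℝ) →ᵇ ℝ) (p : ℝ × ℝ) : ‖gF Φ i f p‖ ≤ ‖f‖ := by
  have := intervalIntegral.norm_integral_le_of_norm_le_const (a := 0) (b := cl p.2)
    (f := fun ζ => f (Φ.γ i (p.1 - Φ.σ i (cl p.2)) ζ)) (C := ‖f‖) (fun _ _ => f.norm_coe_le_norm _)
  rw [sub_zero, abs_of_nonneg (cl_nonneg _)] at this
  exact this.trans (mul_le_of_le_one_right (norm_nonneg _) (cl_le _))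

noncomputable def gD (Φ : Fr ι) (i : ι) : ((ℝ × ℝ) →ᵇ ℝ) →L[ℝ] ((ℝ × ℝ) →ᵇ ℝ) :=
  LinearMap.mkContinuous
    { toFun := fun f => BoundedContinuousFunction.ofNormedAddCommGroup (gF Φ i f) (gF_cont i f) ‖f‖ (gF_bd i f)
      map_add' := by
        intro f g
        ext p
        exact intervalIntegral.integral_add
          ((f.continuous.comp (Φ.γ_cont i _)).intervalIntegrable _ _)
          ((g.continuous.comp (Φ.γ_cont i _)).intervalIntegrable _ _)
      map_smul' := by
        intro c f
        ext p
        exact intervalIntegral.integral_const_mul _ _ } 1 (by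
      intro f
      rw [one_mul]
      exact (BoundedContinuousFunction.norm_le (norm_nonneg _)).2 (gF_bd i f))

lemma gD_apply (i : ι) (f : (ℝ × ℝ) →ᵇ ℝ) (s ξ : ℝ) (h0 : 0 ≤ ξ) (h1 : ξ ≤ 1) :
    gD Φ i f (Φ.γ i s ξ) = ∫ ζ in (0:ℝ)..ξ, f (Φ.γ i s ζ) := by
  have : gD Φ i f (Φ.γ i s ξ) = gF Φ i f (Φ.γ i s ξ) := rfl
  rw [this, gF]
  simp [γ, cl_id h0 h1]

noncomputable def gφ (Φ : Fr ι) (c : ℝ) (E : Co ι) (i : ι) : (ℝ × ℝ) →ᵇ ℝ :=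
  NormedSpace.exp (c • gD Φ i (E i i))

lemma gφ_path (c : ℝ) (E : Co ι) (i : ι) (s ξ : ℝ) (h0 : 0 ≤ ξ) (h1 : ξ ≤ 1) :
    gφ Φ c E i (Φ.γ i s ξ) = Real.exp (∫ ζ in (0:ℝ)..ξ, c * E i i (Φ.γ i s ζ)) := by
  rw [gφ, bexp_apply, intervalIntegral.integral_const_mul, ← gD_apply i (E i i) s ξ h0 h1]
  rfl

lemma gφ_mul (E : Co ι) (i : ι) (p : ℝ × ℝ) : gφ Φ (-1) E i p * gφ Φ 1 E i p = 1 := by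
  rw [gφ, gφ, bexp_apply, bexp_apply, ← Real.exp_add]
  simp

lemma gφ_pos (c : ℝ) (E : Co ι) (i : ι) (p : ℝ × ℝ) : 0 < gφ Φ c E i p := by
  rw [gφ, bexp_apply]; exact Real.exp_pos _

noncomputable def gE (Φ : Fr ι) (E : Co ι) : Co ι := fun i l =>
  if i = l then 0 else gφ Φ (-1) E i * E i l * gφ Φ 1 E l

lemma gE_diag (E : Co ι) (i : ι) : gE Φ E i i = 0 := by simp [gE]

lemma Mild.gauge1 {E : Co ι} (hS : 0 ≤ L - Φ.σ Φ.j0 1) {w : ℝ × ℝ → ι → ℝ}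
    (hM : Φ.Mild (fun i l => E i l) L w) :
    Φ.Mild (fun i l => gE Φ E i l) L (fun p i => gφ Φ (-1) E i p * w p i) := by
  refine hM.gauge (coC E) hS (P := fun i p => -1 * E i i p) (φ := fun i p => gφ Φ (-1) E i p)
    (fun i => continuous_const.mul (coC E i i)) (fun i => (gφ Φ (-1) E i).continuous)
    (fun i s ξ h0 h1 => gφ_path (-1) E i s ξ h0 h1) ?_
  intro i l p hp
  by_cases h : i = l
  · subst h; simp [gE]; ring
  · simp only [gE, if_neg h, BoundedContinuousFunction.coe_mul, Pi.mul_apply, add_zero]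
    linear_combination (gφ Φ (-1) E i p * E i l p) * gφ_mul (Φ := Φ) E l p

lemma Mild.gauge2 {E : Co ι} (hS : 0 ≤ L - Φ.σ Φ.j0 1) {w : ℝ × ℝ → ι → ℝ}
    (hM : Φ.Mild (fun i l => gE Φ E i l) L w) :
    Φ.Mild (fun i l => E i l) L (fun p i => gφ Φ 1 E i p * w p i) := by
  refine hM.gauge (coC (gE Φ E)) hS (P := fun i p => 1 * E i i p) (φ := fun i p => gφ Φ 1 E i p)
    (fun i => continuous_const.mul (coC E i i)) (fun i => (gφ Φ 1 E i).continuous)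
    (fun i s ξ h0 h1 => gφ_path 1 E i s ξ h0 h1) ?_
  intro i l p hp
  by_cases h : i = l
  · subst h; simp [gE]
  · simp only [gE, if_neg h, BoundedContinuousFunction.coe_mul, Pi.mul_apply, add_zero]
    linear_combination -(gφ Φ 1 E l p * E i l p) * gφ_mul (Φ := Φ) E i p

lemma gφ_analytic (c : ℝ) (i : ι) {𝓔 : ℝ → Co ι} {t : ℝ} (h : AnalyticAt ℝ 𝓔 t) :
    AnalyticAt ℝ (fun s => gφ Φ c (𝓔 s) i) t := by
  have h1 : AnalyticAt ℝ (fun s => 𝓔 s i i) t :=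
    (((ContinuousLinearMap.proj (R := ℝ) (φ := fun _ : ι => (ℝ × ℝ) →ᵇ ℝ) i).comp
      (ContinuousLinearMap.proj (R := ℝ) (φ := fun _ : ι => ι → (ℝ × ℝ) →ᵇ ℝ) i)).analyticAt _).comp h
  have h2 : AnalyticAt ℝ (fun s => c • gD Φ i (𝓔 s i i)) t :=
    ((c • gD Φ i).analyticAt _).comp h1
  exact (NormedSpace.exp_analytic _).comp h2

lemma gE_analytic {𝓔 : ℝ → Co ι} {t : ℝ} (h : AnalyticAt ℝ 𝓔 t) :
    AnalyticAt ℝ (fun s => gE Φ (𝓔 s)) t := by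
  refine AnalyticAt.pi fun i => AnalyticAt.pi fun l => ?_
  by_cases hil : i = l
  · simp only [gE, if_pos hil]; exact analyticAt_const
  · simp only [gE, if_neg hil]
    have h1 : AnalyticAt ℝ (fun s => 𝓔 s i l) t :=
      (((ContinuousLinearMap.proj (R := ℝ) (φ := fun _ : ι => (ℝ × ℝ) →ᵇ ℝ) l).comp
        (ContinuousLinearMap.proj (R := ℝ) (φ := fun _ : ι => ι → (ℝ × ℝ) →ᵇ ℝ) i)).analyticAt _).comp h
    exact ((gφ_analytic (-1) i h).mul h1).mul (gφ_analytic 1 l h)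

end K
end Fr
end Obs

open Set
namespace Obs
open Filter Topology MeasureTheory
open scoped BoundedContinuousFunction

lemma prim_zero {V : Type*} [NormedAddCommGroup V] [NormedSpace ℝ V] [CompleteSpace V] {f : ℝ → V}
    (hf : Continuous f) {ℓ : ℝ} (hℓ : 0 < ℓ) (h : ∀ θ ∈ Icc 0 ℓ, ∫ τ in (0:ℝ)..θ, f τ = 0) :
    ∀ θ ∈ Icc 0 ℓ, f θ = 0 := by
  intro θ hθ
  have h1 : HasDerivWithinAt (fun u => ∫ τ in (0:ℝ)..u, f τ) (f θ) (Icc 0 ℓ) θ :=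
    (hf.integral_hasStrictDerivAt 0 θ).hasDerivAt.hasDerivWithinAt
  have h2 : HasDerivWithinAt (fun u => ∫ τ in (0:ℝ)..u, f τ) 0 (Icc 0 ℓ) θ :=
    (hasDerivWithinAt_const θ (Icc 0 ℓ) (0:V)).congr h (h θ hθ)
  exact (uniqueDiffOn_Icc hℓ θ hθ).eq_deriv (Icc 0 ℓ) h1 h2

namespace Fr
section K
set_option linter.unusedSectionVars false
variable {ι : Type} [Fintype ι] [DecidableEq ι] {Φ : Fr ι} {L : ℝ} (D : Φ.Win L)

lemma Sol.congr {E E' : ι → ι → ℝ × ℝ → ℝ} {w w' : ℝ × ℝ → ι → ℝ} (h : Φ.Sol E L w)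
    (hE : ∀ i l, ∀ p ∈ Φ.Om L, E' i l p = E i l p) (hw : ∀ p ∈ Φ.Om L, w' p = w p) :
    Φ.Sol E' L w' := by
  refine ⟨⟨h.cont.congr hw, fun i s x y hxy hx hy => ?_, fun t ht i hi => ?_⟩, fun t ht => ?_⟩
  · rw [hw _ hx, hw _ hy, h.eq i s x y hxy hx hy]
    refine intervalIntegral.integral_congr fun ξ hξ => ?_
    rw [uIcc_of_le hxy] at hξ
    have hm := Φ.Om_path hx hy hξ.1 hξ.2
    rw [hw _ hm]
    exact Finset.sum_congr rfl fun l _ => by rw [hE _ _ _ hm]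
  · rw [hw _ ht]; exact h.b0 t ht i hi
  · rw [hw _ ht]; exact h.b1 t ht

lemma Sol.lin {E : ι → ι → ℝ × ℝ → ℝ} (hE : ∀ i l, Continuous (E i l)) (hS : 0 ≤ L - Φ.σ Φ.j0 1)
    {w w' : ℝ × ℝ → ι → ℝ} (h : Φ.Sol E L w) (h' : Φ.Sol E L w') (c : ℝ) :
    Φ.Sol E L (fun p => w p + c • w' p) := by
  refine ⟨⟨h.cont.add (h'.cont.const_smul c), fun i s x y hxy hx hy => ?_, fun t ht i hi => ?_⟩, fun t ht => ?_⟩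
  · have e1 := h.seg i s x y hxy hx hy
    have e2 := h'.seg i s x y hxy hx hy
    have c1 := (fE_cont hE (comp_r_cont hS h.cont) i).comp (Φ.γ_cont i s)
    have c2 := (fE_cont hE (comp_r_cont hS h'.cont) i).comp (Φ.γ_cont i s)
    have c3 : Continuous (fun ξ => c * (fE E (fun p => w' (Φ.r L p)) i ∘ Φ.γ i s) ξ) :=
      continuous_const.mul c2
    have e3 := intervalIntegral.integral_add (c1.intervalIntegrable (μ := volume) x y)
      (c3.intervalIntegrable (μ := volume) x y)
    rw [intervalIntegral.integral_const_mul] at e3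
    have e4 : w (Φ.γ i s y) i + c * w' (Φ.γ i s y) i - (w (Φ.γ i s x) i + c * w' (Φ.γ i s x) i) =
      (w (Φ.γ i s y) i - w (Φ.γ i s x) i) + c * (w' (Φ.γ i s y) i - w' (Φ.γ i s x) i) := by ring
    simp only [Pi.add_apply, Pi.smul_apply, smul_eq_mul]
    rw [e4, e1, e2]
    refine e3.symm.trans (intervalIntegral.integral_congr fun ξ hξ => ?_)
    rw [uIcc_of_le hxy] at hξ
    have hm := Φ.Om_path hx hy hξ.1 hξ.2
    simp only [fE, Function.comp]
    rw [Φ.r_id hm, Finset.mul_sum, ← Finset.sum_add_distrib]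
    exact Finset.sum_congr rfl fun l _ => by ring
  · simp only [Pi.add_apply, Pi.smul_apply, smul_eq_mul]
    rw [h.b0 t ht i hi, h'.b0 t ht i hi, Finset.mul_sum, ← Finset.sum_add_distrib]
    exact Finset.sum_congr rfl fun l _ => by ring
  · simp only [h.b1 t ht, h'.b1 t ht, smul_zero, add_zero]

lemma Sol.zero (E : ι → ι → ℝ × ℝ → ℝ) (L : ℝ) : Φ.Sol E L 0 :=
  ⟨⟨continuousOn_const, fun i s x y _ _ _ => by simp, fun t _ i _ => by simp⟩, fun t _ => rfl⟩

def Hs (Φ : Fr ι) (E : ι → ι → ℝ × ℝ → ℝ) (hE : ∀ i l, Continuous (E i l)) (L : ℝ)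
    (hS : 0 ≤ L - Φ.σ Φ.j0 1) : Submodule ℝ C(Icc (0:ℝ) 1, ι → ℝ) where
  carrier := {h | ∃ w, Φ.Sol E L w ∧ ∀ x : Icc (0:ℝ) 1, w (0, x) = h x}
  add_mem' := by
    rintro h h' ⟨w, hw, hi⟩ ⟨w', hw', hi'⟩
    refine ⟨_, hw.lin hE hS hw' 1, fun x => ?_⟩
    simp [hi, hi']
  zero_mem' := ⟨0, Sol.zero E L, fun _ => rfl⟩
  smul_mem' := by
    rintro c h ⟨w, hw, hi⟩
    refine ⟨_, (Sol.zero E L).lin hE hS hw c, fun x => ?_⟩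
    simp [hi]

noncomputable def Bc (Φ : Fr ι) : (ι → ℝ) →L[ℝ] (ι → ℝ) :=
  LinearMap.toContinuousLinearMap
    (open Classical in
    { toFun := fun u i => if Φ.mi i then 0 else u i - ∑ j, Φ.Bm i j * u j
      map_add' := by
        intro u v
        ext i
        simp only [Pi.add_apply]
        split_ifs
        · simp
        · simp only [mul_add, Finset.sum_add_distrib]; ring
      map_smul' := by
        intro c u
        ext i
        simp only [Pi.smul_apply, smul_eq_mul, RingHom.id_apply]
        split_ifs
        · simp
        · simp only [mul_sub, Finset.mul_sum]
          congr 1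
          exact Finset.sum_congr rfl fun j _ => by ring })

lemma Bc_zero (u : ι → ℝ) : Bc Φ u = 0 ↔ ∀ i, ¬ Φ.mi i → u i = ∑ j, Φ.Bm i j * u j := by
  have : ∀ i, Bc Φ u i = open Classical in if Φ.mi i then 0 else u i - ∑ j, Φ.Bm i j * u j := fun i => rfl
  constructor
  · intro h i hi
    have h1 := this i
    rw [h, if_neg hi] at h1
    simp only [Pi.zero_apply] at h1
    linarith
  · intro h
    ext i
    rw [this]
    split_ifs with hi
    · rfl
    · rw [h i hi, sub_self]; rfl

noncomputable def Win.prim [CompactSpace (Φ.Om L)] (c ℓ : ℝ) (Q : (ι → ℝ) →L[ℝ] (ι → ℝ)) :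
    C(Φ.Om L, ι → ℝ) →L[ℝ] C(Icc (0:ℝ) ℓ, ι → ℝ) :=
  LinearMap.mkContinuous
    { toFun := fun z => ⟨fun θ => ∫ τ in (0:ℝ)..θ, Q (D.ext z (τ, c)), by
        have h : Continuous fun τ => Q (D.ext z (τ, c)) :=
          Q.continuous.comp ((D.ext_cont z).comp (by fun_prop))
        exact (intervalIntegral.continuous_primitive (fun _ _ => h.intervalIntegrable _ _) 0).comp
          continuous_subtype_val⟩
      map_add' := by
        intro z z'
        have h : ∀ z, Continuous fun τ => Q (D.ext z (τ, c)) := fun z =>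
          Q.continuous.comp ((D.ext_cont z).comp (by fun_prop))
        ext1 θ
        simp only [ContinuousMap.coe_mk, ContinuousMap.add_apply]
        rw [← intervalIntegral.integral_add ((h z).intervalIntegrable _ _) ((h z').intervalIntegrable _ _)]
        simp [Win.ext]
      map_smul' := by
        intro a z
        ext1 θ
        simp only [ContinuousMap.coe_mk, ContinuousMap.smul_apply, RingHom.id_apply]
        rw [← intervalIntegral.integral_smul]
        simp [Win.ext] } (‖Q‖ * |ℓ|) (by
      intro z
      refine (ContinuousMap.norm_le _ (by positivity)).2 fun θ => ?_
      have := intervalIntegral.norm_integral_le_of_norm_le_const (a := 0) (b := θ)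
        (f := fun τ => Q (D.ext z (τ, c))) (C := ‖Q‖ * ‖z‖) (fun τ _ => by
          refine (Q.le_opNorm _).trans ?_
          refine mul_le_mul_of_nonneg_left ?_ (norm_nonneg _)
          exact z.norm_coe_le_norm _)
      refine this.trans ?_
      have h1 : |(θ:ℝ) - 0| ≤ |ℓ| := by
        rw [sub_zero, abs_of_nonneg θ.2.1]; exact θ.2.2.trans (le_abs_self _)
      calc ‖Q‖ * ‖z‖ * |(θ:ℝ) - 0| ≤ ‖Q‖ * ‖z‖ * |ℓ| := by gcongr
        _ = _ := by ring)

lemma Win.prim_apply [CompactSpace (Φ.Om L)] (c ℓ : ℝ) (Q : (ι → ℝ) →L[ℝ] (ι → ℝ)) (z) (θ : Icc (0:ℝ) ℓ) :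
  D.prim c ℓ Q z θ = ∫ τ in (0:ℝ)..θ, Q (D.ext z (τ, c)) := rfl

abbrev YY (Φ : Fr ι) (L : ℝ) := C(Φ.Om L, ι → ℝ) × (C(Icc (0:ℝ) L, ι → ℝ) × C(Icc (0:ℝ) (L - Φ.σ Φ.j0 1), ι → ℝ))

noncomputable def Win.N [CompactSpace (Φ.Om L)] : C(Φ.Om L, ι → ℝ) →L[ℝ]
    (C(Icc (0:ℝ) L, ι → ℝ) × C(Icc (0:ℝ) (L - Φ.σ Φ.j0 1), ι → ℝ)) :=
  (D.prim 1 L (ContinuousLinearMap.id ℝ _)).prod (D.prim 0 (L - Φ.σ Φ.j0 1) (Bc Φ))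

noncomputable def Win.A [CompactSpace (Φ.Om L)] (E : Co ι) : C(Φ.Om L, ι → ℝ) →L[ℝ] YY Φ L :=
  (ContinuousLinearMap.inl ℝ _ _) ∘L (1 - D.KL E) + (ContinuousLinearMap.inr ℝ _ _) ∘L D.N

lemma Win.A_fst [CompactSpace (Φ.Om L)] (E : Co ι) (z) : (D.A E z).1 = z - D.KL E z := by
  simp [Win.A]
lemma Win.A_snd [CompactSpace (Φ.Om L)] (E : Co ι) (z) : (D.A E z).2 = D.N z := by
  simp [Win.A]

lemma Win.A_P [CompactSpace (Φ.Om L)] (E : Co ι) :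
    ((1 + D.KL E) ∘L ContinuousLinearMap.fst ℝ _ _) ∘L D.A E = 1 - D.KL E ∘L D.KL E := by
  ext1 z
  simp only [ContinuousLinearMap.comp_apply, ContinuousLinearMap.coe_fst', D.A_fst,
    add_apply, sub_apply, map_sub]
  simp
  abel

lemma Win.A_ker [CompactSpace (Φ.Om L)] (E : Co ι) (z) :
    D.A E z = 0 ↔ Φ.Sol (fun i l => E i l) L (D.ext z) := by
  have hzc := D.ext_cont z
  have hL : 0 < L := by
    have h1 := D.S_pos
    have h2 := Φ.σ_mono Φ.hj0 (zero_le_one (α := ℝ))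
    rw [Φ.σ0] at h2; linarith
  have hid : ∀ p ∈ Φ.Om L, ∀ h : p ∈ Φ.Om L, D.ext z p = z ⟨p, h⟩ := fun p _ h => D.ext_id z ⟨p, h⟩
  constructor
  · intro h
    have h1 : z - D.KL E z = 0 := by rw [← D.A_fst, h]; rfl
    have h2 : D.N z = 0 := by rw [← D.A_snd E, h]; rfl
    have h3 : D.prim 1 L (ContinuousLinearMap.id ℝ _) z = 0 := congrArg Prod.fst h2
    have h4 : D.prim 0 (L - Φ.σ Φ.j0 1) (Bc Φ) z = 0 := congrArg Prod.snd h2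
    have h5 := prim_zero (f := fun τ => D.ext z (τ, 1)) (hzc.comp (by fun_prop)) hL
      (fun θ hθ => by
        have := congrArg (fun f => f ⟨θ, hθ⟩) h3
        exact this)
    have h6 := prim_zero (f := fun τ => Bc Φ (D.ext z (τ, 0)))
      ((Bc Φ).continuous.comp (hzc.comp (by fun_prop))) D.S_pos
      (fun θ hθ => by
        have := congrArg (fun f => f ⟨θ, hθ⟩) h4
        exact this)
    refine ⟨D.mild_of_fix (coC E) hzc (fun p hp i => ?_) (fun t ht => ?_), fun t ht => ?_⟩
    · rw [hid p hp hp]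
      have h7 := sub_eq_zero.1 h1
      conv_lhs => rw [h7]
      rfl
    · exact (Bc_zero _).1 (h6 t (Φ.mem_Om_zero.1 ht))
    · exact h5 t (Φ.mem_Om_one.1 ht)
  · intro h
    have h1 : (D.A E z).1 = 0 := by
      rw [D.A_fst, sub_eq_zero]
      ext p i
      rw [D.KL_apply, ← D.ext_id z p, D.rep (coC E) h.toMild p.2 i, Finset.sum_eq_zero, zero_add]
      · refine D.K_local _ _ (fun l => fE_cont (coC E) (comp_r_cont D.S_pos.le h.cont) l)
          (fun l => fE_cont (coC E) hzc l) (fun l q hq => ?_) p.2 i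
        unfold fE
        simp only [Φ.r_id hq]
      · intro l _
        by_cases hΘ : D.Θ i l (p.1.1 - Φ.σ i p.1.2) = 0
        · rw [hΘ, zero_mul]
        · have := h.b1 _ (D.Θ_ne p.2 hΘ)
          simp only [γ] at this ⊢
          rw [this]; simp
    have h2 : (D.A E z).2 = 0 := by
      rw [D.A_snd]
      have hp : ∀ c ℓ (Q : (ι → ℝ) →L[ℝ] (ι → ℝ)), (∀ τ, 0 ≤ τ → τ ≤ ℓ → Q (D.ext z (τ, c)) = 0) →
          D.prim c ℓ Q z = 0 := by
        intro c ℓ Q hQ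
        ext1 θ
        rw [D.prim_apply]
        rw [intervalIntegral.integral_congr (g := fun _ => (0 : ι → ℝ))]
        · simp
        · intro τ hτ
          rw [uIcc_of_le θ.2.1] at hτ
          exact hQ τ hτ.1 (hτ.2.trans θ.2.2)
      refine Prod.ext (hp _ _ _ fun τ h0 h1 => ?_) (hp _ _ _ fun τ h0 h1 => ?_)
      · exact h.b1 τ (Φ.mem_Om_one.2 ⟨h0, h1⟩)
      · exact (Bc_zero _).2 (h.b0 τ (Φ.mem_Om_zero.2 ⟨h0, h1⟩))
    exact Prod.ext h1 h2

noncomputable def Win.W [CompactSpace (Φ.Om L)] : C(Φ.Om L, ι → ℝ) →L[ℝ] C(Icc (0:ℝ) 1, ι → ℝ) :=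
  LinearMap.mkContinuous
    { toFun := fun z => ⟨fun x => z ⟨(0, x), Φ.mem_Om_init D.S_pos.le x.2.1 x.2.2⟩, by fun_prop⟩
      map_add' := fun _ _ => rfl
      map_smul' := fun _ _ => rfl } 1 (by
      intro z
      rw [one_mul]
      exact (ContinuousMap.norm_le _ (norm_nonneg _)).2 fun x => z.norm_coe_le_norm _)

noncomputable def mφ (Φ : Fr ι) (E : Co ι) : C(Icc (0:ℝ) 1, ι → ℝ) →ₗ[ℝ] C(Icc (0:ℝ) 1, ι → ℝ) where
  toFun h := ⟨fun x i => gφ Φ 1 E i (0, x) * h x i, by fun_prop⟩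
  map_add' h h' := by ext x i; exact mul_add _ _ _
  map_smul' c h := by ext x i; exact mul_left_comm _ _ _

lemma mφ_inj (E : Co ι) : Function.Injective (mφ Φ E) := by
  intro h h' hh
  ext x i
  have := congrArg (fun f => f x i) hh
  exact mul_left_cancel₀ (gφ_pos (Φ := Φ) 1 E i (0, x)).ne' this

lemma Win.H_eq [CompactSpace (Φ.Om L)] (E : Co ι) {E0 : ι → ι → ℝ × ℝ → ℝ} (hE0 : ∀ i l, Continuous (E0 i l))
    (hEE : ∀ i l, ∀ p ∈ Φ.Om L, E i l p = E0 i l p) :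
    Hs Φ E0 hE0 L D.S_pos.le = ((D.A (gE Φ E)).ker.map D.W.toLinearMap).map (mφ Φ E) := by
  ext h
  constructor
  · rintro ⟨w, hw, hi⟩
    have h1 := hw.congr (E' := fun i l => E i l) (w' := w) (fun i l p hp => hEE i l p hp) (fun _ _ => rfl)
    have h2 := h1.toMild.gauge1 D.S_pos.le
    set z : C(Φ.Om L, ι → ℝ) := ⟨fun p i => gφ Φ (-1) E i p * w p i, continuousOn_iff_continuous_domRestrict.1 h2.cont⟩ with hz
    have h3 : Φ.Sol (fun i l => gE Φ E i l) L (D.ext z) := by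
      refine Sol.congr (w := fun p i => gφ Φ (-1) E i p * w p i) ⟨h2, fun t ht => ?_⟩ (fun _ _ _ _ => rfl) (fun p hp => ?_)
      · ext i; rw [h1.b1 t ht]; simp
      · exact D.ext_id z ⟨p, hp⟩
    refine ⟨D.W z, ⟨z, (D.A_ker _ z).2 h3, rfl⟩, ?_⟩
    ext x i
    change gφ Φ 1 E i (0, x) * (gφ Φ (-1) E i (0, x) * w (0, x) i) = _
    rw [← mul_assoc, mul_comm (gφ Φ 1 E i _), gφ_mul, one_mul, hi]
  · rintro ⟨_, ⟨z, hz, rfl⟩, rfl⟩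
    have h1 := (D.A_ker _ z).1 hz
    have h2 := h1.toMild.gauge2 D.S_pos.le
    refine ⟨_, Sol.congr (w := fun p i => gφ Φ 1 E i p * D.ext z p i) ⟨h2, fun t ht => ?_⟩
      (fun i l p hp => (hEE i l p hp).symm) (fun _ _ => rfl), fun x => ?_⟩
    · ext i; rw [h1.b1 t ht]; simp
    · ext i
      change gφ Φ 1 E i (0, x) * D.ext z (0, x) i = gφ Φ 1 E i (0, x) * _
      rw [D.ext_id z ⟨(0, x), Φ.mem_Om_init D.S_pos.le x.2.1 x.2.2⟩]
      rfl

def sh (E : ι → ι → ℝ × ℝ → ℝ) (t : ℝ) : ι → ι → ℝ × ℝ → ℝ := fun i l p => E i l (t + p.1, p.2)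

lemma sh_cont {E : ι → ι → ℝ × ℝ → ℝ} (hE : ∀ i l, Continuous (E i l)) (t : ℝ) :
    ∀ i l, Continuous (sh E t i l) := fun i l => (hE i l).comp (by fun_prop)

theorem Win.gen {E : ι → ι → ℝ × ℝ → ℝ} (hE : ∀ i l, Continuous (E i l)) {a b : ℝ} (hab : a < b)
    (𝓔 : ℝ → Co ι) (h𝓔 : AnalyticOnNhd ℝ 𝓔 (Ioo a b))
    (hEE : ∀ t ∈ Ioo a b, ∀ i l, ∀ p ∈ Φ.Om L, 𝓔 t i l p = sh E t i l p) :
    (∀ t ∈ Ioo a b, FiniteDimensional ℝ (Hs Φ (sh E t) (sh_cont hE t) L D.S_pos.le)) ∧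
    ∃ g : ℕ, ∀ t ∈ Ioo a b, ∀ᶠ s in 𝓝[≠] t,
      Module.finrank ℝ (Hs Φ (sh E s) (sh_cont hE s) L D.S_pos.le) = g := by
  have := D.compact
  have hK : ∀ t ∈ Ioo a b, AnalyticAt ℝ (fun s => D.KL (gE Φ (𝓔 s))) t := by
    intro t ht
    have h2 := gE_analytic (Φ := Φ) (h𝓔 t ht)
    have h1 : AnalyticAt ℝ (fun e : Co ι => D.KL e) (gE Φ (𝓔 t)) := by
      let K' : Co ι →L[ℝ] (C(Φ.Om L, ι → ℝ) →L[ℝ] C(Φ.Om L, ι → ℝ)) := D.KL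
      exact ContinuousLinearMap.analyticAt (𝕜 := ℝ) (E := Co ι)
        (F := C(Φ.Om L, ι → ℝ) →L[ℝ] C(Φ.Om L, ι → ℝ)) K' _
    exact h1.comp_of_eq h2 rfl
  have h := gc_image hab (fun t => D.A (gE Φ (𝓔 t))) (fun t => D.KL (gE Φ (𝓔 t)) ∘L D.KL (gE Φ (𝓔 t)))
    D.W (fun t ht => (analyticAt_clm_comp analyticAt_const (analyticAt_const.sub (hK t ht))).add
      analyticAt_const) (fun t ht => analyticAt_clm_comp (hK t ht) (hK t ht))
    (fun t ht => D.frk _ (gE_diag _)) (fun t ht => ⟨_, D.A_P _⟩)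
  refine ⟨fun t ht => ?_, ?_⟩
  · have := h.1 t ht
    rw [D.H_eq (𝓔 t) (sh_cont hE t) (hEE t ht)]
    infer_instance
  · obtain ⟨g, hg⟩ := h.2
    refine ⟨g, fun t ht => ?_⟩
    have hn : ∀ᶠ s in 𝓝[≠] t, s ∈ Ioo a b := nhdsWithin_le_nhds (Ioo_mem_nhds ht.1 ht.2)
    filter_upwards [hg t ht, hn] with s hs hsm
    rw [D.H_eq (𝓔 s) (sh_cont hE s) (hEE s hsm), ← hs]
    exact (Submodule.equivMapOfInjective _ (mφ_inj _) _).finrank_eq.symm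

end K
end Fr
end Obs

open Set
namespace Obs
open Filter Topology MeasureTheory
open scoped BoundedContinuousFunction
namespace Fr
section K
set_option linter.unusedSectionVars false
variable {ι : Type} [Fintype ι] [DecidableEq ι] {Φ : Fr ι} {L : ℝ}

lemma Om_shift {L' d : ℝ} (hd : 0 ≤ d) (hL : L' + d ≤ L) {p : ℝ × ℝ} (hp : p ∈ Φ.Om L') :
    (d + p.1, p.2) ∈ Φ.Om L := by
  obtain ⟨a1, a2, a3, a4⟩ := hp
  exact ⟨a1, a2, by simp only; linarith, by simp only; linarith⟩

lemma γ_shift (i : ι) (d s ξ : ℝ) : (d + (Φ.γ i s ξ).1, (Φ.γ i s ξ).2) = Φ.γ i (d + s) ξ := by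
  simp [γ, add_assoc]

lemma Sol.shift {E : ι → ι → ℝ × ℝ → ℝ} {w : ℝ × ℝ → ι → ℝ} (h : Φ.Sol E L w) {L' d : ℝ}
    (hd : 0 ≤ d) (hL : L' + d ≤ L) : Φ.Sol (sh E d) L' (fun p => w (d + p.1, p.2)) := by
  refine ⟨⟨?_, fun i s x y hxy hx hy => ?_, fun t ht i hi => ?_⟩, fun t ht => ?_⟩
  · exact h.cont.comp (f := fun p : ℝ × ℝ => (d + p.1, p.2)) (by fun_prop) fun p hp => Om_shift hd hL hp
  · have hx' := Om_shift hd hL hx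
    have hy' := Om_shift hd hL hy
    simp only [sh]
    simp only [γ_shift] at hx' hy' ⊢
    exact h.eq i (d + s) x y hxy hx' hy'
  · exact h.b0 _ (Om_shift hd hL ht) i hi
  · exact h.b1 _ (Om_shift hd hL ht)

lemma sh_zero (E : ι → ι → ℝ × ℝ → ℝ) : sh E 0 = E := by
  funext i l p; simp [sh]

lemma sh_sh (E : ι → ι → ℝ × ℝ → ℝ) (t d : ℝ) : sh (sh E t) d = sh E (t + d) := by
  funext i l p; simp [sh, add_assoc]

lemma Sol.mono {E : ι → ι → ℝ × ℝ → ℝ} {w : ℝ × ℝ → ι → ℝ} (h : Φ.Sol E L w) {L' : ℝ} (hL : L' ≤ L) :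
    Φ.Sol E L' w := by
  have := h.shift (L' := L') le_rfl (by linarith)
  simpa [sh_zero] using this

lemma Sol.glue {E : ι → ι → ℝ × ℝ → ℝ} (hE : ∀ i l, Continuous (E i l)) {L1 L2 d : ℝ}
    {w1 w2 : ℝ × ℝ → ι → ℝ} (h1 : Φ.Sol E L1 w1)
    (h2 : Φ.Sol (sh E d) L2 w2) (hd0 : 0 ≤ d) (hd : d ≤ L1 - Φ.σ Φ.j0 1) (hS2 : 0 ≤ L2 - Φ.σ Φ.j0 1)
    (hm : ∀ x ∈ Icc (0:ℝ) 1, w1 (d, x) = w2 (0, x)) :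
    ∃ w, Φ.Sol E (d + L2) w ∧ ∀ x ∈ Icc (0:ℝ) 1, w (0, x) = w1 (0, x) := by
  have hs : ∀ x, 0 ≤ x → 0 ≤ Φ.σ Φ.j0 x := fun x hx => by
    have := Φ.σ_mono Φ.hj0 hx; rwa [Φ.σ0] at this
  have m1 : ∀ p ∈ Φ.Om (d + L2), p.1 ≤ d → p ∈ Φ.Om L1 := by
    rintro p ⟨a1, a2, a3, a4⟩ h
    exact ⟨a1, a2, a3, by have := hs _ a1; linarith⟩
  have m2 : ∀ p ∈ Φ.Om (d + L2), d ≤ p.1 → (p.1 - d, p.2) ∈ Φ.Om L2 := by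
    rintro p ⟨a1, a2, a3, a4⟩ h
    exact ⟨a1, a2, by simp only; linarith, by simp only; linarith⟩
  set W : ℝ × ℝ → ι → ℝ := fun p => w1 (min p.1 d, p.2) + w2 (max p.1 d - d, p.2) - w1 (d, p.2) with hW
  have W1 : ∀ p ∈ Φ.Om (d + L2), p.1 ≤ d → W p = w1 p := by
    intro p hp h
    simp only [hW, min_eq_left h, max_eq_right h, sub_self]
    rw [← hm _ ⟨hp.1, hp.2.1⟩]; simp
  have W2 : ∀ p ∈ Φ.Om (d + L2), d ≤ p.1 → W p = w2 (p.1 - d, p.2) := by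
    intro p hp h
    simp only [hW, min_eq_right h, max_eq_left h]
    simp
  have md : ∀ p ∈ Φ.Om (d + L2), (d, p.2) ∈ Φ.Om L1 := by
    rintro p ⟨a1, a2, a3, a4⟩
    exact ⟨a1, a2, hd0, by have := hs _ a1; simp only; linarith⟩
  have e1 : ∀ i s x y, x ≤ y → Φ.γ i s x ∈ Φ.Om (d + L2) → Φ.γ i s y ∈ Φ.Om (d + L2) →
      (Φ.γ i s x).1 ≤ d → (Φ.γ i s y).1 ≤ d → W (Φ.γ i s y) i - W (Φ.γ i s x) i =
      ∫ ξ in x..y, fE E (fun p => W (Φ.r (d + L2) p)) i (Φ.γ i s ξ) := by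
    intro i s x y hxy hx hy hx' hy'
    rw [W1 _ hx hx', W1 _ hy hy', h1.eq i s x y hxy (m1 _ hx hx') (m1 _ hy hy')]
    refine intervalIntegral.integral_congr fun ξ hξ => ?_
    rw [uIcc_of_le hxy] at hξ
    have hm' := Φ.Om_path hx hy hξ.1 hξ.2
    have : (Φ.γ i s ξ).1 ≤ d := by
      simp only [γ] at hx' hy' ⊢
      by_cases hi : Φ.mi i
      · have := Φ.σ_mono hi hξ.2; linarith
      · have := Φ.σ_anti hi hξ.1; linarith
    simp only [fE]
    rw [Φ.r_id hm', W1 _ hm' this]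
  have e2 : ∀ i s x y, x ≤ y → Φ.γ i s x ∈ Φ.Om (d + L2) → Φ.γ i s y ∈ Φ.Om (d + L2) →
      d ≤ (Φ.γ i s x).1 → d ≤ (Φ.γ i s y).1 → W (Φ.γ i s y) i - W (Φ.γ i s x) i =
      ∫ ξ in x..y, fE E (fun p => W (Φ.r (d + L2) p)) i (Φ.γ i s ξ) := by
    intro i s x y hxy hx hy hx' hy'
    have hg : ∀ ξ, ((Φ.γ i s ξ).1 - d, (Φ.γ i s ξ).2) = Φ.γ i (s - d) ξ := by
      intro ξ; simp only [γ]; congr 1; ring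
    have k1 := m2 _ hx hx'
    have k2 := m2 _ hy hy'
    rw [W2 _ hx hx', W2 _ hy hy']
    simp only [hg] at k1 k2 ⊢
    rw [h2.eq i (s - d) x y hxy k1 k2]
    refine intervalIntegral.integral_congr fun ξ hξ => ?_
    rw [uIcc_of_le hxy] at hξ
    have hm' := Φ.Om_path hx hy hξ.1 hξ.2
    have : d ≤ (Φ.γ i s ξ).1 := by
      simp only [γ] at hx' hy' ⊢
      by_cases hi : Φ.mi i
      · have := Φ.σ_mono hi hξ.1; linarith
      · have := Φ.σ_anti hi hξ.2; linarith
    simp only [fE, sh]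
    rw [Φ.r_id hm', W2 _ hm' this, γ_shift, hg]
    simp
  have hWc : ContinuousOn W (Φ.Om (d + L2)) := by
    refine ((h1.cont.comp (f := fun p : ℝ × ℝ => (min p.1 d, p.2)) (by fun_prop) ?_).add
      (h2.cont.comp (f := fun p : ℝ × ℝ => (max p.1 d - d, p.2)) (by fun_prop) ?_)).sub
      (h1.cont.comp (f := fun p : ℝ × ℝ => (d, p.2)) (by fun_prop) md)
    · intro p hp
      rcases le_total p.1 d with h | h
      · simp only [min_eq_left h]; exact m1 p hp h
      · simp only [min_eq_right h]; exact md p hp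
    · intro p hp
      rcases le_total p.1 d with h | h
      · simp only [max_eq_right h, sub_self]; exact Φ.mem_Om_init hS2 hp.1 hp.2.1
      · simp only [max_eq_left h]; exact m2 p hp h
  refine ⟨W, ⟨⟨hWc, fun i s x y hxy hx hy => ?_, fun t ht i hi => ?_⟩, fun t ht => ?_⟩, fun x hx => ?_⟩
  · have key : W (Φ.γ i s y) i - W (Φ.γ i s x) i =
        ∫ ξ in x..y, fE E (fun p => W (Φ.r (d + L2) p)) i (Φ.γ i s ξ) := by
      by_cases c1 : (Φ.γ i s x).1 ≤ d ∧ (Φ.γ i s y).1 ≤ d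
      · exact e1 i s x y hxy hx hy c1.1 c1.2
      by_cases c2 : d ≤ (Φ.γ i s x).1 ∧ d ≤ (Φ.γ i s y).1
      · exact e2 i s x y hxy hx hy c2.1 c2.2
      have hu : d ∈ uIcc (Φ.γ i s x).1 (Φ.γ i s y).1 := by
        rw [mem_uIcc]
        by_contra hc
        push Not at hc
        rcases le_total (Φ.γ i s x).1 d with q | q
        · have := hc.1 q
          exact c1 ⟨q, this.le⟩
        · rcases le_total (Φ.γ i s y).1 d with q' | q'
          · have := hc.2 q'; linarith
          · exact c2 ⟨q, q'⟩
      obtain ⟨ξ, hξ, hd'⟩ := intermediate_value_uIcc (a := x) (b := y)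
        (f := fun ξ => (Φ.γ i s ξ).1) (continuous_fst.comp (Φ.γ_cont i s)).continuousOn hu
      rw [uIcc_of_le hxy] at hξ
      simp only at hd'
      have hmξ := Φ.Om_path hx hy hξ.1 hξ.2
      have cc : Continuous fun ξ => fE E (fun p => W (Φ.r (d + L2) p)) i (Φ.γ i s ξ) :=
        (fE_cont hE (comp_r_cont (by linarith) hWc) i).comp (Φ.γ_cont i s)
      have a1 : W (Φ.γ i s ξ) i - W (Φ.γ i s x) i =
          ∫ ξ in x..ξ, fE E (fun p => W (Φ.r (d + L2) p)) i (Φ.γ i s ξ) := by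
        rcases le_total (Φ.γ i s x).1 d with q | q
        · exact e1 i s x ξ hξ.1 hx hmξ q hd'.le
        · exact e2 i s x ξ hξ.1 hx hmξ q hd'.ge
      have a2 : W (Φ.γ i s y) i - W (Φ.γ i s ξ) i =
          ∫ ξ in ξ..y, fE E (fun p => W (Φ.r (d + L2) p)) i (Φ.γ i s ξ) := by
        rcases le_total (Φ.γ i s y).1 d with q | q
        · exact e1 i s ξ y hξ.2 hmξ hy hd'.le q
        · exact e2 i s ξ y hξ.2 hmξ hy hd'.ge q
      rw [← intervalIntegral.integral_add_adjacent_intervals (cc.intervalIntegrable _ ξ)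
        (cc.intervalIntegrable _ _), ← a1, ← a2]
      ring
    rw [key]
    refine intervalIntegral.integral_congr fun ξ hξ => ?_
    rw [uIcc_of_le hxy] at hξ
    simp only [fE]
    rw [Φ.r_id (Φ.Om_path hx hy hξ.1 hξ.2)]
  · rcases le_total t d with q | q
    · rw [W1 _ ht q]; exact h1.b0 t (m1 _ ht q) i hi
    · rw [W2 _ ht q]; exact h2.b0 _ (m2 _ ht q) i hi
  · rcases le_total t d with q | q
    · rw [W1 _ ht q]; exact h1.b1 t (m1 _ ht q)
    · rw [W2 _ ht q]; exact h2.b1 _ (m2 _ ht q)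
  · exact W1 _ (Φ.mem_Om_init (by linarith) hx.1 hx.2) hd0

lemma max_zero {Z : Set (ℝ × ℝ)} (hZ : IsCompact Z) {w : ℝ × ℝ → ι → ℝ} (hw : ContinuousOn w Z)
    {φ : ℝ × ℝ → ℝ} (hφ : Continuous φ)
    (h : ∀ M, 0 ≤ M → (∀ p ∈ Z, ‖w p‖ ≤ M * Real.exp (φ p)) →
      ∀ p ∈ Z, ‖w p‖ ≤ M / 2 * Real.exp (φ p)) : ∀ p ∈ Z, w p = 0 := by
  intro p hp
  have hc : ContinuousOn (fun p => ‖w p‖ * Real.exp (-φ p)) Z :=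
    hw.norm.mul (by fun_prop)
  obtain ⟨q, hq, hmax⟩ := hZ.exists_isMaxOn ⟨p, hp⟩ hc
  set M := ‖w q‖ * Real.exp (-φ q) with hM
  have hM0 : 0 ≤ M := by positivity
  have hb : ∀ p ∈ Z, ‖w p‖ ≤ M * Real.exp (φ p) := by
    intro p hp
    have h1 : ‖w p‖ * Real.exp (-φ p) ≤ M := hmax hp
    calc ‖w p‖ = ‖w p‖ * Real.exp (-φ p) * Real.exp (φ p) := by
          rw [mul_assoc, ← Real.exp_add]; simp
      _ ≤ _ := by gcongr
  have h2 := h M hM0 hb q hq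
  have h3 : M ≤ M / 2 := by
    calc M ≤ M / 2 * Real.exp (φ q) * Real.exp (-φ q) := by rw [hM]; gcongr
      _ = M / 2 := by rw [mul_assoc, ← Real.exp_add]; simp
  have h4 : M = 0 := by linarith
  have := hb p hp
  rw [h4, zero_mul] at this
  exact norm_le_zero_iff.1 this

lemma E_bd {E : ι → ι → ℝ × ℝ → ℝ} (hE : ∀ i l, Continuous (E i l)) (hS : 0 ≤ L - Φ.σ Φ.j0 1) :
    ∃ c, 0 < c ∧ ∀ p ∈ Φ.Om L, ∀ i, ∑ l, |E i l p| ≤ c := by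
  have hc : Continuous (fun p => ∑ i, ∑ l, |E i l p|) :=
    continuous_finsetSum _ fun i _ => continuous_finsetSum _ fun l _ => (hE i l).abs
  obtain ⟨c, hc⟩ := (Φ.Om_compact L hS).bddAbove_image hc.continuousOn
  refine ⟨max c 1, by positivity, fun p hp i => le_max_of_le_left ?_⟩
  refine le_trans ?_ (hc ⟨p, hp, rfl⟩)
  exact Finset.single_le_sum (f := fun i => ∑ l, |E i l p|)
    (fun i _ => Finset.sum_nonneg fun l _ => abs_nonneg _) (Finset.mem_univ i)

lemma κ_ex (Φ : Fr ι) : ∃ κ, 0 < κ ∧ ∀ i, ∀ x ∈ Icc (0:ℝ) 1, κ ≤ |Φ.dσ i x| := by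
  have h : ∀ i, ∃ κ, 0 < κ ∧ ∀ x ∈ Icc (0:ℝ) 1, κ ≤ |Φ.dσ i x| := by
    intro i
    obtain ⟨q, hq, hmin⟩ := isCompact_Icc.exists_isMinOn (α := ℝ) (s := Icc (0:ℝ) 1)
      ⟨0, by simp⟩ ((Φ.hdσ i).abs.continuousOn)
    refine ⟨|Φ.dσ i q|, abs_pos.2 ?_, fun x hx => hmin hx⟩
    by_cases hi : Φ.mi i
    · exact (Φ.hmi i hi q).ne'
    · exact (Φ.hpl i hi q).ne
  choose κ h1 h2 using h
  obtain ⟨i0, -, h0⟩ := Finset.exists_min_image Finset.univ κ ⟨Φ.j0, Finset.mem_univ _⟩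
  exact ⟨κ i0, h1 i0, fun i x hx => (h0 i (Finset.mem_univ i)).trans (h2 i x hx)⟩

lemma Mild.path_bd {E : ι → ι → ℝ × ℝ → ℝ} {w : ℝ × ℝ → ι → ℝ} (h : Φ.Mild E L w) {c : ℝ}
    (hc0 : 0 ≤ c)
    (hc : ∀ p ∈ Φ.Om L, ∀ i, ∑ l, |E i l p| ≤ c) {i : ι} {s x y : ℝ} (hxy : x ≤ y)
    (hx : Φ.γ i s x ∈ Φ.Om L) (hy : Φ.γ i s y ∈ Φ.Om L) {M : ℝ} (hM : 0 ≤ M) {e G G' : ℝ → ℝ}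
    (hb : ∀ ξ ∈ Icc x y, ‖w (Φ.γ i s ξ)‖ ≤ M * e ξ) (hG : ∀ ξ, HasDerivAt G (G' ξ) ξ)
    (hGc : Continuous G') (he : ∀ ξ ∈ Icc x y, e ξ ≤ G' ξ) :
    |w (Φ.γ i s y) i - w (Φ.γ i s x) i| ≤ c * M * (G y - G x) := by
  rw [h.eq i s x y hxy hx hy, ← intervalIntegral.integral_eq_sub_of_hasDerivAt (fun ξ _ => hG ξ)
    (hGc.intervalIntegrable _ _), ← intervalIntegral.integral_const_mul, ← Real.norm_eq_abs]
  refine intervalIntegral.norm_integral_le_of_norm_le hxy (ae_of_all _ fun ξ hξ => ?_)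
    ((continuous_const.mul hGc).intervalIntegrable _ _)
  have hξ' := Ioc_subset_Icc_self hξ
  have hm := Φ.Om_path hx hy hξ'.1 hξ'.2
  calc ‖∑ l, E i l (Φ.γ i s ξ) * w (Φ.γ i s ξ) l‖
      ≤ ∑ l, |E i l (Φ.γ i s ξ)| * (M * e ξ) := by
        refine (norm_sum_le _ _).trans (Finset.sum_le_sum fun l _ => ?_)
        rw [norm_mul]
        exact mul_le_mul_of_nonneg_left ((norm_le_pi_norm _ l).trans (hb ξ hξ')) (norm_nonneg _)
    _ = (∑ l, |E i l (Φ.γ i s ξ)|) * (M * e ξ) := by rw [Finset.sum_mul]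
    _ ≤ c * (M * e ξ) := by
        refine mul_le_mul_of_nonneg_right (hc _ hm i) ((norm_nonneg _).trans (hb ξ hξ'))
    _ ≤ c * M * G' ξ := by
        rw [← mul_assoc]; exact mul_le_mul_of_nonneg_left (he ξ hξ') (by positivity)

lemma Sol.zero_cone {E : ι → ι → ℝ × ℝ → ℝ} (hE : ∀ i l, Continuous (E i l))
    (hS : 0 ≤ L - Φ.σ Φ.j0 1) {w : ℝ × ℝ → ι → ℝ} (h : Φ.Sol E L w)
    (hL : Φ.σ Φ.imax 1 - Φ.σ Φ.imin 1 ≤ L) : ∀ x ∈ Icc (0:ℝ) 1, w (-Φ.σ Φ.imin 1, x) = 0 := by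
  obtain ⟨c, hc0, hc⟩ := E_bd (Φ := Φ) hE hS
  set Z : Set (ℝ × ℝ) := Φ.Om L ∩ {p | -Φ.σ Φ.imin 1 ≤ p.1 - Φ.σ Φ.imin p.2 ∧
    p.1 - Φ.σ Φ.imax p.2 ≤ L - Φ.σ Φ.imax 1} with hZ
  have hσ1 := Φ.σc Φ.imin
  have hσ2 := Φ.σc Φ.imax
  have hZc : IsCompact Z := by
    refine (Φ.Om_compact L hS).inter_right (IsClosed.inter (s₁ := {p : ℝ × ℝ | -Φ.σ Φ.imin 1 ≤ p.1 - Φ.σ Φ.imin p.2})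
      (s₂ := {p : ℝ × ℝ | p.1 - Φ.σ Φ.imax p.2 ≤ L - Φ.σ Φ.imax 1}) ?_ ?_)
    · exact isClosed_le (by fun_prop) (by fun_prop)
    · exact isClosed_le (by fun_prop) (by fun_prop)
  have key : ∀ p ∈ Z, w p = 0 := by
    refine max_zero hZc (h.cont.mono inter_subset_left) (φ := fun p => (2 * c) * (1 - p.2))
      (by fun_prop) fun M hM hb p hp => ?_
    rw [pi_norm_le_iff_of_nonneg (by positivity)]
    intro i
    obtain ⟨⟨a1, a2, a3, a4⟩, b1, b2⟩ := hp
    set s := p.1 - Φ.σ i p.2 with hs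
    have hγ : Φ.γ i s p.2 = p := Φ.γ_self i p
    have z1 : ∀ ξ, p.2 ≤ ξ → -Φ.σ Φ.imin 1 ≤ (s + Φ.σ i ξ) - Φ.σ Φ.imin ξ := by
      intro ξ hξ
      have := Φ.sub_mono (fun x => Φ.himin i x) hξ
      simp only at this; linarith
    have z2 : ∀ ξ, p.2 ≤ ξ → (s + Φ.σ i ξ) - Φ.σ Φ.imax ξ ≤ L - Φ.σ Φ.imax 1 := by
      intro ξ hξ
      have := Φ.sub_mono (fun x => Φ.himax i x) hξ
      simp only at this; linarith
    have hx : Φ.γ i s p.2 ∈ Φ.Om L := by rw [hγ]; exact ⟨a1, a2, a3, a4⟩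
    have hy : Φ.γ i s 1 ∈ Φ.Om L := by
      refine Φ.mem_Om_one.2 ⟨?_, ?_⟩
      · have := z1 1 a2; linarith
      · have := z2 1 a2; linarith
    have h1 := h.toMild.path_bd hc0.le hc a2 hx hy hM (e := fun ξ => Real.exp (2 * c * (1 - ξ)))
      (G := fun ξ => -(Real.exp (2 * c * (1 - ξ)) / (2 * c)))
      (G' := fun ξ => Real.exp (2 * c * (1 - ξ)))
      (fun ξ hξ => hb _ ⟨Φ.Om_path hx hy hξ.1 hξ.2, z1 ξ hξ.1, z2 ξ hξ.1⟩)
      (fun ξ => by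
        have h1 : HasDerivAt (fun ξ : ℝ => 2 * c * (1 - ξ)) (2 * c * (-1)) ξ :=
          ((hasDerivAt_id ξ).const_sub 1).const_mul (2 * c)
        have := (h1.exp.div_const (2 * c)).neg
        exact this.congr_deriv (by field_simp)) (by fun_prop) (fun ξ _ => le_rfl)
    have hy' : w (Φ.γ i s 1) = 0 := h.b1 _ hy
    rw [hy', hγ, Pi.zero_apply, zero_sub, abs_neg] at h1
    rw [Real.norm_eq_abs]
    refine h1.trans ?_
    simp only [sub_self, mul_zero, Real.exp_zero]
    have : c * M * (-(1 / (2 * c)) - -(Real.exp (2 * c * (1 - p.2)) / (2 * c))) =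
      M / 2 * Real.exp (2 * c * (1 - p.2)) - M / 2 := by field_simp; ring
    rw [this]; linarith
  intro x hx
  refine key _ ⟨⟨hx.1, hx.2, ?_, ?_⟩, ?_, ?_⟩ <;> simp only
  · have := Φ.σ_anti Φ.hneg zero_le_one; rw [Φ.σ0] at this; linarith
  · have := Φ.sub_mono (fun x => Φ.himax Φ.j0 x) hx.2
    have := Φ.σ_mono Φ.hpmax hx.1
    rw [Φ.σ0] at this
    simp only at *
    linarith
  · have := Φ.σ_anti Φ.hneg hx.1; rw [Φ.σ0] at this; linarith
  · have := Φ.σ_mono Φ.hpmax hx.1; rw [Φ.σ0] at this; linarith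

lemma Sol.backward {E : ι → ι → ℝ × ℝ → ℝ} (hE : ∀ i l, Continuous (E i l))
    {w : ℝ × ℝ → ι → ℝ} (h : Φ.Sol E L w) {t1 : ℝ} (ht0 : 0 ≤ t1) (ht1 : t1 ≤ L - Φ.σ Φ.j0 1)
    (hz : ∀ x ∈ Icc (0:ℝ) 1, w (t1, x) = 0) : ∀ x ∈ Icc (0:ℝ) 1, w (0, x) = 0 := by
  have hS : 0 ≤ L - Φ.σ Φ.j0 1 := ht0.trans ht1
  obtain ⟨c, hc0, hc⟩ := E_bd (Φ := Φ) hE hS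
  obtain ⟨κ, hκ0, hκ⟩ := Φ.κ_ex
  set β := ∑ i, ∑ j, |Φ.Bm i j| with hβ
  have hβ0 : 0 ≤ β := Finset.sum_nonneg fun _ _ => Finset.sum_nonneg fun _ _ => abs_nonneg _
  set μ := 2 * (1 + β) * c / κ with hμ
  have hμ0 : 0 < μ := by positivity
  set Z : Set (ℝ × ℝ) := Icc 0 t1 ×ˢ Icc 0 1 with hZ
  have hZO : Z ⊆ Φ.Om L := by
    rintro p ⟨⟨a1, a2⟩, b1, b2⟩
    refine ⟨b1, b2, a1, ?_⟩
    have := Φ.σ_mono Φ.hj0 b1; rw [Φ.σ0] at this; linarith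
  have key : ∀ p ∈ Z, w p = 0 := by
    refine max_zero (isCompact_Icc.prod isCompact_Icc) (h.cont.mono hZO)
      (φ := fun p => μ * (t1 - p.1)) (by fun_prop) fun M hM hb p hp => ?_
    have hG : ∀ i s ξ, HasDerivAt (fun ξ => -(Real.exp (μ * (t1 - (s + Φ.σ i ξ))) / (μ * κ)))
        (Φ.dσ i ξ / κ * Real.exp (μ * (t1 - (s + Φ.σ i ξ)))) ξ := by
      intro i s ξ
      have h1 := ((((Φ.hσ i ξ).const_add s).const_sub t1).const_mul μ)
      have := (h1.exp.div_const (μ * κ)).neg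
      exact this.congr_deriv (by field_simp)
    have hGc : ∀ i s, Continuous fun ξ => Φ.dσ i ξ / κ * Real.exp (μ * (t1 - (s + Φ.σ i ξ))) := by
      intro i s
      have := Φ.σc i
      have := Φ.hdσ i
      fun_prop
    have Mc : c * M / (μ * κ) * (1 + β) = M / 2 := by
      rw [hμ]; field_simp
    have Mc0 : 0 ≤ c * M / (μ * κ) := by positivity
    have hmin : ∀ i, Φ.mi i → ∀ p ∈ Z, |w p i| ≤ c * M / (μ * κ) * Real.exp (μ * (t1 - p.1)) := by
      intro i hi p hp
      set s := p.1 - Φ.σ i p.2 with hs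
      have hγ : Φ.γ i s p.2 = p := Φ.γ_self i p
      obtain ⟨⟨a1, a2⟩, b1, b2⟩ := hp
      obtain ⟨y, hy, hyt, hyw⟩ : ∃ y ∈ Icc p.2 1, s + Φ.σ i y ≤ t1 ∧ w (Φ.γ i s y) = 0 := by
        rcases le_total (s + Φ.σ i 1) t1 with q | q
        · refine ⟨1, ⟨b2, le_rfl⟩, q, h.b1 _ (Φ.mem_Om_one.2 ⟨?_, ?_⟩)⟩
          · have := Φ.σ_mono hi b2; linarith
          · have := Φ.σ_mono Φ.hj0 zero_le_one; rw [Φ.σ0] at this; linarith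
        · have hcs := Φ.σc i
          obtain ⟨y, hy, hyt⟩ := intermediate_value_Icc (f := fun ξ => s + Φ.σ i ξ) b2
            (by fun_prop) (show t1 ∈ _ from ⟨by linarith, q⟩)
          simp only at hyt
          refine ⟨y, hy, hyt.le, ?_⟩
          rw [γ, hyt]
          exact hz y ⟨b1.trans hy.1, hy.2⟩
      have mZ : ∀ ξ ∈ Icc p.2 y, Φ.γ i s ξ ∈ Z := by
        intro ξ hξ
        have q1 := Φ.σ_mono hi hξ.1
        have q2 := Φ.σ_mono hi hξ.2
        exact ⟨⟨by simp only [γ]; linarith, by simp only [γ]; linarith⟩,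
          b1.trans hξ.1, hξ.2.trans hy.2⟩
      have h1 := h.toMild.path_bd hc0.le hc hy.1 (hZO (mZ _ ⟨le_rfl, hy.1⟩))
        (hZO (mZ _ ⟨hy.1, le_rfl⟩)) hM
        (e := fun ξ => Real.exp (μ * (t1 - (s + Φ.σ i ξ))))
        (fun ξ hξ => hb _ (mZ ξ hξ)) (hG i s) (hGc i s) (fun ξ hξ => by
          have := hκ i ξ ⟨b1.trans hξ.1, hξ.2.trans hy.2⟩
          rw [abs_of_pos (Φ.hmi i hi ξ)] at this
          refine le_mul_of_one_le_left (Real.exp_pos _).le ?_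
          rwa [le_div_iff₀ hκ0, one_mul])
      rw [hyw, hγ, Pi.zero_apply, zero_sub, abs_neg] at h1
      refine h1.trans ?_
      have e2 : s + Φ.σ i p.2 = p.1 := by rw [hs]; ring
      rw [e2]
      have : 0 ≤ c * M / (μ * κ) * Real.exp (μ * (t1 - (s + Φ.σ i y))) := by positivity
      calc _ = c * M / (μ * κ) * Real.exp (μ * (t1 - p.1)) -
          c * M / (μ * κ) * Real.exp (μ * (t1 - (s + Φ.σ i y))) := by ring
        _ ≤ _ := by linarith
    rw [pi_norm_le_iff_of_nonneg (by positivity)]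
    intro i
    rw [Real.norm_eq_abs]
    by_cases hi : Φ.mi i
    · refine (hmin i hi p hp).trans (mul_le_mul_of_nonneg_right ?_ (Real.exp_pos _).le)
      rw [← Mc]
      exact le_mul_of_one_le_right Mc0 (by linarith)
    set s := p.1 - Φ.σ i p.2 with hs
    have hγ : Φ.γ i s p.2 = p := Φ.γ_self i p
    obtain ⟨⟨a1, a2⟩, b1, b2⟩ := hp
    obtain ⟨y, hy, hyt, hyw⟩ : ∃ y ∈ Icc 0 p.2, s + Φ.σ i y ≤ t1 ∧ |w (Φ.γ i s y) i| ≤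
        c * M / (μ * κ) * β * Real.exp (μ * (t1 - p.1)) := by
      rcases le_total (s + Φ.σ i 0) t1 with q | q
      · refine ⟨0, ⟨le_rfl, b1⟩, q, ?_⟩
        rw [Φ.σ0, add_zero] at q
        have hsp : p.1 ≤ s := by have := Φ.σ_anti hi b1; rw [Φ.σ0] at this; linarith
        have hm : (s, (0:ℝ)) ∈ Z := ⟨⟨by linarith, q⟩, le_rfl, zero_le_one⟩
        rw [Φ.γ_zero, h.b0 s (hZO hm) i hi]
        calc |∑ j, Φ.Bm i j * w (s, 0) j| ≤ ∑ j, |Φ.Bm i j| *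
              (c * M / (μ * κ) * Real.exp (μ * (t1 - p.1))) := by
              refine (Finset.abs_sum_le_sum_abs _ _).trans (Finset.sum_le_sum fun j _ => ?_)
              rw [abs_mul]
              by_cases hj : Φ.Bm i j = 0
              · simp [hj]
              · refine mul_le_mul_of_nonneg_left ((hmin j (Φ.hBm i j hj) _ hm).trans ?_) (abs_nonneg _)
                refine mul_le_mul_of_nonneg_left (Real.exp_le_exp.2 ?_) Mc0
                exact mul_le_mul_of_nonneg_left (by simp only; linarith) hμ0.le
          _ = (∑ j, |Φ.Bm i j|) * (c * M / (μ * κ) * Real.exp (μ * (t1 - p.1))) := by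
              rw [Finset.sum_mul]
          _ ≤ β * (c * M / (μ * κ) * Real.exp (μ * (t1 - p.1))) := by
              refine mul_le_mul_of_nonneg_right ?_ (by positivity)
              exact Finset.single_le_sum (f := fun i => ∑ j, |Φ.Bm i j|)
                (fun i _ => Finset.sum_nonneg fun l _ => abs_nonneg _) (Finset.mem_univ i)
          _ = _ := by ring
      · have hcs := Φ.σc i
        obtain ⟨y, hy, hyt⟩ := intermediate_value_Icc' (f := fun ξ => s + Φ.σ i ξ) b1
          (by fun_prop) (show t1 ∈ _ from ⟨by linarith, q⟩)
        simp only at hyt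
        refine ⟨y, hy, hyt.le, ?_⟩
        rw [γ, hyt, hz y ⟨hy.1, hy.2.trans b2⟩]
        simp only [Pi.zero_apply, abs_zero]
        positivity
    have mZ : ∀ ξ ∈ Icc y p.2, Φ.γ i s ξ ∈ Z := by
      intro ξ hξ
      have q1 := Φ.σ_anti hi hξ.1
      have q2 := Φ.σ_anti hi hξ.2
      exact ⟨⟨by simp only [γ]; linarith, by simp only [γ]; linarith⟩,
        hy.1.trans hξ.1, hξ.2.trans b2⟩
    have h1 := h.toMild.path_bd hc0.le hc hy.2 (hZO (mZ _ ⟨le_rfl, hy.2⟩))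
      (hZO (mZ _ ⟨hy.2, le_rfl⟩)) hM
      (e := fun ξ => Real.exp (μ * (t1 - (s + Φ.σ i ξ))))
      (fun ξ hξ => hb _ (mZ ξ hξ)) (fun ξ => (hG i s ξ).neg) (hGc i s).neg (fun ξ hξ => by
        have := hκ i ξ ⟨hy.1.trans hξ.1, hξ.2.trans b2⟩
        rw [abs_of_neg (Φ.hpl i hi ξ)] at this
        rw [← neg_mul, ← neg_div]
        refine le_mul_of_one_le_left (Real.exp_pos _).le ?_
        rwa [le_div_iff₀ hκ0, one_mul])
    rw [hγ] at h1
    have e2 : s + Φ.σ i p.2 = p.1 := by rw [hs]; ring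
    simp only [Pi.neg_apply] at h1
    rw [e2] at h1
    have h2 : 0 ≤ c * M / (μ * κ) * Real.exp (μ * (t1 - (s + Φ.σ i y))) := by positivity
    have h3 := abs_sub_abs_le_abs_sub (w p i) (w (Φ.γ i s y) i)
    have h4 : M / 2 * Real.exp (μ * (t1 - p.1)) = c * M / (μ * κ) * Real.exp (μ * (t1 - p.1)) +
      c * M / (μ * κ) * β * Real.exp (μ * (t1 - p.1)) := by rw [← Mc]; ring
    have h5 : c * M * (- -(Real.exp (μ * (t1 - p.1)) / (μ * κ)) -
        - -(Real.exp (μ * (t1 - (s + Φ.σ i y))) / (μ * κ))) = c * M / (μ * κ) * Real.exp (μ * (t1 - p.1)) -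
          c * M / (μ * κ) * Real.exp (μ * (t1 - (s + Φ.σ i y))) := by ring
    rw [h5] at h1
    linarith
  intro x hx
  exact key _ ⟨⟨le_rfl, ht0⟩, hx⟩

end K
end Fr
end Obs

open Set
namespace Obs
open Filter Topology MeasureTheory
open scoped BoundedContinuousFunction
namespace Fr
section K
set_option linter.unusedSectionVars false
variable {ι : Type} [Fintype ι] [DecidableEq ι] {Φ : Fr ι} {L : ℝ}

def Extd (Φ : Fr ι) (E : ι → ι → ℝ × ℝ → ℝ) (L L' : ℝ) : Prop :=
  ∀ w, Φ.Sol E L w → ∃ w', Φ.Sol E L' w' ∧ ∀ x ∈ Icc (0:ℝ) 1, w' (0, x) = w (0, x)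

lemma Hs_anti {E : ι → ι → ℝ × ℝ → ℝ} (hE : ∀ i l, Continuous (E i l)) {L L' : ℝ} (hL : L ≤ L')
    (h1 : 0 ≤ L - Φ.σ Φ.j0 1) (h2 : 0 ≤ L' - Φ.σ Φ.j0 1) : Hs Φ E hE L' h2 ≤ Hs Φ E hE L h1 := by
  rintro h ⟨w, hw, hi⟩
  exact ⟨w, hw.mono hL, hi⟩

lemma Extd_of_eq {E : ι → ι → ℝ × ℝ → ℝ} (hE : ∀ i l, Continuous (E i l)) {L L' : ℝ}
    (h1 : 0 ≤ L - Φ.σ Φ.j0 1) (h2 : 0 ≤ L' - Φ.σ Φ.j0 1) (h : Hs Φ E hE L h1 ≤ Hs Φ E hE L' h2) :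
    Φ.Extd E L L' := by
  intro w hw
  have hc : Continuous fun x : Icc (0:ℝ) 1 => w (0, x.1) :=
    hw.cont.comp_continuous (f := fun x : Icc (0:ℝ) 1 => ((0:ℝ), x.1)) (by fun_prop)
      (fun x => Φ.mem_Om_init h1 x.2.1 x.2.2)
  obtain ⟨w', hw', hi⟩ := h (show (⟨_, hc⟩ : C(Icc (0:ℝ) 1, ι → ℝ)) ∈ _ from ⟨w, hw, fun x => rfl⟩)
  exact ⟨w', hw', fun x hx => hi ⟨x, hx⟩⟩

lemma chain_ind {E : ι → ι → ℝ × ℝ → ℝ} (hE : ∀ i l, Continuous (E i l)) {a β L0 δ : ℝ}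
    (hδ : 0 < δ) (hS : 0 < L0 - Φ.σ Φ.j0 1)
    (hG : ∀ t ∈ Ioo a (β - L0 - δ), ∀ᶠ s in 𝓝[≠] t, Φ.Extd (sh E s) L0 (L0 + δ)) (n : ℕ) :
    ∀ t ℓ, a < t → Φ.Extd (sh E t) L0 (L0 + δ) → L0 ≤ ℓ → ℓ ≤ L0 + n * (δ / 2) → t + ℓ + δ < β →
      Φ.Extd (sh E t) L0 ℓ := by
  induction n with
  | zero =>
    intro t ℓ _ _ h1 h2 _ w hw
    exact ⟨w, hw.mono (by simpa using h2), fun _ _ => rfl⟩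
  | succ n ih =>
    intro t ℓ hat hgt h1 h2 h3 w hw
    rcases le_or_gt ℓ (L0 + δ) with hℓ | hℓ
    · obtain ⟨w', hw', hi⟩ := hgt w hw
      exact ⟨w', hw'.mono hℓ, hi⟩
    obtain ⟨w1, hw1, hi⟩ := hgt w hw
    have e1 : ∀ᶠ s in 𝓝[≠] (t + 3 / 4 * δ), s ∈ Ioo (t + δ / 2) (t + δ) :=
      nhdsWithin_le_nhds (Ioo_mem_nhds (by linarith) (by linarith))
    obtain ⟨t', hG', ht'⟩ := ((hG (t + 3 / 4 * δ) ⟨by linarith, by linarith⟩).and e1).exists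
    have hs := hw1.shift (L' := L0) (d := t' - t) (by linarith [ht'.1]) (by linarith [ht'.2])
    rw [sh_sh, add_sub_cancel] at hs
    push_cast at h2
    obtain ⟨w2, hw2, hi2⟩ := ih t' (ℓ - (t' - t)) (by linarith [ht'.1]) hG' (by linarith [ht'.2])
      (by linarith [ht'.1]) (by linarith) _ hs
    obtain ⟨W, hW, hWi⟩ := Sol.glue (sh_cont hE t) (L2 := ℓ - (t' - t)) (d := t' - t) (w2 := w2) hw1
      (by rw [sh_sh, add_sub_cancel]; exact hw2) (by linarith [ht'.1]) (by linarith [ht'.2])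
      (by linarith [ht'.2]) (fun x hx => by rw [hi2 x hx, add_zero])
    rw [add_sub_cancel] at hW
    exact ⟨W, hW, fun x hx => by rw [hWi x hx, hi x hx]⟩

theorem chain {E : ι → ι → ℝ × ℝ → ℝ} (hE : ∀ i l, Continuous (E i l)) {T0 a β : ℝ} (ha : a < 0)
    (hT1 : Φ.σ Φ.imax 1 - Φ.σ Φ.imin 1 < β) (hS0 : ∀ L, T0 < L → 0 < L - Φ.σ Φ.j0 1)
    (hg : ∀ L (hL : T0 < L), L < β →
      (∀ t ∈ Ioo a (β - L), FiniteDimensional ℝ (Hs Φ (sh E t) (sh_cont hE t) L (hS0 L hL).le)) ∧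
      ∃ g : ℕ, ∀ t ∈ Ioo a (β - L), ∀ᶠ s in 𝓝[≠] t,
        Module.finrank ℝ (Hs Φ (sh E s) (sh_cont hE s) L (hS0 L hL).le) = g)
    {L : ℝ} (hL : T0 < L) (hLβ : L < β) {w : ℝ × ℝ → ι → ℝ} (hw : Φ.Sol E L w) :
    ∀ x ∈ Icc (0:ℝ) 1, w (0, x) = 0 := by
  have hP : ∃ n : ℕ, ∃ L0, ∃ h0 : T0 < L0, L0 < L ∧ ∀ t ∈ Ioo a (β - L0), ∀ᶠ s in 𝓝[≠] t,
      Module.finrank ℝ (Hs Φ (sh E s) (sh_cont hE s) L0 (hS0 L0 h0).le) = n := by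
    have h0 : T0 < (T0 + L) / 2 := by linarith
    obtain ⟨g, hg'⟩ := (hg _ h0 (by linarith)).2
    exact ⟨g, _, h0, by linarith, hg'⟩
  classical
  obtain ⟨L0, h0, hL0, hn⟩ := Nat.find_spec hP
  set g0 := Nat.find hP with hg0
  set δ := min (L - L0) (β - max (Φ.σ Φ.imax 1 - Φ.σ Φ.imin 1) L0) / 2 with hδ
  have hδ0 : 0 < δ := by
    have : 0 < min (L - L0) (β - max (Φ.σ Φ.imax 1 - Φ.σ Φ.imin 1) L0) :=
      lt_min (by linarith) (sub_pos.2 (max_lt hT1 (by linarith)))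
    linarith
  have hδ1 : 2 * δ ≤ L - L0 := by rw [hδ]; have := min_le_left (L - L0) (β - max (Φ.σ Φ.imax 1 - Φ.σ Φ.imin 1) L0); linarith
  have hδ2 : 2 * δ ≤ β - max (Φ.σ Φ.imax 1 - Φ.σ Φ.imin 1) L0 := by
    rw [hδ]; have := min_le_right (L - L0) (β - max (Φ.σ Φ.imax 1 - Φ.σ Φ.imin 1) L0); linarith
  have h1 : T0 < L0 + δ := by linarith
  obtain ⟨g1, hg1⟩ := (hg (L0 + δ) h1 (by linarith)).2
  have hle : g0 ≤ g1 := Nat.find_min' hP ⟨L0 + δ, h1, by linarith, hg1⟩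
  have hG : ∀ t ∈ Ioo a (β - L0 - δ), ∀ᶠ s in 𝓝[≠] t, Φ.Extd (sh E s) L0 (L0 + δ) := by
    intro t ht
    have hin : ∀ᶠ s in 𝓝[≠] t, s ∈ Ioo a (β - L0 - δ) := nhdsWithin_le_nhds (Ioo_mem_nhds ht.1 ht.2)
    filter_upwards [hg1 t ⟨ht.1, by linarith [ht.2]⟩, hn t ⟨ht.1, by linarith [ht.2]⟩, hin] with s k1 k2 k3
    refine Extd_of_eq (sh_cont hE s) (hS0 L0 h0).le (hS0 _ h1).le ?_
    have := (hg L0 h0 (by linarith)).1 s ⟨k3.1, by linarith [k3.2]⟩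
    refine (Submodule.eq_of_le_of_finrank_le (Hs_anti (sh_cont hE s) (by linarith) _ _) ?_).ge
    rw [k1, k2]; exact hle
  set ℓ := max (Φ.σ Φ.imax 1 - Φ.σ Φ.imin 1) L0 with hℓ
  have hin : ∀ᶠ s in 𝓝[>] (0:ℝ), s ∈ Ioo 0 δ := Ioo_mem_nhdsGT hδ0
  have hG0 : ∀ᶠ s in 𝓝[>] (0:ℝ), Φ.Extd (sh E s) L0 (L0 + δ) :=
    (hG 0 ⟨ha, by linarith⟩).filter_mono (nhdsWithin_mono _ fun x hx => ne_of_gt hx)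
  obtain ⟨t, ht, hgt⟩ := (hin.and hG0).exists
  have hs := hw.shift (L' := L0) (d := t) ht.1.le (by linarith [ht.2])
  obtain ⟨n, hn⟩ := exists_nat_ge ((ℓ - L0) / (δ / 2))
  have hℓn : ℓ ≤ L0 + n * (δ / 2) := by
    rw [div_le_iff₀ (by linarith)] at hn; linarith
  obtain ⟨w', hw', hi⟩ := chain_ind hE hδ0 (hS0 L0 h0) hG n t ℓ (ha.trans ht.1) hgt
    (le_max_right _ _) hℓn (by linarith [ht.2]) _ hs
  have hℓ1 : Φ.σ Φ.imax 1 - Φ.σ Φ.imin 1 ≤ ℓ := le_max_left _ _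
  have hℓ2 : L0 ≤ ℓ := le_max_right _ _
  have hSL := hS0 L0 h0
  have hz := hw'.zero_cone (sh_cont hE t) (by linarith) hℓ1
  have q1 := Φ.sub_mono (fun x => Φ.himax Φ.j0 x) (zero_le_one)
  have q2 := Φ.σ_anti Φ.hneg zero_le_one
  simp only [Φ.σ0] at q1 q2
  have hz' := hw'.backward (sh_cont hE t) (t1 := -Φ.σ Φ.imin 1) (by linarith) (by linarith) hz
  refine hw.backward hE (t1 := t) ht.1.le (by linarith [ht.2]) fun x hx => ?_
  rw [← hz' x hx, hi x hx, add_zero]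

end K
end Fr
end Obs

open Set
namespace Obs
open Filter Topology MeasureTheory
open scoped BoundedContinuousFunction

lemma hsub {h : ℝ → ℝ} (hm : Measurable h) (h0 : ∀ t, 0 ≤ h t) (hi : Integrable h) {ψ dψ : ℝ → ℝ}
    (hψ : ∀ ξ, HasDerivAt ψ (dψ ξ) ξ) (hs : (∀ ξ, 0 < dψ ξ) ∨ (∀ ξ, dψ ξ < 0)) {κ x y : ℝ} (hκ : 0 < κ)
    (hb : ∀ ξ ∈ Icc x y, κ ≤ |dψ ξ|) :
    IntegrableOn (fun ξ => h (ψ ξ)) (Icc x y) ∧ ∫ ξ in Icc x y, h (ψ ξ) ≤ κ⁻¹ * ∫ t, h t := by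
  have hc : Continuous ψ := continuous_iff_continuousAt.2 fun x => (hψ x).continuousAt
  have hinj : InjOn ψ (Icc x y) := by
    rcases hs with hs | hs
    · exact (strictMono_of_deriv_pos fun x => by rw [(hψ x).deriv]; exact hs x).injective.injOn
    · exact (strictAnti_of_deriv_neg fun x => by rw [(hψ x).deriv]; exact hs x).injective.injOn
  have h1 := (integrableOn_image_iff_integrableOn_abs_deriv_smul measurableSet_Icc
    (fun ξ _ => (hψ ξ).hasDerivWithinAt) hinj h).1 hi.integrableOn
  have h2 := integral_image_eq_integral_abs_deriv_smul measurableSet_Icc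
    (fun ξ _ => (hψ ξ).hasDerivWithinAt) hinj h
  have hle : ∀ ξ ∈ Icc x y, h (ψ ξ) ≤ κ⁻¹ * (|dψ ξ| • h (ψ ξ)) := by
    intro ξ hξ
    rw [smul_eq_mul, ← mul_assoc]
    refine le_mul_of_one_le_left (h0 _) ?_
    rw [inv_mul_eq_div, le_div_iff₀ hκ, one_mul]
    exact hb ξ hξ
  have hae : ∀ᵐ ξ ∂(volume.restrict (Icc x y)), h (ψ ξ) ≤ κ⁻¹ * (|dψ ξ| • h (ψ ξ)) :=
    (ae_restrict_iff' measurableSet_Icc).2 (ae_of_all _ hle)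
  refine ⟨?_, ?_⟩
  · refine Integrable.mono' (h1.const_mul κ⁻¹) (hm.comp hc.measurable).aestronglyMeasurable ?_
    filter_upwards [hae] with ξ hξ
    rw [Real.norm_eq_abs, abs_of_nonneg (h0 _)]; exact hξ
  · calc ∫ ξ in Icc x y, h (ψ ξ) ≤ ∫ ξ in Icc x y, κ⁻¹ * (|dψ ξ| • h (ψ ξ)) :=
          integral_mono_of_nonneg (ae_of_all _ fun ξ => h0 _) (h1.const_mul κ⁻¹) hae
      _ = κ⁻¹ * ∫ t in ψ '' Icc x y, h t := by rw [integral_const_mul, h2]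
      _ ≤ _ := mul_le_mul_of_nonneg_left (setIntegral_le_integral hi (ae_of_all _ h0))
          (by positivity)

lemma hint {V J : Type*} [NormedAddCommGroup V] [NormedSpace ℝ V] {h : ℝ → ℝ} (hm : Measurable h)
    (h0 : ∀ t, 0 ≤ h t) (hi : Integrable h) (S : Finset J) {ψ dψ : J → ℝ → ℝ}
    (hψ : ∀ j ξ, HasDerivAt (ψ j) (dψ j ξ) ξ)
    (hs : ∀ j ∈ S, (∀ ξ, 0 < dψ j ξ) ∨ (∀ ξ, dψ j ξ < 0)) {κ x y : ℝ} (hκ : 0 < κ) (hxy : x ≤ y)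
    (hb : ∀ j ∈ S, ∀ ξ ∈ Icc x y, κ ≤ |dψ j ξ|) {f : ℝ → V} {c : ℝ} (hc : 0 ≤ c)
    (hf : ∀ ξ ∈ Icc x y, ‖f ξ‖ ≤ c * ∑ j ∈ S, h (ψ j ξ)) :
    ‖∫ ξ in x..y, f ξ‖ ≤ c * (S.card * (κ⁻¹ * ∫ t, h t)) := by
  have hS := fun j (hj : j ∈ S) => hsub hm h0 hi (hψ j) (hs j hj) hκ (hb j hj)
  have hI : IntegrableOn (fun ξ => ∑ j ∈ S, h (ψ j ξ)) (Icc x y) :=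
    integrable_finsetSum S fun j hj => (hS j hj).1
  have h1 : ‖∫ ξ in x..y, f ξ‖ ≤ ∫ ξ in x..y, c * ∑ j ∈ S, h (ψ j ξ) :=
    intervalIntegral.norm_integral_le_of_norm_le hxy
      (ae_of_all _ fun ξ hξ => hf ξ (Ioc_subset_Icc_self hξ))
      ((intervalIntegrable_iff_integrableOn_Icc_of_le hxy).2 (hI.const_mul c))
  refine h1.trans ?_
  rw [intervalIntegral.integral_const_mul]
  refine mul_le_mul_of_nonneg_left ?_ hc
  rw [intervalIntegral.integral_of_le hxy, ← integral_Icc_eq_integral_Ioc,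
    integral_finsetSum S fun j hj => (hS j hj).1]
  refine (Finset.sum_le_card_nsmul S _ _ fun j hj => (hS j hj).2).trans ?_
  simp

namespace Fr
section K
set_option linter.unusedSectionVars false
variable {ι : Type} [Fintype ι] [DecidableEq ι] {Φ : Fr ι} {L : ℝ} (D : Φ.Win L)

lemma κ_ex2 (Φ : Fr ι) : ∃ κ, 0 < κ ∧ κ ≤ 1 ∧ (∀ i, ∀ x ∈ Icc (0:ℝ) 1, κ ≤ |Φ.dσ i x|) ∧
    ∀ i l, i ≠ l → ∀ x ∈ Icc (0:ℝ) 1, κ ≤ |Φ.dσ i x - Φ.dσ l x| := by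
  obtain ⟨κ, h0, h1⟩ := Φ.κ_ex
  have h : ∀ q : ι × ι, ∃ κ, 0 < κ ∧ (q.1 ≠ q.2 → ∀ x ∈ Icc (0:ℝ) 1, κ ≤ |Φ.dσ q.1 x - Φ.dσ q.2 x|) := by
    intro q
    by_cases hq : q.1 = q.2
    · exact ⟨1, one_pos, fun h => absurd hq h⟩
    obtain ⟨x, hx, hmin⟩ := isCompact_Icc.exists_isMinOn (α := ℝ) (s := Icc (0:ℝ) 1)
      ⟨0, by simp⟩ (((Φ.hdσ q.1).sub (Φ.hdσ q.2)).abs.continuousOn)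
    refine ⟨|Φ.dσ q.1 x - Φ.dσ q.2 x|, abs_pos.2 ?_, fun _ x hx => hmin hx⟩
    rcases Φ.hlt _ _ hq with h | h
    · have := h x; exact (sub_neg.2 this).ne
    · have := h x; exact (sub_pos.2 this).ne'
  choose κ' k1 k2 using h
  obtain ⟨i0, -, hm⟩ := Finset.exists_min_image Finset.univ κ' ⟨(Φ.j0, Φ.j0), Finset.mem_univ _⟩
  refine ⟨min (min κ 1) (κ' i0), lt_min (lt_min h0 one_pos) (k1 _), ?_, ?_, ?_⟩
  · exact (min_le_left _ _).trans (min_le_right _ _)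
  · exact fun i x hx => ((min_le_left _ _).trans (min_le_left _ _)).trans (h1 i x hx)
  · exact fun i l hil x hx => ((min_le_right _ _).trans (hm (i, l) (Finset.mem_univ _))).trans (k2 (i, l) hil x hx)

noncomputable def hh (L : ℝ) (z : ℝ × ℝ → ι → ℝ) : ℝ → ℝ := (Icc 0 L).indicator (fun τ => ‖z (τ, 1)‖)

lemma hh_nonneg (z : ℝ × ℝ → ι → ℝ) (t : ℝ) : 0 ≤ hh L z t := indicator_nonneg (fun _ _ => norm_nonneg _) t

lemma hh_eq (hS : 0 ≤ L - Φ.σ Φ.j0 1) (z : ℝ × ℝ → ι → ℝ) :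
    hh L z = (Icc 0 L).indicator (fun τ => ‖z (Φ.r L (τ, 1))‖) := by
  refine indicator_congr fun τ hτ => ?_
  rw [Φ.r_id (Φ.mem_Om_one.2 hτ)]

lemma hh_meas (hS : 0 ≤ L - Φ.σ Φ.j0 1) {z : ℝ × ℝ → ι → ℝ} (hz : ContinuousOn z (Φ.Om L)) :
    Measurable (hh L z) ∧ Integrable (hh L z) ∧ Integrable (fun t => hh L z t ^ 2) := by
  have hc : Continuous fun τ : ℝ => ‖z (Φ.r L (τ, 1))‖ :=
    ((comp_r_cont hS hz).comp (f := fun τ : ℝ => (τ, (1:ℝ))) (by fun_prop)).norm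
  rw [hh_eq hS z]
  refine ⟨hc.measurable.indicator measurableSet_Icc, ?_, ?_⟩
  · exact (integrable_indicator_iff measurableSet_Icc).2 hc.continuousOn.integrableOn_Icc
  · have : (fun t => (Icc 0 L).indicator (fun τ => ‖z (Φ.r L (τ, 1))‖) t ^ 2) =
      (Icc 0 L).indicator (fun τ => ‖z (Φ.r L (τ, 1))‖ ^ 2) := by
      funext t; by_cases ht : t ∈ Icc 0 L <;> simp [ht]
    rw [this]
    exact (integrable_indicator_iff measurableSet_Icc).2 (hc.pow 2).continuousOn.integrableOn_Icc

noncomputable def Win.Ry (z : ℝ × ℝ → ι → ℝ) (p : ℝ × ℝ) (i : ι) : ℝ :=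
  ∑ l, D.Θ i l (p.1 - Φ.σ i p.2) * z (Φ.r L (Φ.γ l (p.1 - Φ.σ i p.2) 1)) l

lemma Win.Ry_cont {z : ℝ × ℝ → ι → ℝ} (hz : ContinuousOn z (Φ.Om L)) : Continuous (D.Ry z) := by
  refine continuous_pi fun i => continuous_finsetSum _ fun l _ => ?_
  have h1 := Φ.σc i
  have h2 : Continuous fun p : ℝ × ℝ => p.1 - Φ.σ i p.2 := by fun_prop
  refine ((D.Θ_cont i l).comp h2).mul ?_
  have h3 := (comp_r_cont D.S_pos.le hz).comp ((Φ.γ_cont2 l).comp (h2.prodMk (continuous_const (y := (1:ℝ)))))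
  exact (continuous_apply l).comp h3

lemma Win.Ry_bd (z : ℝ × ℝ → ι → ℝ) {p : ℝ × ℝ} (hp : p ∈ Φ.Om L) (i : ι) :
    |D.Ry z p i| ≤ D.cΘ * ∑ l, hh L z (p.1 - Φ.σ i p.2 + Φ.σ l 1) := by
  rw [Finset.mul_sum]
  refine (Finset.abs_sum_le_sum_abs _ _).trans (Finset.sum_le_sum fun l _ => ?_)
  by_cases hΘ : D.Θ i l (p.1 - Φ.σ i p.2) = 0
  · rw [hΘ, zero_mul, abs_zero]; exact mul_nonneg D.cΘ_nonneg (hh_nonneg _ _)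
  have hm := D.Θ_ne hp hΘ
  rw [abs_mul, Φ.r_id hm]
  refine mul_le_mul (D.Θ_bd _ _ _) ?_ (abs_nonneg _) D.cΘ_nonneg
  have hm' : p.1 - Φ.σ i p.2 + Φ.σ l 1 ∈ Icc 0 L := Φ.mem_Om_one.1 hm
  rw [hh, indicator_of_mem hm']
  exact norm_le_pi_norm (z (p.1 - Φ.σ i p.2 + Φ.σ l 1, 1)) l

theorem Win.core [CompactSpace (Φ.Om L)] (e : Co ι) (hd : ∀ i, e i i = 0)
    (hker : ∀ z, D.A e z = 0 → D.W z = 0) :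
    ∃ c, 0 ≤ c ∧ ∀ z, Φ.Mild (fun i l => e i l) L z → ∀ x ∈ Icc (0:ℝ) 1, ∀ i,
      |z (0, x) i - D.Ry z (0, x) i| ≤ c * ∫ t, hh L z t := by
  obtain ⟨c, hc0, hc⟩ := ob_lemma (D.A e) _ _ (D.A_P e) (D.frk e hd) D.W hker
  obtain ⟨κ, hκ0, hκ1, hκa, hκb⟩ := Φ.κ_ex2
  set n : ℝ := ((Fintype.card ι : ℕ) : ℝ) with hn
  have hn0 : 0 ≤ n := Nat.cast_nonneg _
  have hΘ0 := D.cΘ_nonneg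
  set m1 := (2 + n * |D.cΓ|) * (‖e‖ * D.cΘ * (n * n * κ⁻¹)) with hm1
  set m2 := 1 + D.cΘ * (n * n) with hm2
  set m3 := ‖Bc Φ‖ * D.cΘ * (n * n) with hm3
  have hm10 : 0 ≤ m1 := by positivity
  have hm20 : 0 ≤ m2 := by positivity
  have hm30 : 0 ≤ m3 := by positivity
  refine ⟨c * (m1 + m2 + m3), by positivity, fun z hz x hx i => ?_⟩
  obtain ⟨hm, hi, -⟩ := hh_meas D.S_pos.le hz.cont
  have h0 := hh_nonneg (L := L) z
  set I := ∫ t, hh L z t with hI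
  have hI0 : 0 ≤ I := integral_nonneg h0
  set zC : C(Φ.Om L, ι → ℝ) := ⟨fun p => z p, continuousOn_iff_continuous_domRestrict.1 hz.cont⟩ with hzC
  set RC : C(Φ.Om L, ι → ℝ) := ⟨fun p => D.Ry z p, (D.Ry_cont hz.cont).comp continuous_subtype_val⟩ with hRC
  have hzc := hz.cont
  have hK : zC - RC = D.KL e zC := by
    rw [sub_eq_iff_eq_add', ]
    ext p i
    have h1 := D.rep (coC e) hz p.2 i
    refine h1.trans ?_
    refine congrArg₂ (· + ·) (Finset.sum_congr rfl fun l _ => ?_) rfl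
    by_cases hΘ : D.Θ i l (p.1.1 - Φ.σ i p.1.2) = 0
    · rw [hΘ, zero_mul, zero_mul]
    · rw [Φ.r_id (D.Θ_ne p.2 hΘ)]
  have hfst : (D.A e (zC - RC)).1 = D.KL e RC := by
    rw [D.A_fst, map_sub, ← hK]; abel
  have b1 : ‖D.KL e RC‖ ≤ m1 * I := by
    refine (ContinuousMap.norm_le _ (by positivity)).2 fun p => ?_
    rw [pi_norm_le_iff_of_nonneg (by positivity)]
    intro i
    rw [D.KL_apply, Real.norm_eq_abs]
    refine (D.K_bd _ (fun l => fE_cont (coC e) (D.ext_cont _) l) (‖e‖ * D.cΘ * (n * n * κ⁻¹) * I)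
      ?_ p.2 i).trans_eq (by rw [hm1]; ring)
    intro i s x y hxy hx hy
    have hS : ((Finset.univ.filter fun q : ι × ι => q.1 ≠ i).card : ℝ) ≤ n * n := by
      have : (Finset.univ.filter fun q : ι × ι => q.1 ≠ i).card ≤ Fintype.card ι * Fintype.card ι := by
        rw [← Fintype.card_prod]; exact Finset.card_le_univ _
      rw [hn]; exact_mod_cast this
    have h1 := hint (V := ℝ) hm h0 hi (Finset.univ.filter fun q : ι × ι => q.1 ≠ i)
      (ψ := fun q ξ => s + Φ.σ i ξ - Φ.σ q.1 ξ + Φ.σ q.2 1) (dψ := fun q ξ => Φ.dσ i ξ - Φ.dσ q.1 ξ)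
      (fun q ξ => (((Φ.hσ i ξ).const_add s).sub (Φ.hσ q.1 ξ)).add_const _)
      (fun q hq => by
        have hq' := (Finset.mem_filter.1 hq).2
        rcases Φ.hlt _ _ hq' with h | h
        · left; intro ξ; have := h ξ; linarith
        · right; intro ξ; have := h ξ; linarith) hκ0 hxy
      (fun q hq ξ hξ => hκb i q.1 (Finset.mem_filter.1 hq).2.symm ξ ⟨hx.1.trans hξ.1, hξ.2.trans hy.2.1⟩)
      (f := fun ξ => fE (fun i l => e i l) (D.ext RC) i (Φ.γ i s ξ)) (c := ‖e‖ * D.cΘ) (by positivity)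
      (fun ξ hξ => by
        have hmem := Φ.Om_path hx hy hξ.1 hξ.2
        have hex : ∀ l, D.ext RC (Φ.γ i s ξ) l = D.Ry z (Φ.γ i s ξ) l := fun l => by
          rw [show Φ.γ i s ξ = ((⟨Φ.γ i s ξ, hmem⟩ : Φ.Om L) : ℝ × ℝ) from rfl, D.ext_id]; rfl
        rw [Real.norm_eq_abs]
        unfold fE
        refine (Finset.abs_sum_le_sum_abs _ _).trans ?_
        calc ∑ l, |e i l (Φ.γ i s ξ) * D.ext RC (Φ.γ i s ξ) l|
            ≤ ∑ l, if l ≠ i then ‖e‖ * (D.cΘ * ∑ j, hh L z (s + Φ.σ i ξ - Φ.σ l ξ + Φ.σ j 1)) else 0 := by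
              refine Finset.sum_le_sum fun l _ => ?_
              by_cases hl : l = i
              · rw [if_neg (not_not.2 hl), hl, hd i]; simp
              · rw [if_pos hl, abs_mul, hex]
                exact mul_le_mul (Co_bd e i l _) (D.Ry_bd z hmem l) (abs_nonneg _) (norm_nonneg _)
          _ = _ := by
              rw [Finset.sum_filter, Fintype.sum_prod_type, Finset.mul_sum]
              refine Finset.sum_congr rfl fun l _ => ?_
              by_cases hl : l = i
              · simp [hl]
              · simp only [ne_eq, hl, not_false_eq_true, if_true]; ring)
    rw [Real.norm_eq_abs] at h1
    refine h1.trans ?_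
    calc _ ≤ ‖e‖ * D.cΘ * (n * n * (κ⁻¹ * I)) := by gcongr
      _ = _ := by ring
  have hpr : ∀ q ℓ, 0 ≤ q → q ≤ 1 → (∀ τ ∈ Icc 0 ℓ, (τ, q) ∈ Φ.Om L) → ∀ Q : (ι → ℝ) →L[ℝ] (ι → ℝ),
      ∀ θ ∈ Icc 0 ℓ, ‖∫ τ in (0:ℝ)..θ, Q (D.Ry z (τ, q))‖ ≤ ‖Q‖ * D.cΘ * (n * n) * I := by
    intro q ℓ _ _ hmem Q θ hθ
    have h1 := hint (V := ι → ℝ) hm h0 hi (Finset.univ : Finset (ι × ι))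
      (ψ := fun p τ => τ - Φ.σ p.1 q + Φ.σ p.2 1) (dψ := fun _ _ => 1)
      (fun p ξ => ((hasDerivAt_id ξ).sub_const _).add_const _)
      (fun p hp => Or.inl fun _ => one_pos) one_pos hθ.1 (fun p hp ξ hξ => by simp)
      (f := fun τ => Q (D.Ry z (τ, q))) (c := ‖Q‖ * D.cΘ) (by positivity)
      (fun τ hτ => by
        refine (Q.le_opNorm _).trans ?_
        rw [mul_assoc]
        refine mul_le_mul_of_nonneg_left ?_ (norm_nonneg _)
        have hnn : ∀ i, 0 ≤ ∑ l, hh L z (τ - Φ.σ i q + Φ.σ l 1) := fun i => Finset.sum_nonneg fun l _ => h0 _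
        rw [Fintype.sum_prod_type, pi_norm_le_iff_of_nonneg
          (mul_nonneg hΘ0 (Finset.sum_nonneg fun i _ => hnn i))]
        intro i
        refine (D.Ry_bd z (hmem τ ⟨hτ.1, hτ.2.trans hθ.2⟩) i).trans (mul_le_mul_of_nonneg_left ?_ hΘ0)
        exact Finset.single_le_sum (f := fun i => ∑ l, hh L z (τ - Φ.σ i q + Φ.σ l 1))
          (fun i _ => hnn i) (Finset.mem_univ i))
    refine h1.trans_eq ?_
    rw [Finset.card_univ, Fintype.card_prod, inv_one, one_mul, hn]
    push_cast; ring
  have hsplit : ∀ q ℓ, (∀ τ ∈ Icc 0 ℓ, (τ, q) ∈ Φ.Om L) → ∀ Q : (ι → ℝ) →L[ℝ] (ι → ℝ),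
      ∀ θ : Icc 0 ℓ, D.prim q ℓ Q (zC - RC) θ = (∫ τ in (0:ℝ)..θ, Q (z (Φ.r L (τ, q)))) -
        ∫ τ in (0:ℝ)..θ, Q (D.Ry z (τ, q)) := by
    intro q ℓ hmem Q θ
    have k1 : Continuous fun τ : ℝ => Q (z (Φ.r L (τ, q))) :=
      Q.continuous.comp ((comp_r_cont D.S_pos.le hzc).comp (f := fun τ : ℝ => (τ, q)) (by fun_prop))
    have k2 : Continuous fun τ : ℝ => Q (D.Ry z (τ, q)) :=
      Q.continuous.comp ((D.Ry_cont hzc).comp (f := fun τ : ℝ => (τ, q)) (by fun_prop))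
    rw [← intervalIntegral.integral_sub (k1.intervalIntegrable _ _) (k2.intervalIntegrable _ _),
      D.prim_apply]
    refine intervalIntegral.integral_congr fun τ hτ => ?_
    rw [uIcc_of_le θ.2.1] at hτ
    have hmm := hmem τ ⟨hτ.1, hτ.2.trans θ.2.2⟩
    simp only [← map_sub]
    congr 1
    rw [show ((τ, q) : ℝ × ℝ) = ((⟨(τ, q), hmm⟩ : Φ.Om L) : ℝ × ℝ) from rfl, D.ext_id, Φ.r_id hmm]
    rfl
  have b2 : ‖D.prim 1 L (ContinuousLinearMap.id ℝ _) (zC - RC)‖ ≤ m2 * I := by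
    refine (ContinuousMap.norm_le _ (by positivity)).2 fun θ => ?_
    have hmem : ∀ τ ∈ Icc 0 L, (τ, (1:ℝ)) ∈ Φ.Om L := fun τ hτ => Φ.mem_Om_one.2 hτ
    rw [hsplit 1 L hmem]
    refine (norm_sub_le _ _).trans ?_
    have k1 : ‖∫ τ in (0:ℝ)..θ, (ContinuousLinearMap.id ℝ (ι → ℝ)) (z (Φ.r L (τ, 1)))‖ ≤
        1 * (((Finset.univ : Finset Unit).card : ℝ) * ((1:ℝ)⁻¹ * I)) := by
      refine hint hm h0 hi (Finset.univ : Finset Unit) (ψ := fun _ τ => τ) (dψ := fun _ _ => 1)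
        (fun _ ξ => hasDerivAt_id ξ) (fun p hp => Or.inl fun _ => one_pos) one_pos θ.2.1
        (fun p hp ξ hξ => by simp) zero_le_one (fun τ hτ => ?_)
      have hτ' : τ ∈ Icc 0 L := ⟨hτ.1, hτ.2.trans θ.2.2⟩
      simp only [ContinuousLinearMap.coe_id', id_eq, Finset.univ_unique, Finset.sum_singleton, one_mul]
      rw [Φ.r_id (hmem τ hτ'), hh, indicator_of_mem hτ']
    have k2 := hpr 1 L zero_le_one le_rfl hmem (ContinuousLinearMap.id ℝ (ι → ℝ)) θ θ.2
    have k3 : ‖ContinuousLinearMap.id ℝ (ι → ℝ)‖ ≤ 1 := ContinuousLinearMap.norm_id_le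
    have k4 : ‖ContinuousLinearMap.id ℝ (ι → ℝ)‖ * D.cΘ * (n * n) * I ≤ 1 * D.cΘ * (n * n) * I := by gcongr
    have k5 : 1 * (((Finset.univ : Finset Unit).card : ℝ) * ((1:ℝ)⁻¹ * I)) = I := by simp
    have k6 : m2 * I = I + 1 * D.cΘ * (n * n) * I := by rw [hm2]; ring
    rw [k5] at k1
    linarith
  have b3 : ‖D.prim 0 (L - Φ.σ Φ.j0 1) (Bc Φ) (zC - RC)‖ ≤ m3 * I := by
    refine (ContinuousMap.norm_le _ (by positivity)).2 fun θ => ?_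
    have hmem : ∀ τ ∈ Icc 0 (L - Φ.σ Φ.j0 1), (τ, (0:ℝ)) ∈ Φ.Om L := fun τ hτ => Φ.mem_Om_zero.2 hτ
    rw [hsplit 0 _ hmem]
    have k1 : ∫ τ in (0:ℝ)..θ, Bc Φ (z (Φ.r L (τ, 0))) = 0 := by
      rw [intervalIntegral.integral_congr (g := fun _ => (0 : ι → ℝ))]
      · simp
      · intro τ hτ
        rw [uIcc_of_le θ.2.1] at hτ
        have hm := hmem τ ⟨hτ.1, hτ.2.trans θ.2.2⟩
        simp only [Φ.r_id hm]
        exact (Bc_zero _).2 (hz.b0 τ hm)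
    rw [k1, zero_sub, norm_neg]
    exact hpr 0 _ le_rfl zero_le_one hmem (Bc Φ) θ θ.2
  have hA : ‖D.A e (zC - RC)‖ ≤ (m1 + m2 + m3) * I := by
    have hsnd : (D.A e (zC - RC)).2 = (D.prim 1 L (ContinuousLinearMap.id ℝ _) (zC - RC),
      D.prim 0 (L - Φ.σ Φ.j0 1) (Bc Φ) (zC - RC)) := D.A_snd e _
    have p1 : 0 ≤ m1 * I := by positivity
    have p2 : 0 ≤ m2 * I := by positivity
    have p3 : 0 ≤ m3 * I := by positivity
    rw [Prod.norm_def, hfst, hsnd, Prod.norm_def]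
    refine max_le ?_ (max_le ?_ ?_)
    · linarith
    · simp only; linarith
    · simp only; linarith
  have hW := (hc (zC - RC)).trans (mul_le_mul_of_nonneg_left hA hc0)
  have h5 : |z (0, x) i - D.Ry z (0, x) i| ≤ ‖D.W (zC - RC)‖ := by
    have := (D.W (zC - RC)).norm_coe_le_norm ⟨x, hx⟩
    refine le_trans ?_ this
    exact norm_le_pi_norm (D.W (zC - RC) ⟨x, hx⟩) i
  rw [mul_assoc]
  exact h5.trans hW

end K
end Fr
end Obs

open Set
namespace Obs
open Filter Topology MeasureTheory
open scoped BoundedContinuousFunction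

namespace Fr
section K
set_option linter.unusedSectionVars false
variable {ι : Type} [Fintype ι] [DecidableEq ι] {Φ : Fr ι} {L : ℝ} (D : Φ.Win L)

lemma Win.hker [CompactSpace (Φ.Om L)] (E : Co ι)
    (hu : ∀ w, Φ.Sol (fun i l => E i l) L w → ∀ x ∈ Icc (0:ℝ) 1, w (0, x) = 0)
    (z : C(Φ.Om L, ι → ℝ)) (hz : D.A (gE Φ E) z = 0) : D.W z = 0 := by
  have h1 := (D.A_ker (gE Φ E) z).1 hz
  have h2 := h1.toMild.gauge2 D.S_pos.le
  have h3 := hu _ ⟨h2, fun t ht => by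
    funext i
    simp only [h1.b1 t ht, Pi.zero_apply, mul_zero]⟩
  ext x i
  have h4 := congrFun (h3 x x.2) i
  have hm := Φ.mem_Om_init D.S_pos.le x.2.1 x.2.2
  have h5 := D.ext_id z ⟨(0, x), hm⟩
  simp only [Pi.zero_apply, mul_eq_zero, (gφ_pos 1 E i (0, (x:ℝ))).ne', false_or] at h4
  rw [h5] at h4
  exact h4

theorem Win.final (D : Φ.Win L) (E : Co ι)
    (hu : ∀ w, Φ.Sol (fun i l => E i l) L w → ∀ x ∈ Icc (0:ℝ) 1, w (0, x) = 0) :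
    ∃ c, 0 ≤ c ∧ ∀ w, Φ.Mild (fun i l => E i l) L w →
      ∫ x in (0:ℝ)..1, ∑ i, w (0, x) i ^ 2 ≤ c * ∫ t in (0:ℝ)..L, ∑ i, w (t, 1) i ^ 2 := by
  have := D.compact
  obtain ⟨c, hc0, hc⟩ := D.core (gE Φ E) (gE_diag E) (D.hker E hu)
  obtain ⟨κ, hκ0, -, hκa, -⟩ := Φ.κ_ex2
  set n : ℝ := ((Fintype.card ι : ℕ) : ℝ) with hn
  have hn0 : 0 ≤ n := Nat.cast_nonneg _
  have hL : 0 < L := by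
    have h1 := D.S_pos
    have h2 : Φ.σ Φ.j0 0 ≤ Φ.σ Φ.j0 1 := Φ.σ_mono Φ.hj0 zero_le_one
    rw [Φ.σ0] at h2
    linarith
  obtain ⟨G, hG0, hG⟩ : ∃ G, 0 ≤ G ∧ ∀ c, (c = 1 ∨ c = -1) → ∀ i p, |gφ Φ c E i p| ≤ G := by
    refine ⟨∑ i, (‖gφ Φ 1 E i‖ + ‖gφ Φ (-1) E i‖), by positivity, fun c hc i p => ?_⟩
    have h1 := (gφ Φ c E i).norm_coe_le_norm p
    refine h1.trans (le_trans ?_ (Finset.single_le_sum (f := fun i => ‖gφ Φ 1 E i‖ + ‖gφ Φ (-1) E i‖)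
      (fun i _ => by positivity) (Finset.mem_univ i)))
    rcases hc with rfl | rfl
    · exact le_add_of_nonneg_right (norm_nonneg _)
    · exact le_add_of_nonneg_left (norm_nonneg _)
  refine ⟨(2 * G ^ 2 * (D.cΘ ^ 2 * n * (n * n * κ⁻¹)) + n * (2 * G ^ 2 * c ^ 2 * L)) * G ^ 2,
    by positivity, fun w hw => ?_⟩
  set z : ℝ × ℝ → ι → ℝ := fun p i => gφ Φ (-1) E i p * w p i with hzdef
  have hz : Φ.Mild (fun i l => gE Φ E i l) L z := hw.gauge1 D.S_pos.le
  obtain ⟨hm, hi, hi2⟩ := hh_meas D.S_pos.le hz.cont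
  have h0 := hh_nonneg (L := L) z
  have hcore := hc z hz
  have hwz : ∀ p i, w p i = gφ Φ 1 E i p * z p i := fun p i => by
    rw [hzdef]; linear_combination (-w p i) * gφ_mul (Φ := Φ) E i p
  set J := ∫ t, hh L z t ^ 2 with hJ
  set I := ∫ t, hh L z t with hI
  have hfc : Continuous fun τ : ℝ => ‖z (Φ.r L (τ, 1))‖ :=
    ((comp_r_cont D.S_pos.le hz.cont).comp (f := fun τ : ℝ => (τ, (1:ℝ))) (by fun_prop)).norm
  have hI' : I = ∫ τ in (0:ℝ)..L, ‖z (Φ.r L (τ, 1))‖ := by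
    rw [hI, hh_eq D.S_pos.le z, integral_indicator measurableSet_Icc, integral_Icc_eq_integral_Ioc,
      intervalIntegral.integral_of_le hL.le]
  have hJ' : J = ∫ τ in (0:ℝ)..L, ‖z (Φ.r L (τ, 1))‖ ^ 2 := by
    have : (fun t => hh L z t ^ 2) = (Icc 0 L).indicator (fun τ => ‖z (Φ.r L (τ, 1))‖ ^ 2) := by
      rw [hh_eq D.S_pos.le z]
      funext t; by_cases ht : t ∈ Icc 0 L <;> simp [ht]
    rw [hJ, this, integral_indicator measurableSet_Icc, integral_Icc_eq_integral_Ioc,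
      intervalIntegral.integral_of_le hL.le]
  have hCS : I ^ 2 ≤ L * J := by
    have h1 : 0 ≤ ∫ τ in (0:ℝ)..L, (L * ‖z (Φ.r L (τ, 1))‖ - I) ^ 2 :=
      intervalIntegral.integral_nonneg hL.le fun _ _ => sq_nonneg _
    have h2 : ∫ τ in (0:ℝ)..L, (L * ‖z (Φ.r L (τ, 1))‖ - I) ^ 2 = L ^ 2 * J - 2 * L * I * I + L * I ^ 2 := by
      have : ∀ τ : ℝ, (L * ‖z (Φ.r L (τ, 1))‖ - I) ^ 2 =
        L ^ 2 * ‖z (Φ.r L (τ, 1))‖ ^ 2 - 2 * L * I * ‖z (Φ.r L (τ, 1))‖ + I ^ 2 := fun τ => by ring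
      simp only [this]
      rw [intervalIntegral.integral_add (Continuous.intervalIntegrable (by fun_prop) _ _)
        (Continuous.intervalIntegrable (by fun_prop) _ _),
        intervalIntegral.integral_sub (Continuous.intervalIntegrable (by fun_prop) _ _)
        (Continuous.intervalIntegrable (by fun_prop) _ _), intervalIntegral.integral_const_mul,
        intervalIntegral.integral_const_mul, ← hI', ← hJ', intervalIntegral.integral_const]
      simp
    rw [h2] at h1
    have h3 : 0 ≤ L * (L * J - I ^ 2) := by linarith
    have := nonneg_of_mul_nonneg_right h3 hL
    linarith
  have hJw : J ≤ G ^ 2 * ∫ t in (0:ℝ)..L, ∑ i, w (t, 1) i ^ 2 := by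
    rw [hJ', ← intervalIntegral.integral_const_mul]
    have hwc : ContinuousOn (fun t : ℝ => ∑ i, w (t, 1) i ^ 2) (Icc 0 L) := by
      refine continuousOn_finsetSum _ fun i _ => ContinuousOn.pow ?_ 2
      have := hw.cont.comp (f := fun t : ℝ => (t, (1:ℝ))) (s := Icc 0 L) (by fun_prop)
        (fun t ht => Φ.mem_Om_one.2 ht)
      exact (continuous_apply i).comp_continuousOn this
    refine intervalIntegral.integral_mono_on hL.le (hfc.pow 2 |>.intervalIntegrable _ _)
      ((hwc.intervalIntegrable_of_Icc hL.le).const_mul _) fun t ht => ?_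
    rw [Φ.r_id (Φ.mem_Om_one.2 ht)]
    have h1 : ‖z (t, 1)‖ ≤ Real.sqrt (G ^ 2 * ∑ i, w (t, 1) i ^ 2) := by
      refine (pi_norm_le_iff_of_nonneg (Real.sqrt_nonneg _)).2 fun i => ?_
      refine Real.le_sqrt_of_sq_le ?_
      rw [Real.norm_eq_abs, sq_abs, hzdef]
      simp only
      rw [mul_pow]
      refine mul_le_mul ?_ (Finset.single_le_sum (f := fun i => w (t, 1) i ^ 2)
        (fun i _ => sq_nonneg _) (Finset.mem_univ i)) (sq_nonneg _) (sq_nonneg _)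
      rw [← sq_abs]
      exact pow_le_pow_left₀ (abs_nonneg _) (hG _ (Or.inr rfl) _ _) 2
    calc _ ≤ Real.sqrt (G ^ 2 * ∑ i, w (t, 1) i ^ 2) ^ 2 := pow_le_pow_left₀ (norm_nonneg _) h1 2
      _ = _ := Real.sq_sqrt (mul_nonneg (sq_nonneg _) (Finset.sum_nonneg fun _ _ => sq_nonneg _))
  have hJ0 : 0 ≤ J := integral_nonneg fun t => sq_nonneg _
  have hRc : Continuous fun x : ℝ => ∑ i, D.Ry z (0, x) i ^ 2 := by
    refine continuous_finsetSum _ fun i _ => Continuous.pow ?_ 2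
    exact (continuous_apply i).comp ((D.Ry_cont hz.cont).comp (f := fun x : ℝ => ((0:ℝ), x)) (by fun_prop))
  have hmem : ∀ x ∈ Icc (0:ℝ) 1, ((0:ℝ), x) ∈ Φ.Om L := fun x hx => Φ.mem_Om_init D.S_pos.le hx.1 hx.2
  have hR : ∫ x in (0:ℝ)..1, ∑ i, D.Ry z (0, x) i ^ 2 ≤ D.cΘ ^ 2 * n * (n * n * κ⁻¹) * J := by
    have h1 := hint (V := ℝ) (hm.pow_const 2) (fun t => sq_nonneg _) hi2 (Finset.univ : Finset (ι × ι))
      (ψ := fun q x => 0 - Φ.σ q.1 x + Φ.σ q.2 1) (dψ := fun q x => 0 - Φ.dσ q.1 x)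
      (fun q x => ((hasDerivAt_const x (0:ℝ)).sub (Φ.hσ q.1 x)).add_const _)
      (fun q hq => by
        by_cases h : Φ.mi q.1
        · right; intro ξ; have := Φ.hmi _ h ξ; linarith
        · left; intro ξ; have := Φ.hpl _ h ξ; linarith) hκ0 zero_le_one
      (fun q hq x hx => by rw [zero_sub, abs_neg]; exact hκa _ x hx)
      (f := fun x => ∑ i, D.Ry z (0, x) i ^ 2) (c := D.cΘ ^ 2 * n) (by positivity)
      (fun x hx => by
        rw [Real.norm_eq_abs, abs_of_nonneg (Finset.sum_nonneg fun _ _ => sq_nonneg _),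
          Fintype.sum_prod_type, Finset.mul_sum]
        refine Finset.sum_le_sum fun i _ => ?_
        have h2 := D.Ry_bd z (hmem x hx) i
        have h3 := pow_le_pow_left₀ (abs_nonneg _) h2 2
        rw [sq_abs, mul_pow] at h3
        refine h3.trans ?_
        rw [mul_assoc]
        refine mul_le_mul_of_nonneg_left ?_ (sq_nonneg _)
        have h4 := sq_sum_le_card_mul_sum_sq (s := (Finset.univ : Finset ι))
          (f := fun l => hh L z (0 - Φ.σ i x + Φ.σ l 1))
        rw [Finset.card_univ] at h4
        exact h4)
    refine (le_abs_self _).trans (h1.trans_eq ?_)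
    rw [Finset.card_univ, Fintype.card_prod, hn]
    push_cast; ring
  have hwc0 : ContinuousOn (fun x : ℝ => ∑ i, w (0, x) i ^ 2) (Icc 0 1) := by
    refine continuousOn_finsetSum _ fun i _ => ContinuousOn.pow ?_ 2
    have := hw.cont.comp (f := fun x : ℝ => ((0:ℝ), x)) (s := Icc 0 1) (by fun_prop) hmem
    exact (continuous_apply i).comp_continuousOn this
  have hmain : ∫ x in (0:ℝ)..1, ∑ i, w (0, x) i ^ 2 ≤
      ∫ x in (0:ℝ)..1, (2 * G ^ 2 * ∑ i, D.Ry z (0, x) i ^ 2 + n * (2 * G ^ 2 * (c * I) ^ 2)) := by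
    refine intervalIntegral.integral_mono_on zero_le_one (hwc0.intervalIntegrable_of_Icc zero_le_one)
      (Continuous.intervalIntegrable (by fun_prop) _ _) fun x hx => ?_
    have : n * (2 * G ^ 2 * (c * I) ^ 2) = ∑ i : ι, 2 * G ^ 2 * (c * I) ^ 2 := by
      rw [Finset.sum_const, Finset.card_univ, nsmul_eq_mul]
    rw [this, Finset.mul_sum, ← Finset.sum_add_distrib]
    refine Finset.sum_le_sum fun i _ => ?_
    have h1 := hcore x hx i
    have h2 : (z (0, x) i - D.Ry z (0, x) i) ^ 2 ≤ (c * I) ^ 2 := by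
      rw [← sq_abs]; exact pow_le_pow_left₀ (abs_nonneg _) h1 2
    have h3 : z (0, x) i ^ 2 ≤ 2 * D.Ry z (0, x) i ^ 2 + 2 * (c * I) ^ 2 := by
      nlinarith [sq_nonneg (z (0, x) i - 2 * D.Ry z (0, x) i)]
    have h4 : gφ Φ 1 E i (0, x) ^ 2 ≤ G ^ 2 := by
      rw [← sq_abs]; exact pow_le_pow_left₀ (abs_nonneg _) (hG _ (Or.inl rfl) _ _) 2
    rw [hwz, mul_pow]
    calc _ ≤ G ^ 2 * (2 * D.Ry z (0, x) i ^ 2 + 2 * (c * I) ^ 2) :=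
          mul_le_mul h4 h3 (sq_nonneg _) (sq_nonneg _)
      _ = _ := by ring
  refine hmain.trans ?_
  rw [intervalIntegral.integral_add (Continuous.intervalIntegrable (by fun_prop) _ _)
    (Continuous.intervalIntegrable (by fun_prop) _ _), intervalIntegral.integral_const_mul,
    intervalIntegral.integral_const, sub_zero, one_smul]
  calc _ ≤ 2 * G ^ 2 * (D.cΘ ^ 2 * n * (n * n * κ⁻¹) * J) + n * (2 * G ^ 2 * c ^ 2 * (L * J)) := by
        refine add_le_add (mul_le_mul_of_nonneg_left hR (by positivity)) ?_
        refine mul_le_mul_of_nonneg_left ?_ hn0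
        rw [mul_pow, ← mul_assoc]
        exact mul_le_mul_of_nonneg_left hCS (by positivity)
    _ = (2 * G ^ 2 * (D.cΘ ^ 2 * n * (n * n * κ⁻¹)) + n * (2 * G ^ 2 * c ^ 2 * L)) * J := by ring
    _ ≤ _ := by
        refine (mul_le_mul_of_nonneg_left hJw (by positivity)).trans_eq ?_
        ring

end K
end Fr
end Obs

open Set
namespace Obs
open Filter Topology MeasureTheory
open scoped BoundedContinuousFunction

namespace Fr
section K
set_option linter.unusedSectionVars false
variable {ι : Type} [Fintype ι] [DecidableEq ι] {Φ : Fr ι} {L : ℝ} (D : Φ.Win L)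

lemma left_inv (Φ : Fr ι) (V : ι → Prop)
    (h : ∀ u : ι → ℝ, (∀ i, ¬ Φ.mi i → u i = ∑ j, Φ.Bm i j * u j) → (∀ l, V l → u l = 0) → u = 0) :
    ∃ M : ι → ι → ℝ, (∀ i l, ¬ V l → M i l = 0) ∧ ∀ u : ι → ℝ,
      (∀ i, ¬ Φ.mi i → u i = ∑ j, Φ.Bm i j * u j) → ∀ i, ∑ l, M i l * u l = u i := by
  classical
  let N0 : Submodule ℝ (ι → ℝ) := LinearMap.ker (Bc Φ).toLinearMap
  let f : N0 →ₗ[ℝ] (ι → ℝ) := LinearMap.pi fun l => if V l then (LinearMap.proj l).comp N0.subtype else 0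
  have hf : ∀ u l, f u l = if V l then u.1 l else 0 := by
    intro u l
    by_cases hV : V l <;> simp [f, hV]
  obtain ⟨g, hg⟩ := LinearMap.exists_leftInverse_of_injective f (by
    rw [LinearMap.ker_eq_bot']
    intro u hu
    refine Subtype.ext (h u.1 ((Bc_zero _).1 u.2) fun l hl => ?_)
    have := congrFun hu l
    rwa [hf, if_pos hl] at this)
  refine ⟨fun i l => if V l then (g (Pi.single l 1)).1 i else 0, fun i l hl => by simp [hl], ?_⟩
  intro u hu i
  have h1 := LinearMap.congr_fun hg ⟨u, (Bc_zero _).2 hu⟩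
  rw [LinearMap.comp_apply, LinearMap.id_apply] at h1
  have h2 : f ⟨u, (Bc_zero _).2 hu⟩ = ∑ l, (if V l then u l else 0) • Pi.single (M := fun _ => ℝ) l (1:ℝ) := by
    rw [← pi_eq_sum_univ' ]
    funext l; rw [hf]
  rw [h2, map_sum] at h1
  have h3 := congrFun (congrArg Subtype.val h1) i
  simp only [map_smul, AddSubmonoidClass.coe_finsetSum, Finset.sum_apply, Submodule.coe_smul,
    Pi.smul_apply, smul_eq_mul] at h3
  rw [← h3]
  refine Finset.sum_congr rfl fun l _ => ?_
  by_cases hV : V l <;> simp [hV, mul_comm]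

theorem win_ex (hS : 0 < L - Φ.σ Φ.j0 1) (hc1 : ∀ i, Φ.mi i → Φ.σ i 1 < L)
    (hc2 : ∀ i, ¬ Φ.mi i → -Φ.σ i 1 < L - Φ.σ Φ.j0 1)
    (hloc : ∀ s ∈ Icc 0 (L - Φ.σ Φ.j0 1), ∀ u : ι → ℝ, (∀ i, ¬ Φ.mi i → u i = ∑ j, Φ.Bm i j * u j) →
      (∀ l, Φ.mi l → ((∀ x, Φ.dσ l x ≤ Φ.dσ Φ.j0 x) ∨ s < L - Φ.σ l 1) → u l = 0) →
      (∀ l, ¬ Φ.mi l → -Φ.σ l 1 < s → u l = 0) → u = 0) : Nonempty (Φ.Win L) := by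
  classical
  set S := L - Φ.σ Φ.j0 1 with hSd
  have hj : ∀ l, (∀ x, Φ.dσ l x ≤ Φ.dσ Φ.j0 x) → Φ.σ l 1 ≤ Φ.σ Φ.j0 1 := fun l hl => by
    have := Φ.sub_mono hl (zero_le_one (α := ℝ))
    simp only [Φ.σ0] at this; linarith
  obtain ⟨g, hg⟩ := exists_continuous_forall_mem_convex_of_local_const (X := Icc 0 S) (E := ι → ι → ℝ)
    (t := fun s => {M | (∀ i l, ¬ (0 ≤ (s:ℝ) + Φ.σ l 1 ∧ (s:ℝ) + Φ.σ l 1 ≤ L) → M i l = 0) ∧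
      ∀ u : ι → ℝ, (∀ i, ¬ Φ.mi i → u i = ∑ j, Φ.Bm i j * u j) → ∀ i, ∑ l, M i l * u l = u i})
    (by
      intro s M hM N hN a b ha hb hab
      refine ⟨fun i l hl => by simp [hM.1 i l hl, hN.1 i l hl], fun u hu i => ?_⟩
      have e1 := hM.2 u hu i
      have e2 := hN.2 u hu i
      have : ∑ l, (a • M + b • N) i l * u l = a * ∑ l, M i l * u l + b * ∑ l, N i l * u l := by
        rw [Finset.mul_sum, Finset.mul_sum, ← Finset.sum_add_distrib]
        refine Finset.sum_congr rfl fun l _ => ?_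
        simp only [Pi.add_apply, Pi.smul_apply, smul_eq_mul]; ring
      rw [this, e1, e2, ← add_mul, hab, one_mul])
    (by
      intro s
      obtain ⟨M, hM1, hM2⟩ := left_inv Φ
        (fun l => (Φ.mi l ∧ ((∀ x, Φ.dσ l x ≤ Φ.dσ Φ.j0 x) ∨ (s:ℝ) < L - Φ.σ l 1)) ∨
          (¬ Φ.mi l ∧ -Φ.σ l 1 < (s:ℝ))) (fun u hu hV => hloc s s.2 u hu
            (fun l h1 h2 => hV l (Or.inl ⟨h1, h2⟩)) (fun l h1 h2 => hV l (Or.inr ⟨h1, h2⟩)))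
      refine ⟨M, ?_⟩
      have : ∀ l, ∀ᶠ y : Icc 0 S in 𝓝 s, ∀ i, ¬ (0 ≤ (y:ℝ) + Φ.σ l 1 ∧ (y:ℝ) + Φ.σ l 1 ≤ L) → M i l = 0 := by
        intro l
        by_cases hV : (Φ.mi l ∧ ((∀ x, Φ.dσ l x ≤ Φ.dσ Φ.j0 x) ∨ (s:ℝ) < L - Φ.σ l 1)) ∨
          (¬ Φ.mi l ∧ -Φ.σ l 1 < (s:ℝ))
        · have : ∀ᶠ y : Icc 0 S in 𝓝 s, 0 ≤ (y:ℝ) + Φ.σ l 1 ∧ (y:ℝ) + Φ.σ l 1 ≤ L := by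
            rcases hV with ⟨h1, h2⟩ | ⟨h1, h2⟩
            · have h3 := Φ.σ_mono h1 (zero_le_one (α := ℝ))
              rw [Φ.σ0] at h3
              rcases h2 with h2 | h2
              · have h4 := hj l h2
                exact Eventually.of_forall fun y => ⟨by linarith [y.2.1], by linarith [y.2.2]⟩
              · filter_upwards [continuous_subtype_val.continuousAt.eventually_lt continuousAt_const h2] with y hy
                exact ⟨by linarith [y.2.1], by linarith⟩
            · have h3 := Φ.σ_anti h1 (zero_le_one (α := ℝ))
              rw [Φ.σ0] at h3
              have h5 := Φ.σ_mono Φ.hj0 (zero_le_one (α := ℝ))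
              rw [Φ.σ0] at h5
              filter_upwards [continuousAt_const.eventually_lt continuous_subtype_val.continuousAt h2] with y hy
              exact ⟨by linarith, by linarith [y.2.2]⟩
          filter_upwards [this] with y hy i hn
          exact absurd hy hn
        · exact Eventually.of_forall fun y i _ => hM1 i l hV
      filter_upwards [eventually_all.2 this] with y hy
      exact ⟨fun i l => hy l i, hM2⟩)
  have hc : Continuous fun s : ℝ => g (projIcc 0 S hS.le s) := g.continuous.comp continuous_projIcc
  have hpr : ∀ s, (s, (0:ℝ)) ∈ Φ.Om L → ((projIcc 0 S hS.le s : Icc 0 S) : ℝ) = s := fun s hs => by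
    rw [projIcc_of_mem hS.le (Φ.mem_Om_zero.1 hs)]
  let α : ι → ℝ → ℝ := fun i s => if Φ.mi i then
    (if ∀ x, Φ.dσ i x ≤ Φ.dσ Φ.j0 x then 1 else cl ((L - Φ.σ i 1 - s) / (L - Φ.σ i 1)))
    else cl ((s + Φ.σ i 1) / (S + Φ.σ i 1))
  have hcl0 : ∀ a b, 0 < b → cl (a / b) ≠ 0 → 0 < a := by
    intro a b hb h
    by_contra hh
    apply h
    have : a / b ≤ 0 := div_nonpos_of_nonpos_of_nonneg (not_lt.1 hh) hb.le
    rw [cl, min_eq_right (by linarith), max_eq_left this]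
  have hcl1 : ∀ a b, 0 < b → cl (a / b) ≠ 1 → a < b := by
    intro a b hb h
    by_contra hh
    apply h
    have : 1 ≤ a / b := (one_le_div hb).2 (not_lt.1 hh)
    rw [cl, min_eq_left this, max_eq_right zero_le_one]
  refine ⟨⟨hS, α, fun i l s => g (projIcc 0 S hS.le s) i l, fun i => ?_, fun i l => ?_, fun i s => ?_,
    fun i s => ?_, ‖g‖, fun i l s => ?_, ?_, ?_, ?_, ?_⟩⟩
  · have := cl_cont
    by_cases h1 : Φ.mi i
    · by_cases h2 : ∀ x, Φ.dσ i x ≤ Φ.dσ Φ.j0 x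
      · simp only [α, if_pos h1, if_pos h2]; fun_prop
      · simp only [α, if_pos h1, if_neg h2]; fun_prop
    · simp only [α, if_neg h1]; fun_prop
  · exact (continuous_apply l).comp ((continuous_apply i).comp hc)
  · simp only [α]; split_ifs <;> first | exact zero_le_one | exact cl_nonneg _
  · simp only [α]; split_ifs <;> first | exact le_rfl | exact cl_le _
  · exact ((norm_le_pi_norm (g (projIcc 0 S hS.le s) i) l).trans (norm_le_pi_norm _ i)).trans
      (g.norm_coe_le_norm _)
  · intro i p hp ha
    have hp1 := Φ.Om_fst_le hp
    obtain ⟨a1, a2, a3, a4⟩ := hp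
    refine Φ.mem_Om_one.2 ?_
    by_cases h1 : Φ.mi i
    · have h3 := Φ.σ_mono h1 a2
      by_cases h2 : ∀ x, Φ.dσ i x ≤ Φ.dσ Φ.j0 x
      · have h4 := Φ.sub_mono h2 a2
        simp only at h4
        exact ⟨by linarith, by linarith⟩
      · simp only [α, if_pos h1, if_neg h2] at ha
        have := hcl0 _ _ (by linarith [hc1 i h1]) ha
        exact ⟨by linarith, by linarith⟩
    · have h3 := Φ.σ_anti h1 a2
      simp only [α, if_neg h1] at ha
      have := hcl0 _ _ (by linarith [hc2 i h1]) ha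
      exact ⟨by linarith, by linarith⟩
  · intro i p hp ha
    obtain ⟨a1, a2, a3, a4⟩ := hp
    refine Φ.mem_Om_zero.2 ?_
    by_cases h1 : Φ.mi i
    · by_cases h2 : ∀ x, Φ.dσ i x ≤ Φ.dσ Φ.j0 x
      · simp only [α, if_pos h1, if_pos h2] at ha; exact absurd rfl ha
      · simp only [α, if_pos h1, if_neg h2] at ha
        have := hcl1 _ _ (by linarith [hc1 i h1]) ha
        have h4 := Φ.sub_mono ((Φ.cmp i Φ.j0).resolve_left h2) a1
        simp only [Φ.σ0] at h4
        exact ⟨by linarith, by linarith⟩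
    · have h3 := Φ.σ_anti h1 a1
      rw [Φ.σ0] at h3
      simp only [α, if_neg h1] at ha
      have := hcl1 _ _ (by linarith [hc2 i h1]) ha
      exact ⟨by linarith, by linarith⟩
  · intro i l s hs hn
    refine Φ.mem_Om_one.2 ?_
    by_contra h
    refine hn ((hg (projIcc 0 S hS.le s)).1 i l ?_)
    rwa [hpr s hs]
  · intro s hs
    exact (hg (projIcc 0 S hS.le s)).2

end K
end Fr
end Obs

open Set
namespace Obs
open Filter Topology MeasureTheory
open scoped BoundedContinuousFunction

structure Dat (k m : ℕ) where
  hm : 1 ≤ m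
  hkm : m ≤ k
  μ : Fin (k + m) → ℝ → ℝ
  μc : ∀ i, Continuous (μ i)
  μ0 : ∀ i x, 0 < μ i x
  hinc : ∀ i j : Fin (k + m), i.1 < j.1 → j.1 < k → ∀ x, μ i x < μ j x
  hdec : ∀ i j : Fin (k + m), k ≤ i.1 → i.1 < j.1 → ∀ x, μ j x < μ i x
  B : Matrix (Fin k) (Fin m) ℝ

namespace Dat
variable {k m : ℕ} (d : Dat k m)

noncomputable def ε (i : Fin (k + m)) : ℝ := if i.1 < k then 1 else -1

lemma εp {i : Fin (k + m)} (h : i.1 < k) : ε i = 1 := if_pos h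
lemma εn {i : Fin (k + m)} (h : ¬ i.1 < k) : ε i = -1 := if_neg h

noncomputable def fr : Fr (Fin (k + m)) where
  σ i x := ε i * ∫ ξ in (0:ℝ)..x, d.μ i ξ
  dσ i x := ε i * d.μ i x
  hσ i x := ((d.μc i).integral_hasStrictDerivAt 0 x).hasDerivAt.const_mul _
  hdσ i := continuous_const.mul (d.μc i)
  σ0 i := by simp
  hlt i l hil := by
    have hne : i.1 ≠ l.1 := fun h => hil (Fin.ext h)
    by_cases hi : i.1 < k <;> by_cases hl : l.1 < k
    · rw [εp hi, εp hl]
      rcases lt_or_gt_of_ne hne with h | h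
      · left; intro x; linarith [d.hinc i l h hl x]
      · right; intro x; linarith [d.hinc l i h hi x]
    · rw [εp hi, εn hl]; right; intro x; linarith [d.μ0 i x, d.μ0 l x]
    · rw [εn hi, εp hl]; left; intro x; linarith [d.μ0 i x, d.μ0 l x]
    · rw [εn hi, εn hl]
      rcases lt_or_gt_of_ne hne with h | h
      · left; intro x; linarith [d.hdec i l (not_lt.1 hi) h x]
      · right; intro x; linarith [d.hdec l i (not_lt.1 hl) h x]
  mi i := i.1 < k
  hmi i hi x := by rw [εp hi, one_mul]; exact d.μ0 i x
  hpl i hi x := by rw [εn hi]; linarith [d.μ0 i x]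
  j0 := ⟨k - m, by have := d.hm; omega⟩
  hj0 := by have := d.hm; have := d.hkm; simp only; omega
  imax := ⟨k - 1, by have := d.hm; have := d.hkm; omega⟩
  himax i x := by
    have h1 := d.hm
    have h2 := d.hkm
    have h3 : k - 1 < k := by omega
    by_cases hi : i.1 < k
    · rw [εp hi, εp (by exact h3)]
      rcases lt_or_eq_of_le (show i.1 ≤ k - 1 by omega) with h | h
      · linarith [d.hinc i ⟨k - 1, by omega⟩ h h3 x]
      · have : i = ⟨k - 1, by omega⟩ := Fin.ext h
        rw [this]
    · rw [εn hi, εp (by exact h3)]; linarith [d.μ0 i x, d.μ0 ⟨k - 1, by omega⟩ x]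
  imin := ⟨k, by have := d.hm; omega⟩
  himin i x := by
    have h1 := d.hm
    have h3 : ¬ k < k := by omega
    by_cases hi : i.1 < k
    · rw [εp hi, εn (by exact h3)]; linarith [d.μ0 i x, d.μ0 ⟨k, by omega⟩ x]
    · rw [εn hi, εn (by exact h3)]
      rcases lt_or_eq_of_le (not_lt.1 hi) with h | h
      · linarith [d.hdec ⟨k, by omega⟩ i le_rfl h x]
      · have : i = ⟨k, by omega⟩ := Fin.ext h.symm
        rw [this]
  hneg := by simp
  Bm i j := if h : k ≤ i.1 ∧ j.1 < k then -d.B ⟨j.1, h.2⟩ ⟨i.1 - k, by omega⟩ else 0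
  hBm i j h := by
    by_contra hh
    exact h (dif_neg fun h' => hh h'.2)

lemma Bm_eq (i j : Fin (k + m)) (hi : k ≤ i.1) (hj : j.1 < k) :
    d.fr.Bm i j = -d.B ⟨j.1, hj⟩ ⟨i.1 - k, by omega⟩ := dif_pos ⟨hi, hj⟩

lemma Bm_zero (i j : Fin (k + m)) (hj : ¬ j.1 < k) : d.fr.Bm i j = 0 := dif_neg fun h => hj h.2

noncomputable def τ (i : Fin (k + m)) : ℝ := ∫ ξ in (0:ℝ)..1, d.μ i ξ

lemma σp {i : Fin (k + m)} (h : i.1 < k) : d.fr.σ i 1 = d.τ i := by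
  change ε i * _ = _
  rw [εp h, one_mul]; rfl
lemma σn {i : Fin (k + m)} (h : ¬ i.1 < k) : d.fr.σ i 1 = -d.τ i := by
  change ε i * _ = _
  rw [εn h, neg_one_mul]; rfl

lemma τ_pos (i : Fin (k + m)) : 0 < d.τ i :=
  intervalIntegral.intervalIntegral_pos_of_pos ((d.μc i).intervalIntegrable _ _) (d.μ0 i) zero_lt_one

lemma τ_le {i j : Fin (k + m)} (h : ∀ x, d.μ i x ≤ d.μ j x) : d.τ i ≤ d.τ j :=
  intervalIntegral.integral_mono_on zero_le_one ((d.μc i).intervalIntegrable _ _)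
    ((d.μc j).intervalIntegrable _ _) fun x _ => h x

lemma τ_inc {i j : Fin (k + m)} (h : i.1 ≤ j.1) (hj : j.1 < k) : d.τ i ≤ d.τ j := by
  rcases h.lt_or_eq with h | h
  · exact d.τ_le fun x => (d.hinc i j h hj x).le
  · rw [Fin.ext h]

lemma τ_dec {i j : Fin (k + m)} (hi : k ≤ i.1) (h : i.1 ≤ j.1) : d.τ j ≤ d.τ i := by
  rcases h.lt_or_eq with h | h
  · exact d.τ_le fun x => (d.hdec i j hi h x).le
  · rw [Fin.ext h]

theorem win (hB : ∀ i (h1 : 1 ≤ i) (him : i ≤ m),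
      (Matrix.of fun p q : Fin i =>
        d.B ⟨k - i + p.1, by have := p.2; have := d.hkm; omega⟩ ⟨m - i + q.1, by have := q.2; omega⟩).det ≠ 0)
    {L : ℝ} (hT : ∀ j (hj : j < m), d.τ ⟨k - m + j, by omega⟩ + d.τ ⟨k + j, by omega⟩ < L) :
    Nonempty (d.fr.Win L) := by
  have hm := d.hm
  have hkm := d.hkm
  have hj0 : d.fr.σ d.fr.j0 1 = d.τ ⟨k - m, by omega⟩ := d.σp (by change k - m < k; omega)
  have hT0 := hT 0 (by omega)
  have hT1 := hT (m - 1) (by omega)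
  simp only [add_zero] at hT0
  refine Fr.win_ex ?_ (fun i hi => ?_) (fun i hi => ?_) ?_
  · rw [hj0]; linarith [d.τ_pos ⟨k, by omega⟩]
  · rw [d.σp hi]
    have hi' : i.1 < k := hi
    have h1 := d.τ_inc (i := i) (j := ⟨k - m + (m - 1), by omega⟩) (by simp only; omega) (by simp only; omega)
    linarith [d.τ_pos ⟨k + (m - 1), by omega⟩]
  · rw [hj0, d.σn hi]
    have hi' : ¬ i.1 < k := hi
    have h1 := d.τ_dec (i := ⟨k, by omega⟩) (j := i) le_rfl (not_lt.1 hi')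
    linarith
  · intro s hs u hu hV1 hV2
    have hplus : (∀ l : Fin (k + m), l.1 < k → u l = 0) → u = 0 := by
      intro h
      funext i
      by_cases hi : i.1 < k
      · exact h i hi
      · rw [hu i hi]
        refine Finset.sum_eq_zero fun j _ => ?_
        by_cases hj : j.1 < k
        · rw [h j hj, mul_zero]
        · rw [d.Bm_zero i j hj, zero_mul]
    by_contra hne
    have hex : ∃ n, ∃ h : n < k, u ⟨n, by omega⟩ ≠ 0 := by
      by_contra hh
      push Not at hh
      exact hne (hplus fun l hl => hh l.1 hl)
    classical
    obtain ⟨hl0, hu0⟩ := Nat.find_spec hex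
    have hmin : ∀ l : Fin (k + m), l.1 < Nat.find hex → u l = 0 := fun l hl => by
      have := Nat.find_min hex hl
      push Not at this
      exact this (by omega)
    set l0 := Nat.find hex with hl0d
    have hj : ¬ l0 ≤ k - m := fun hh => hu0 (hV1 ⟨l0, by omega⟩ hl0 (Or.inl fun x => by
      change ε _ * _ ≤ ε _ * _
      rw [εp (by exact hl0), εp (by change k - m < k; omega)]
      rcases hh.lt_or_eq with h | h
      · have := d.hinc ⟨l0, by omega⟩ ⟨k - m, by omega⟩ h (by simp only; omega) x
        change 1 * _ ≤ 1 * d.μ ⟨k - m, by omega⟩ x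
        linarith
      · have : (⟨l0, by omega⟩ : Fin (k + m)) = d.fr.j0 := Fin.ext h
        rw [this]))
    have hs0 : L - d.τ ⟨l0, by omega⟩ ≤ s := by
      by_contra hh
      refine hu0 (hV1 ⟨l0, by omega⟩ hl0 (Or.inr ?_))
      rw [d.σp (by exact hl0)]
      exact not_le.1 hh
    obtain ⟨c, hc1, hc2, rfl' : l0 = k - c⟩ : ∃ c, 1 ≤ c ∧ c ≤ m ∧ l0 = k - c := ⟨k - l0, by omega, by omega, by omega⟩
    have hq : ∀ q : Fin c, u ⟨k + m - c + q.1, by omega⟩ = 0 := by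
      intro q
      refine hV2 _ (by change ¬ (k + m - c + q.1 < k); omega) ?_
      rw [d.σn (by change ¬ (k + m - c + q.1 < k); omega), neg_neg]
      have h1 := d.τ_dec (i := ⟨k + (m - c), by omega⟩) (j := ⟨k + m - c + q.1, by omega⟩)
        (by simp only; omega) (by simp only; omega)
      have h2 := hT (m - c) (by omega)
      have h3 : (⟨k - m + (m - c), by omega⟩ : Fin (k + m)) = ⟨l0, by omega⟩ := Fin.ext (by simp only; omega)
      rw [h3] at h2
      linarith
    have hvec : (fun p : Fin c => u ⟨k - c + p.1, by omega⟩) = 0 := by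
      refine Matrix.eq_zero_of_vecMul_eq_zero (hB c hc1 hc2) ?_
      funext q
      have h1 := hu ⟨k + m - c + q.1, by omega⟩ (by change ¬ (k + m - c + q.1 < k); omega)
      rw [hq q] at h1
      have h2 : ∑ j, d.fr.Bm ⟨k + m - c + q.1, by omega⟩ j * u j =
          ∑ p : Fin c, d.fr.Bm ⟨k + m - c + q.1, by omega⟩ ⟨k - c + p.1, by omega⟩ * u ⟨k - c + p.1, by omega⟩ := by
        symm
        refine Finset.sum_of_injOn (fun p : Fin c => (⟨k - c + p.1, by omega⟩ : Fin (k + m))) ?_ ?_ ?_ ?_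
        · intro p _ q _ h
          have := congrArg Fin.val h
          simp only at this
          exact Fin.ext (by omega)
        · intro p _; simp
        · intro j _ hj'
          by_cases hjk : j.1 < k
          · rw [hmin j ?_, mul_zero]
            by_contra hh
            refine hj' ⟨⟨j.1 - (k - c), by omega⟩, by simp, Fin.ext ?_⟩
            simp only; omega
          · rw [d.Bm_zero _ _ hjk, zero_mul]
        · intro p _; rfl
      rw [h2] at h1
      simp only [Matrix.vecMul, dotProduct, Matrix.of_apply, Pi.zero_apply]
      have h3 : ∑ p : Fin c, u ⟨k - c + p.1, by omega⟩ * d.B ⟨k - c + p.1, by omega⟩ ⟨m - c + q.1, by omega⟩ =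
        -∑ p : Fin c, d.fr.Bm ⟨k + m - c + q.1, by omega⟩ ⟨k - c + p.1, by omega⟩ * u ⟨k - c + p.1, by omega⟩ := by
        rw [← Finset.sum_neg_distrib]
        refine Finset.sum_congr rfl fun p _ => ?_
        rw [d.Bm_eq _ _ (by simp only; omega) (by simp only; omega)]
        have : (⟨k + m - c + q.1 - k, by omega⟩ : Fin m) = ⟨m - c + q.1, by omega⟩ := Fin.ext (by simp only; omega)
        rw [this]; ring
      rw [h3, ← h1, neg_zero]
    have h9 := congrFun hvec ⟨0, by omega⟩
    refine hu0 ?_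
    have : (⟨l0, by omega⟩ : Fin (k + m)) = ⟨k - c + 0, by omega⟩ := Fin.ext (by simp only; omega)
    rw [this]; exact h9

end Dat
end Obs

open Set
namespace Obs
open Filter Topology MeasureTheory
open scoped BoundedContinuousFunction

namespace Dat
variable {k m : ℕ} (d : Dat k m)

lemma coL {L : ℝ} (hL : 0 ≤ L) :
    ∃ Q : C(Icc 0 L, C(Icc (0:ℝ) 1, Fin (k + m) → Fin (k + m) → ℝ)) →L[ℝ] Fr.Co (Fin (k + m)),
      ∀ f i l p, Q f i l p = -(f (projIcc 0 L hL p.1) (projIcc 0 1 zero_le_one p.2) l i) *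
        d.fr.dσ l (Fr.cl p.2) := by
  have h : ∀ l, ∃ c, ∀ x ∈ Icc (0:ℝ) 1, |d.fr.dσ l x| ≤ c := fun l => by
    obtain ⟨c, hc⟩ := isCompact_Icc.exists_bound_of_continuousOn (d.fr.hdσ l).continuousOn (s := Icc (0:ℝ) 1)
    exact ⟨c, hc⟩
  choose c hc using h
  have hc0 : ∀ l, 0 ≤ c l := fun l => (abs_nonneg _).trans (hc l 0 (by simp))
  have hcs : ∀ l, c l ≤ ∑ l, c l := fun l => Finset.single_le_sum (fun l _ => hc0 l) (Finset.mem_univ l)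
  have hb : ∀ (f : C(Icc 0 L, C(Icc (0:ℝ) 1, Fin (k + m) → Fin (k + m) → ℝ))) i l (p : ℝ × ℝ),
      ‖-(f (projIcc 0 L hL p.1) (projIcc 0 1 zero_le_one p.2) l i) * d.fr.dσ l (Fr.cl p.2)‖ ≤ (∑ l, c l) * ‖f‖ := by
    intro f i l p
    rw [norm_mul, norm_neg, mul_comm]
    refine mul_le_mul ((hc l _ ⟨Fr.cl_nonneg _, Fr.cl_le _⟩).trans (hcs l)) ?_ (norm_nonneg _)
      (Finset.sum_nonneg fun l _ => hc0 l)
    exact ((norm_le_pi_norm _ i).trans (norm_le_pi_norm _ l)).trans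
      (((f _).norm_coe_le_norm _).trans (f.norm_coe_le_norm _))
  refine ⟨LinearMap.mkContinuous
    { toFun := fun f i l => BoundedContinuousFunction.ofNormedAddCommGroup
        (fun p : ℝ × ℝ => -(f (projIcc 0 L hL p.1) (projIcc 0 1 zero_le_one p.2) l i) * d.fr.dσ l (Fr.cl p.2))
        (by
          have h1 : Continuous fun p : ℝ × ℝ => f (projIcc 0 L hL p.1) :=
            f.continuous.comp (continuous_projIcc.comp continuous_fst)
          have h2 : Continuous fun p : ℝ × ℝ => projIcc (0:ℝ) 1 zero_le_one p.2 :=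
            continuous_projIcc.comp continuous_snd
          have h3 := continuous_eval.comp (h1.prodMk h2)
          have h4 := (continuous_apply i).comp ((continuous_apply l).comp h3)
          have h5 := (d.fr.hdσ l).comp (Fr.cl_cont.comp (continuous_snd (X := ℝ) (Y := ℝ)))
          exact h4.neg.mul h5) ((∑ l, c l) * ‖f‖) (hb f i l)
      map_add' := fun f g => by
        funext i l; ext p
        simp only [BoundedContinuousFunction.coe_ofNormedAddCommGroup, ContinuousMap.add_apply,
          Pi.add_apply, BoundedContinuousFunction.add_apply]
        ring
      map_smul' := fun a f => by
        funext i l; ext p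
        simp only [BoundedContinuousFunction.coe_ofNormedAddCommGroup, ContinuousMap.smul_apply,
          Pi.smul_apply, BoundedContinuousFunction.smul_apply, smul_eq_mul, RingHom.id_apply]
        ring } (∑ l, c l) (fun f => ?_), fun f i l p => rfl⟩
  have h0 : 0 ≤ (∑ l, c l) * ‖f‖ := mul_nonneg (Finset.sum_nonneg fun l _ => hc0 l) (norm_nonneg f)
  refine (pi_norm_le_iff_of_nonneg h0).2 fun i => (pi_norm_le_iff_of_nonneg h0).2 fun l => ?_
  exact (BoundedContinuousFunction.norm_le h0).2 (hb f i l)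

noncomputable def Ef (F : ℝ → C(Icc (0:ℝ) 1, Fin (k + m) → Fin (k + m) → ℝ)) :
    Fin (k + m) → Fin (k + m) → ℝ × ℝ → ℝ := fun i l p =>
  -(F p.1 (projIcc 0 1 zero_le_one p.2) l i) * d.fr.dσ l (Fr.cl p.2)

lemma Ef_cont {F : ℝ → C(Icc (0:ℝ) 1, Fin (k + m) → Fin (k + m) → ℝ)} (hF : Continuous F) (i l) :
    Continuous (d.Ef F i l) := by
  have h2 : Continuous fun p : ℝ × ℝ => projIcc (0:ℝ) 1 zero_le_one p.2 :=
    continuous_projIcc.comp continuous_snd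
  have h3 := continuous_eval.comp ((hF.comp continuous_fst).prodMk h2)
  have h4 := (continuous_apply i).comp ((continuous_apply l).comp h3)
  have h5 := (d.fr.hdσ l).comp (Fr.cl_cont.comp (continuous_snd (X := ℝ) (Y := ℝ)))
  exact h4.neg.mul h5

theorem obs (hB : ∀ i (h1 : 1 ≤ i) (him : i ≤ m),
      (Matrix.of fun p q : Fin i =>
        d.B ⟨k - i + p.1, by have := p.2; have := d.hkm; omega⟩ ⟨m - i + q.1, by have := q.2; omega⟩).det ≠ 0)
    {T0 a β : ℝ} (hT : ∀ j (hj : j < m), d.τ ⟨k - m + j, by omega⟩ + d.τ ⟨k + j, by omega⟩ ≤ T0)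
    (ha : a < 0) (hT1 : d.τ ⟨k - 1, by have := d.hm; omega⟩ + d.τ ⟨k, by have := d.hm; omega⟩ < β)
    {F : ℝ → C(Icc (0:ℝ) 1, Fin (k + m) → Fin (k + m) → ℝ)} (hF : Continuous F)
    (hFa : AnalyticOnNhd ℝ F (Ioo a β)) {L : ℝ} (hL : T0 < L) (hLβ : L < β) :
    ∃ c, 0 ≤ c ∧ ∀ w, d.fr.Mild (d.Ef F) L w →
      ∫ x in (0:ℝ)..1, ∑ i, w (0, x) i ^ 2 ≤ c * ∫ t in (0:ℝ)..L, ∑ i, w (t, 1) i ^ 2 := by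
  have hm := d.hm
  have hkm := d.hkm
  have D : ∀ L, T0 < L → Nonempty (d.fr.Win L) := fun L hL => d.win hB fun j hj => (hT j hj).trans_lt hL
  have hL0 : ∀ L, T0 < L → 0 < L := fun L hL => by
    have := hT 0 (by omega)
    linarith [d.τ_pos ⟨k - m + 0, by omega⟩, d.τ_pos ⟨k + 0, by omega⟩]
  have fam : ∀ L (hL : T0 < L), ∃ 𝓔 : ℝ → Fr.Co (Fin (k + m)), AnalyticOnNhd ℝ 𝓔 (Ioo a (β - L)) ∧
      ∀ t, ∀ i l, ∀ p ∈ d.fr.Om L, 𝓔 t i l p = Fr.sh (d.Ef F) t i l p := by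
    intro L hL
    obtain ⟨Q, hQ⟩ := d.coL (hL0 L hL).le
    let Ψ : ℝ → C(Icc 0 L, C(Icc (0:ℝ) 1, Fin (k + m) → Fin (k + m) → ℝ)) := fun t =>
      ⟨fun s => F (t + s), hF.comp (by fun_prop)⟩
    refine ⟨fun t => Q (Ψ t), fun t ht => ?_, fun t i l p hp => ?_⟩
    · refine (Q.analyticAt _).comp (analyticAt_shift F (fun s : Icc 0 L => (s:ℝ)) continuous_subtype_val Ψ t
        (Eventually.of_forall fun t s => rfl) fun s => hFa _ ⟨?_, ?_⟩)
      · linarith [s.2.1, ht.1]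
      · linarith [s.2.2, ht.2]
    · rw [hQ]
      have : projIcc 0 L (hL0 L hL).le p.1 = ⟨p.1, hp.2.2.1, d.fr.Om_fst_le hp⟩ := projIcc_of_mem _ _
      rw [this]; rfl
  have huniq : ∀ w, d.fr.Sol (d.Ef F) L w → ∀ x ∈ Icc (0:ℝ) 1, w (0, x) = 0 := fun w hw =>
    Fr.chain (Φ := d.fr) (d.Ef_cont hF) ha
      (by
        rw [show d.fr.σ d.fr.imax 1 = d.τ ⟨k - 1, by omega⟩ from d.σp (by change k - 1 < k; omega),
          show d.fr.σ d.fr.imin 1 = -d.τ ⟨k, by omega⟩ from d.σn (by change ¬ k < k; omega)]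
        linarith)
      (fun L hL => (D L hL).some.S_pos)
      (fun L hL hLβ => by
        obtain ⟨𝓔, h1, h2⟩ := fam L hL
        exact (D L hL).some.gen (d.Ef_cont hF) (by linarith) 𝓔 h1 fun t _ => h2 t) hL hLβ hw
  obtain ⟨𝓔, -, h2⟩ := fam L hL
  have h2' : ∀ i l, ∀ p ∈ d.fr.Om L, 𝓔 0 i l p = d.Ef F i l p := fun i l p hp => by
    rw [h2 0 i l p hp]; simp [Fr.sh]
  obtain ⟨c, hc0, hc⟩ := (D L hL).some.final (𝓔 0) fun w hw =>
    huniq w (hw.congr (fun i l p hp => (h2' i l p hp).symm) fun _ _ => rfl)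
  refine ⟨c, hc0, fun w hw => hc w ⟨hw.cont, fun i s x y hxy hx hy => ?_, hw.b0⟩⟩
  rw [hw.eq i s x y hxy hx hy]
  refine intervalIntegral.integral_congr fun ξ hξ => ?_
  rw [uIcc_of_le hxy] at hξ
  exact Finset.sum_congr rfl fun l _ => by rw [h2' _ _ _ (d.fr.Om_path hx hy hξ.1 hξ.2)]

end Dat
end Obs

open Set
namespace Obs
open Filter Topology MeasureTheory
open scoped BoundedContinuousFunction

lemma path_deriv {T : ℝ} {g gt gx : ℝ → ℝ → ℝ}
    (ht : ContinuousOn (fun p : ℝ × ℝ => gt p.1 p.2) (Icc 0 T ×ˢ Icc 0 1))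
    (hx : ContinuousOn (fun p : ℝ × ℝ => gx p.1 p.2) (Icc 0 T ×ˢ Icc 0 1))
    (dt : ∀ t ∈ Icc (0:ℝ) T, ∀ x ∈ Icc (0:ℝ) 1, HasDerivWithinAt (fun s => g s x) (gt t x) (Icc 0 T) t)
    (dx : ∀ t ∈ Icc (0:ℝ) T, ∀ x ∈ Icc (0:ℝ) 1, HasDerivWithinAt (fun y => g t y) (gx t x) (Icc 0 1) x)
    {ρ : ℝ → ℝ} {ρ' ξ : ℝ} (hρ : HasDerivAt ρ ρ' ξ) (h1 : ρ ξ ∈ Ioo 0 T) (h2 : ξ ∈ Ioo (0:ℝ) 1) :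
    HasDerivAt (fun y => g (ρ y) y) (ρ' * gt (ρ ξ) ξ + gx (ρ ξ) ξ) ξ := by
  have hn : Ioo 0 T ×ˢ Ioo (0:ℝ) 1 ∈ 𝓝 (ρ ξ, ξ) := prod_mem_nhds (Ioo_mem_nhds h1.1 h1.2) (Ioo_mem_nhds h2.1 h2.2)
  have hn' : Icc 0 T ×ˢ Icc (0:ℝ) 1 ∈ 𝓝 (ρ ξ, ξ) :=
    mem_of_superset hn (prod_mono Ioo_subset_Icc_self Ioo_subset_Icc_self)
  let S : ℝ →L[ℝ] ℝ →L[ℝ] ℝ := ContinuousLinearMap.smulRightL ℝ ℝ ℝ (1 : ℝ →L[ℝ] ℝ)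
  have hS : ∀ a : ℝ, S a = ContinuousLinearMap.smulRight (1 : ℝ →L[ℝ] ℝ) a := fun a => rfl
  have key := hasStrictFDerivAt_uncurry_coprod (𝕜 := ℝ) (u := (ρ ξ, ξ)) (f := g)
    (f₁ := fun t x => S (gt t x)) (f₂ := fun t x => S (gx t x))
    (by
      filter_upwards [hn] with p hp
      have := (dt p.1 (Ioo_subset_Icc_self hp.1) p.2 (Ioo_subset_Icc_self hp.2)).hasDerivAt
        (Icc_mem_nhds hp.1.1 hp.1.2)
      exact this.hasFDerivAt)
    (by
      filter_upwards [hn] with p hp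
      have := (dx p.1 (Ioo_subset_Icc_self hp.1) p.2 (Ioo_subset_Icc_self hp.2)).hasDerivAt
        (Icc_mem_nhds hp.2.1 hp.2.2)
      exact this.hasFDerivAt)
    (S.continuous.continuousAt.comp (ht.continuousAt hn'))
    (S.continuous.continuousAt.comp (hx.continuousAt hn'))
  have h3 := key.hasFDerivAt.comp_hasDerivAt ξ (f := fun y => (ρ y, y)) (hρ.prodMk (hasDerivAt_id ξ))
  refine h3.congr_deriv ?_
  change S (gt (ρ ξ) ξ) ρ' + S (gx (ρ ξ) ξ) 1 = _
  rw [hS, hS]; simp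

namespace Dat
variable {k m : ℕ} (d : Dat k m)

lemma conv {lam lam' : Fin (k + m) → ℝ → ℝ} (hlc : ∀ i, ContinuousOn (lam i) (Icc 0 1))
    (hlam' : ∀ i, ∀ x ∈ Icc (0:ℝ) 1, HasDerivWithinAt (lam i) (lam' i x) (Icc 0 1) x)
    (hpos : ∀ i, ∀ x ∈ Icc (0:ℝ) 1, 0 < lam i x)
    (hμ : ∀ i, ∀ x ∈ Icc (0:ℝ) 1, d.μ i x = (lam i x)⁻¹) {L T : ℝ} (hLT : L ≤ T)
    {F : ℝ → C(Icc (0:ℝ) 1, Fin (k + m) → Fin (k + m) → ℝ)} (hF : Continuous F)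
    {C : ℝ → ℝ → Fin (k + m) → Fin (k + m) → ℝ}
    (hFC : ∀ t ∈ Icc 0 L, ∀ x : Icc (0:ℝ) 1, F t x = C t x)
    {v vt vx : ℝ → ℝ → Fin (k + m) → ℝ}
    (hv : ContinuousOn (fun p : ℝ × ℝ => v p.1 p.2) (Icc 0 T ×ˢ Icc 0 1))
    (hvt : ContinuousOn (fun p : ℝ × ℝ => vt p.1 p.2) (Icc 0 T ×ˢ Icc 0 1))
    (hvx : ContinuousOn (fun p : ℝ × ℝ => vx p.1 p.2) (Icc 0 T ×ˢ Icc 0 1))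
    (dt : ∀ t ∈ Icc (0:ℝ) T, ∀ x ∈ Icc (0:ℝ) 1, ∀ i,
      HasDerivWithinAt (fun s => v s x i) (vt t x i) (Icc 0 T) t)
    (dx : ∀ t ∈ Icc (0:ℝ) T, ∀ x ∈ Icc (0:ℝ) 1, ∀ i,
      HasDerivWithinAt (fun y => v t y i) (vx t x i) (Icc 0 1) x)
    (pde : ∀ t ∈ Icc (0:ℝ) T, ∀ x ∈ Icc (0:ℝ) 1, ∀ i : Fin (k + m),
      vt t x i = (if (i : ℕ) < k then -lam i x else lam i x) * vx t x i +
        (if (i : ℕ) < k then -lam' i x else lam' i x) * v t x i - ∑ j, C t x j i * v t x j)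
    (bc : ∀ t ∈ Icc (0:ℝ) T, ∀ i : Fin m,
      lam (Fin.natAdd k i) 0 * v t 0 (Fin.natAdd k i) =
        -∑ j : Fin k, d.B j i * (-lam (Fin.castAdd m j) 0 * v t 0 (Fin.castAdd m j))) :
    d.fr.Mild (d.Ef F) L (fun p i => -(ε i * lam i p.2 * v p.1 p.2 i)) := by
  have hOm : ∀ p ∈ d.fr.Om L, p ∈ Icc 0 T ×ˢ Icc (0:ℝ) 1 := fun p hp =>
    ⟨⟨hp.2.2.1, (d.fr.Om_fst_le hp).trans hLT⟩, hp.1, hp.2.1⟩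
  have hwc : ContinuousOn (fun p : ℝ × ℝ => fun i => -(ε i * lam i p.2 * v p.1 p.2 i)) (d.fr.Om L) := by
    refine continuousOn_pi.2 fun i => ?_
    have h1 : ContinuousOn (fun p : ℝ × ℝ => lam i p.2) (d.fr.Om L) :=
      (hlc i).comp continuousOn_snd fun p hp => (hOm p hp).2
    have h2 : ContinuousOn (fun p : ℝ × ℝ => v p.1 p.2 i) (d.fr.Om L) :=
      ((continuous_apply i).comp_continuousOn hv).mono hOm
    exact ((continuousOn_const.mul h1).mul h2).neg
  have hεε : ∀ i : Fin (k + m), ε i * ε i = 1 := fun i => by unfold ε; split_ifs <;> norm_num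
  refine ⟨hwc, fun i s x y hxy hx hy => ?_, fun t ht i hi => ?_⟩
  · rcases hxy.eq_or_lt with rfl | hlt
    · simp
    have hpath : ∀ ξ ∈ Icc x y, d.fr.γ i s ξ ∈ d.fr.Om L := fun ξ hξ => d.fr.Om_path hx hy hξ.1 hξ.2
    have hγc := d.fr.γ_cont i s
    have hwγ := hwc.comp hγc.continuousOn hpath
    symm
    refine intervalIntegral.integral_eq_sub_of_hasDerivAt_of_le
      (f := fun ξ => -(ε i * lam i (d.fr.γ i s ξ).2 * v (d.fr.γ i s ξ).1 (d.fr.γ i s ξ).2 i)) hxy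
      ((continuous_apply i).comp_continuousOn hwγ) (fun ξ hξ => ?_) ?_
    · have hξ' := hpath ξ (Ioo_subset_Icc_self hξ)
      have hξO := hOm _ hξ'
      have h01 : ξ ∈ Ioo (0:ℝ) 1 := ⟨hx.1.trans_lt hξ.1, hξ.2.trans_le hy.2.1⟩
      have hI01 := Ioo_subset_Icc_self h01
      have hx1 := hOm _ hx
      have hy1 := hOm _ hy
      have htm : s + d.fr.σ i ξ ∈ Ioo 0 T := by
        have a1 : 0 ≤ s + d.fr.σ i x := hx1.1.1
        have a2 : s + d.fr.σ i x ≤ T := hx1.1.2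
        have a3 : 0 ≤ s + d.fr.σ i y := hy1.1.1
        have a4 : s + d.fr.σ i y ≤ T := hy1.1.2
        by_cases h : d.fr.mi i
        · have hs : StrictMono (d.fr.σ i) := strictMono_of_deriv_pos fun x => by
            rw [(d.fr.hσ i x).deriv]; exact d.fr.hmi i h x
          have := hs hξ.1
          have := hs hξ.2
          constructor <;> linarith
        · have hs : StrictAnti (d.fr.σ i) := strictAnti_of_deriv_neg fun x => by
            rw [(d.fr.hσ i x).deriv]; exact d.fr.hpl i h x
          have := hs hξ.1
          have := hs hξ.2
          constructor <;> linarith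
      have hd1 := path_deriv (g := fun t x => v t x i) ((continuous_apply i).comp_continuousOn hvt)
        ((continuous_apply i).comp_continuousOn hvx) (fun t ht x hx => dt t ht x hx i)
        (fun t ht x hx => dx t ht x hx i) ((d.fr.hσ i ξ).const_add s) htm h01
      have hd2 := (hlam' i ξ hI01).hasDerivAt (Icc_mem_nhds h01.1 h01.2)
      refine (((hd2.const_mul (ε i)).mul hd1).neg).congr_deriv ?_
      have hp := pde _ (Ioo_subset_Icc_self htm) ξ hI01 i
      have hs1 : ∀ a : ℝ, (if (i : ℕ) < k then -a else a) = -ε i * a := fun a => by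
        unfold ε; split_ifs <;> ring
      rw [hs1, hs1] at hp
      have hsum : ∑ l, d.Ef F i l (d.fr.γ i s ξ) * -(ε l * lam l (d.fr.γ i s ξ).2 *
          v (d.fr.γ i s ξ).1 (d.fr.γ i s ξ).2 l) =
          ∑ j, C (s + d.fr.σ i ξ) ξ j i * v (s + d.fr.σ i ξ) ξ j := by
        refine Finset.sum_congr rfl fun l _ => ?_
        have e1 : d.Ef F i l (d.fr.γ i s ξ) = -(C (s + d.fr.σ i ξ) ξ l i) * (ε l * (lam l ξ)⁻¹) := by
          change -(F (s + d.fr.σ i ξ) (projIcc 0 1 zero_le_one ξ) l i) * (ε l * d.μ l (Fr.cl ξ)) = _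
          rw [Fr.cl_id hI01.1 hI01.2, hμ l ξ hI01, projIcc_of_mem zero_le_one hI01,
            hFC (s + d.fr.σ i ξ) ⟨hξ'.2.2.1, d.fr.Om_fst_le hξ'⟩]
        rw [e1]
        change _ * -(ε l * lam l ξ * v (s + d.fr.σ i ξ) ξ l) = _
        have e2 := (hpos l ξ hI01).ne'
        have e3 : (lam l ξ)⁻¹ * lam l ξ = 1 := inv_mul_cancel₀ e2
        linear_combination (C (s + d.fr.σ i ξ) ξ l i * v (s + d.fr.σ i ξ) ξ l) *
          ((lam l ξ)⁻¹ * lam l ξ * hεε l + e3)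
      rw [hsum]
      have e4 : d.fr.dσ i ξ = ε i * (lam i ξ)⁻¹ := by
        change ε i * d.μ i ξ = _
        rw [hμ i ξ hI01]
      rw [e4]
      have e3 : (lam i ξ)⁻¹ * lam i ξ = 1 := inv_mul_cancel₀ (hpos i ξ hI01).ne'
      linear_combination (-(vt (s + d.fr.σ i ξ) ξ i)) * ((lam i ξ)⁻¹ * lam i ξ * hεε i + e3) - hp
    · refine ContinuousOn.intervalIntegrable_of_Icc hxy ?_
      refine continuousOn_finsetSum _ fun l _ => ContinuousOn.mul ?_ ?_
      · exact ((d.Ef_cont hF i l).comp hγc).continuousOn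
      · exact (continuous_apply l).comp_continuousOn hwγ
  · have hi' : ¬ i.1 < k := hi
    obtain ⟨i', rfl⟩ : ∃ i' : Fin m, i = Fin.natAdd k i' := ⟨⟨i.1 - k, by omega⟩, Fin.ext (by simp; omega)⟩
    have h1 := bc t (hOm _ ht).1 i'
    have e1 : ε (Fin.natAdd k i' : Fin (k + m)) = -1 := εn hi'
    simp only [e1]
    rw [Fin.sum_univ_add]
    have h2 : ∑ j : Fin m, d.fr.Bm (Fin.natAdd k i') (Fin.natAdd k j) *
        -(ε (Fin.natAdd k j : Fin (k + m)) * lam (Fin.natAdd k j) 0 * v t 0 (Fin.natAdd k j)) = 0 :=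
      Finset.sum_eq_zero fun j _ => by rw [d.Bm_zero _ _ (by simp), zero_mul]
    rw [h2, add_zero, neg_one_mul, neg_mul, neg_neg, h1, ← Finset.sum_neg_distrib]
    refine Finset.sum_congr rfl fun j _ => ?_
    have e2 : ε (Fin.castAdd m j : Fin (k + m)) = 1 := εp (by simp)
    rw [d.Bm_eq _ _ (by simp) (by simp), e2]
    have e3 : (⟨(Fin.natAdd k i' : Fin (k + m)).1 - k, by simp⟩ : Fin m) = i' := Fin.ext (by simp)
    have e4 : (⟨(Fin.castAdd m j : Fin (k + m)).1, by simp⟩ : Fin k) = j := Fin.ext (by simp)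
    rw [e3, e4]; ring

end Dat
end Obs

open Set
/-- Observability inequality at any time `T > T_opt` in the time-analytic setting (dual
formulation of Theorem 1.3 of the paper, restricted to classical adjoint solutions). Here
`n = k + m` with `k ≥ m ≥ 1`, `Σ(x) = diag(−λ₁(x),…,−λ_k(x), λ_{k+1}(x),…,λ_{k+m}(x))` with
`λ_i` of class `C²` and derivative `λ'_i`, `τ_i = ∫₀¹ dx/λ_i(x)`, `T₁ = τ_k + τ_{k+1}`,
`T_opt = max{τ_{k+1−m}+τ_{k+1}, …, τ_k+τ_{k+m}}`, every trailing principal minor of `B` of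
size at most `m` is nonzero, `C` is continuous on `[0,∞) × [0,1]`, and `t ↦ C(t,·)` is
real-analytic on an open interval `I = (a,b) ⊇ [0,T₁]` (as a map `F` into the Banach space
`C([0,1]; ℝ^{n×n})`). Every classical solution `v` of the adjoint system
`∂_t v = Σ(x) ∂_x v + (Σ′(x) − C(t,x)ᵀ) v` with `v₋(t,1) = 0` and
`Σ₊(0) v₊(t,0) = −Bᵀ Σ₋(0) v₋(t,0)` obeys
`∫₀ᵀ |v₊(t,1)|² dt ≥ c_T ∫₀¹ |v(0,x)|² dx`. -/
theorem stmt2 (k m : ℕ) (hm : 1 ≤ m) (hkm : m ≤ k)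
    (lam lam' : Fin (k + m) → ℝ → ℝ)
    (hlamC2 : ∀ i, ContDiffOn ℝ 2 (lam i) (Icc 0 1))
    (hlam' : ∀ i, ∀ x ∈ Icc (0:ℝ) 1, HasDerivWithinAt (lam i) (lam' i x) (Icc 0 1) x)
    (hpos : ∀ i, ∀ x ∈ Icc (0:ℝ) 1, 0 < lam i x)
    (hdec : ∀ i j : Fin (k + m), (i : ℕ) < (j : ℕ) → (j : ℕ) < k →
      ∀ x ∈ Icc (0:ℝ) 1, lam j x < lam i x)
    (hinc : ∀ i j : Fin (k + m), k ≤ (i : ℕ) → (i : ℕ) < (j : ℕ) →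
      ∀ x ∈ Icc (0:ℝ) 1, lam i x < lam j x)
    (τ : Fin (k + m) → ℝ) (hτ : ∀ i, τ i = ∫ x in (0:ℝ)..1, (lam i x)⁻¹)
    (T₁ : ℝ) (hT₁ : T₁ = τ ⟨k - 1, by omega⟩ + τ ⟨k, by omega⟩)
    (Topt : ℝ)
    (hTopt : Topt = ⨆ j : Fin m,
      (τ ⟨k - m + j.1, by have := j.2; omega⟩ + τ ⟨k + j.1, by have := j.2; omega⟩))
    (B : Matrix (Fin k) (Fin m) ℝ)
    (hB : ∀ i (h1 : 1 ≤ i) (him : i ≤ m),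
      (Matrix.of fun p q : Fin i =>
        B ⟨k - i + p.1, by have := p.2; omega⟩ ⟨m - i + q.1, by have := q.2; omega⟩).det ≠ 0)
    (C : ℝ → ℝ → Fin (k + m) → Fin (k + m) → ℝ)
    (hC : ContinuousOn (fun p : ℝ × ℝ => C p.1 p.2) (Ici 0 ×ˢ Icc 0 1))
    (a b : ℝ) (hI : Icc 0 T₁ ⊆ Ioo a b)
    -- `t ↦ C(t,·)` is real-analytic on `I = (a,b)` into `C([0,1]; ℝ^{n×n})`
    (F : ℝ → C(Icc (0:ℝ) 1, Fin (k + m) → Fin (k + m) → ℝ))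
    (hF : ∀ t : ℝ, ∀ x : Icc (0:ℝ) 1, F t x = C t x.1)
    (hFa : AnalyticOnNhd ℝ F (Ioo a b)) :
    ∀ T : ℝ, Topt < T →
      ∃ c : ℝ, 0 < c ∧
        ∀ v vt vx : ℝ → ℝ → Fin (k + m) → ℝ,
          ContinuousOn (fun p : ℝ × ℝ => v p.1 p.2) (Icc 0 T ×ˢ Icc 0 1) →
          ContinuousOn (fun p : ℝ × ℝ => vt p.1 p.2) (Icc 0 T ×ˢ Icc 0 1) →
          ContinuousOn (fun p : ℝ × ℝ => vx p.1 p.2) (Icc 0 T ×ˢ Icc 0 1) →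
          (∀ t ∈ Icc (0:ℝ) T, ∀ x ∈ Icc (0:ℝ) 1, ∀ i,
            HasDerivWithinAt (fun s => v s x i) (vt t x i) (Icc 0 T) t) →
          (∀ t ∈ Icc (0:ℝ) T, ∀ x ∈ Icc (0:ℝ) 1, ∀ i,
            HasDerivWithinAt (fun y => v t y i) (vx t x i) (Icc 0 1) x) →
          -- ∂_t v = Σ(x) ∂_x v + (Σ′(x) − C(t,x)ᵀ) v
          (∀ t ∈ Icc (0:ℝ) T, ∀ x ∈ Icc (0:ℝ) 1, ∀ i : Fin (k + m),
            vt t x i = (if (i : ℕ) < k then -lam i x else lam i x) * vx t x i +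
              (if (i : ℕ) < k then -lam' i x else lam' i x) * v t x i -
              ∑ j, C t x j i * v t x j) →
          -- v₋(t,1) = 0
          (∀ t ∈ Icc (0:ℝ) T, ∀ j : Fin k, v t 1 (Fin.castAdd m j) = 0) →
          -- Σ₊(0) v₊(t,0) = −Bᵀ Σ₋(0) v₋(t,0)
          (∀ t ∈ Icc (0:ℝ) T, ∀ i : Fin m,
            lam (Fin.natAdd k i) 0 * v t 0 (Fin.natAdd k i) =
              -∑ j : Fin k, B j i * (-lam (Fin.castAdd m j) 0 * v t 0 (Fin.castAdd m j))) →
          (∫ t in (0:ℝ)..T, ∑ i : Fin m, (v t 1 (Fin.natAdd k i)) ^ 2) ≥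
            c * ∫ x in (0:ℝ)..1, ∑ i, (v 0 x i) ^ 2 := by
  intro T hTT
  let d : Obs.Dat k m :=
    { hm := hm
      hkm := hkm
      μ := fun i x => (lam i (Obs.Fr.cl x))⁻¹
      μc := fun i => ((hlamC2 i).continuousOn.comp_continuous Obs.Fr.cl_cont
        fun x => ⟨Obs.Fr.cl_nonneg x, Obs.Fr.cl_le x⟩).inv₀
        fun x => (hpos i _ ⟨Obs.Fr.cl_nonneg x, Obs.Fr.cl_le x⟩).ne'
      μ0 := fun i x => inv_pos.2 (hpos i _ ⟨Obs.Fr.cl_nonneg x, Obs.Fr.cl_le x⟩)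
      hinc := fun i j hij hj x => inv_strictAnti₀ (hpos j _ ⟨Obs.Fr.cl_nonneg x, Obs.Fr.cl_le x⟩)
        (hdec i j hij hj _ ⟨Obs.Fr.cl_nonneg x, Obs.Fr.cl_le x⟩)
      hdec := fun i j hi hij x => inv_strictAnti₀ (hpos i _ ⟨Obs.Fr.cl_nonneg x, Obs.Fr.cl_le x⟩)
        (hinc i j hi hij _ ⟨Obs.Fr.cl_nonneg x, Obs.Fr.cl_le x⟩)
      B := B }
  have hμ : ∀ i, ∀ x ∈ Icc (0:ℝ) 1, d.μ i x = (lam i x)⁻¹ := fun i x hx => by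
    change (lam i (Obs.Fr.cl x))⁻¹ = _
    rw [Obs.Fr.cl_id hx.1 hx.2]
  have hdτ : ∀ i, d.τ i = τ i := fun i => by
    rw [hτ i]
    refine intervalIntegral.integral_congr fun x hx => ?_
    rw [uIcc_of_le zero_le_one] at hx
    exact hμ i x hx
  have hT : ∀ j (hj : j < m), d.τ ⟨k - m + j, by omega⟩ + d.τ ⟨k + j, by omega⟩ ≤ Topt := by
    intro j hj
    rw [hdτ, hdτ, hTopt]
    exact le_ciSup (f := fun j : Fin m => (τ ⟨k - m + j.1, by have := j.2; omega⟩ +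
      τ ⟨k + j.1, by have := j.2; omega⟩)) (Set.finite_range _).bddAbove ⟨j, hj⟩
  have hT1' : Topt ≤ T₁ := by
    haveI : Nonempty (Fin m) := ⟨⟨0, hm⟩⟩
    rw [hTopt, hT₁]
    refine ciSup_le fun j => ?_
    have hj := j.2
    rw [← hdτ, ← hdτ, ← hdτ, ← hdτ]
    refine add_le_add (d.τ_inc ?_ ?_) (d.τ_dec ?_ ?_) <;> simp <;> omega
  have hTpos : 0 < Topt := by
    have := hT 0 hm
    have h1 := d.τ_pos ⟨k - m + 0, by omega⟩
    have h2 := d.τ_pos ⟨k + 0, by omega⟩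
    linarith
  have h0 := hI ⟨le_rfl, hTpos.le.trans hT1'⟩
  have h1 := hI ⟨hTpos.le.trans hT1', le_rfl⟩
  obtain ⟨L, hL1, hL2, hL3⟩ : ∃ L, Topt < L ∧ L ≤ T ∧ L < b :=
    ⟨min T ((T₁ + b) / 2), lt_min hTT (by linarith [h1.2]), min_le_left _ _,
      (min_le_right _ _).trans_lt (by linarith [h1.2])⟩
  obtain ⟨β, hβ1, hβ2, hβ3⟩ : ∃ β, T₁ < β ∧ L < β ∧ β < b := by
    obtain ⟨β, h, h'⟩ := exists_between (max_lt h1.2 hL3)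
    exact ⟨β, (le_max_left _ _).trans_lt h, (le_max_right _ _).trans_lt h, h'⟩
  have ha : a / 2 < 0 := by linarith [h0.1]
  have haβ : a / 2 ≤ β := by linarith
  have hsub : Icc (a / 2) β ⊆ Ioo a b := fun x hx => ⟨by linarith [hx.1], hx.2.trans_lt hβ3⟩
  let G : ℝ → C(Icc (0:ℝ) 1, Fin (k + m) → Fin (k + m) → ℝ) := fun t => F (projIcc (a / 2) β haβ t)
  have hG : Continuous G := hFa.continuousOn.comp_continuous
    (continuous_subtype_val.comp continuous_projIcc) fun t => hsub (projIcc (a / 2) β haβ t).2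
  have hGe : ∀ t ∈ Icc (a / 2) β, G t = F t := fun t ht => by
    change F (projIcc (a / 2) β haβ t) = _
    rw [projIcc_of_mem haβ ht]
  have hGa : AnalyticOnNhd ℝ G (Ioo (a / 2) β) := fun t ht =>
    (hFa t (hsub (Ioo_subset_Icc_self ht))).congr (by
      filter_upwards [Ioo_mem_nhds ht.1 ht.2] with s hs
      exact (hGe s (Ioo_subset_Icc_self hs)).symm)
  obtain ⟨c, hc0, hc⟩ := d.obs hB hT ha (by rw [hdτ, hdτ, ← hT₁]; exact hβ1) hG hGa hL1 hβ2
  have hlc : ∀ i, ContinuousOn (lam i) (Icc 0 1) := fun i => (hlamC2 i).continuousOn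
  obtain ⟨l, hl0, hl⟩ : ∃ l : ℝ, 0 < l ∧ ∀ i, ∀ x ∈ Icc (0:ℝ) 1, l ≤ lam i x := by
    have hx : ∀ i, ∃ l : ℝ, 0 < l ∧ ∀ x ∈ Icc (0:ℝ) 1, l ≤ lam i x := fun i => by
      obtain ⟨x, hx, hm⟩ := isCompact_Icc.exists_isMinOn (nonempty_Icc.2 zero_le_one) (hlc i)
      exact ⟨lam i x, hpos i x hx, fun y hy => hm hy⟩
    choose f hf0 hf using hx
    haveI : Nonempty (Fin (k + m)) := ⟨⟨0, by omega⟩⟩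
    obtain ⟨i, hi⟩ := Finite.exists_min f
    exact ⟨f i, hf0 i, fun j x hx => (hi j).trans (hf j x hx)⟩
  obtain ⟨Λ, hΛ0, hΛ⟩ : ∃ Λ : ℝ, 0 < Λ ∧ ∀ i, lam i 1 ≤ Λ := by
    haveI : Nonempty (Fin (k + m)) := ⟨⟨0, by omega⟩⟩
    obtain ⟨i, hi⟩ := Finite.exists_max fun i => lam i 1
    exact ⟨lam i 1, hpos i 1 ⟨zero_le_one, le_rfl⟩, hi⟩
  refine ⟨l ^ 2 / ((c + 1) * Λ ^ 2), by positivity, ?_⟩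
  intro v vt vx hv hvt hvx dt dx pde bc1 bc
  have hL0 : 0 < L := hTpos.trans hL1
  have hT0 : 0 < T := hL0.trans_le hL2
  have hw := hc _ (d.conv hlc hlam' hpos hμ hL2 hG
    (fun t ht x => by rw [hGe t ⟨ha.le.trans ht.1, ht.2.trans hβ2.le⟩]; exact hF t x)
    hv hvt hvx dt dx pde bc)
  have hεε : ∀ i : Fin (k + m), Obs.Dat.ε i * Obs.Dat.ε i = 1 := fun i => by
    unfold Obs.Dat.ε; split_ifs <;> norm_num
  have hsq : ∀ (i : Fin (k + m)) (p q : ℝ), (-(Obs.Dat.ε i * p * q)) ^ 2 = p ^ 2 * q ^ 2 :=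
    fun i p q => by linear_combination (p ^ 2 * q ^ 2) * hεε i
  simp only [hsq] at hw
  have hv0 : ∀ i, ContinuousOn (fun x => v 0 x i) (Icc 0 1) := fun i =>
    (continuous_apply i).comp_continuousOn (hv.comp (f := fun x : ℝ => ((0:ℝ), x))
      (by fun_prop) fun x hx => ⟨⟨le_rfl, hT0.le⟩, hx⟩)
  have hv1 : ∀ i, ContinuousOn (fun t => v t 1 i) (Icc 0 T) := fun i =>
    (continuous_apply i).comp_continuousOn (hv.comp (f := fun t : ℝ => (t, (1:ℝ)))
      (by fun_prop) fun t ht => ⟨ht, zero_le_one, le_rfl⟩)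
  have A : l ^ 2 * ∫ x in (0:ℝ)..1, ∑ i, (v 0 x i) ^ 2 ≤
      ∫ x in (0:ℝ)..1, ∑ i, (lam i x) ^ 2 * (v 0 x i) ^ 2 := by
    rw [← intervalIntegral.integral_const_mul]
    refine intervalIntegral.integral_mono_on zero_le_one
      (ContinuousOn.intervalIntegrable_of_Icc zero_le_one
        (continuousOn_const.mul (continuousOn_finsetSum _ fun i _ => (hv0 i).pow 2)))
      (ContinuousOn.intervalIntegrable_of_Icc zero_le_one
        (continuousOn_finsetSum _ fun i _ => ((hlc i).pow 2).mul ((hv0 i).pow 2))) fun x hx => ?_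
    rw [Finset.mul_sum]
    refine Finset.sum_le_sum fun i _ => ?_
    exact mul_le_mul_of_nonneg_right (pow_le_pow_left₀ hl0.le (hl i x hx) 2) (sq_nonneg _)
  have hcm : ContinuousOn (fun t => ∑ i : Fin m, (v t 1 (Fin.natAdd k i)) ^ 2) (Icc 0 T) :=
    continuousOn_finsetSum _ fun i _ => (hv1 _).pow 2
  have D : ∫ t in (0:ℝ)..L, ∑ i, (lam i 1) ^ 2 * (v t 1 i) ^ 2 ≤
      Λ ^ 2 * ∫ t in (0:ℝ)..L, ∑ i : Fin m, (v t 1 (Fin.natAdd k i)) ^ 2 := by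
    rw [← intervalIntegral.integral_const_mul]
    have hs : Icc 0 L ⊆ Icc 0 T := Icc_subset_Icc_right hL2
    refine intervalIntegral.integral_mono_on hL0.le
      (ContinuousOn.intervalIntegrable_of_Icc hL0.le
        (continuousOn_finsetSum _ fun i _ => continuousOn_const.mul (((hv1 i).mono hs).pow 2)))
      (ContinuousOn.intervalIntegrable_of_Icc hL0.le
        (continuousOn_const.mul (hcm.mono hs))) fun t ht => ?_
    rw [Fin.sum_univ_add, Finset.mul_sum, Finset.sum_eq_zero, zero_add]
    · refine Finset.sum_le_sum fun i _ => ?_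
      exact mul_le_mul_of_nonneg_right
        (pow_le_pow_left₀ (hpos _ 1 ⟨zero_le_one, le_rfl⟩).le (hΛ _) 2) (sq_nonneg _)
    · intro j _
      rw [bc1 t (hs ht) j]; simp
  have E : ∫ t in (0:ℝ)..L, ∑ i : Fin m, (v t 1 (Fin.natAdd k i)) ^ 2 ≤
      ∫ t in (0:ℝ)..T, ∑ i : Fin m, (v t 1 (Fin.natAdd k i)) ^ 2 :=
    intervalIntegral.integral_mono_interval le_rfl hL0.le hL2
      (Filter.Eventually.of_forall fun t => Finset.sum_nonneg fun i _ => sq_nonneg _)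
      (ContinuousOn.intervalIntegrable_of_Icc hT0.le hcm)
  have Enn : 0 ≤ ∫ t in (0:ℝ)..T, ∑ i : Fin m, (v t 1 (Fin.natAdd k i)) ^ 2 :=
    intervalIntegral.integral_nonneg hT0.le fun t _ => Finset.sum_nonneg fun i _ => sq_nonneg _
  rw [ge_iff_le, div_mul_eq_mul_div, div_le_iff₀ (by positivity)]
  have D2 := D.trans (mul_le_mul_of_nonneg_left E (sq_nonneg Λ))
  have D3 := (A.trans hw).trans (mul_le_mul_of_nonneg_left D2 hc0)
  have D4 := mul_nonneg (sq_nonneg Λ) Enn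
  nlinarith [D3, D4]
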